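/- arXiv:1707.03701 — 3 statements merged into one kernel-verified Lean document; each statement's English description precedes it below -/
import Mathlib

section
/- For n ≥ 11, the minimum of f(P(n,2),M) over all type-2 perfect matchings M of P(n,2) equals ⌈n/12⌉ + 1. -/
open SimpleGraph

/-- Vertices of the generalized Petersen graph `P(n,2)`:
`Sum.inl i` is the outer vertex `u_i`, `Sum.inr i` is the inner vertex `v_i`. -/
abbrev PV (n : ℕ) := ZMod n ⊕ ZMod n

/-- The outer vertex `u_i`. -/
def pu {n : ℕ} (i : ZMod n) : PV n := Sum.inl i

/-- The inner vertex `v_i`. -/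
def pv {n : ℕ} (i : ZMod n) : PV n := Sum.inr i

/-- The generalized Petersen graph `P(n,2)`, with edges
`u_i u_{i+2}`, `u_i v_i` (spokes) and `v_i v_{i+1}`, indices mod `n`. -/
def petersen (n : ℕ) : SimpleGraph (PV n) :=
  SimpleGraph.fromRel (fun x y =>
    (∃ i : ZMod n, x = pu i ∧ y = pu (i + 2)) ∨
    (∃ i : ZMod n, x = pu i ∧ y = pv i) ∨
    (∃ i : ZMod n, x = pv i ∧ y = pv (i + 1)))

/-- `S` is a forcing set of the perfect matching `M` of `G`:
`S ⊆ M` and `S` is contained in no other perfect matching of `G`. -/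
def IsForcingSet {V : Type*} (G : SimpleGraph V) (M : G.Subgraph) (S : Set (Sym2 V)) : Prop :=
  S ⊆ M.edgeSet ∧
    ∀ M' : G.Subgraph, M'.IsPerfectMatching → S ⊆ M'.edgeSet → M' = M

/-- The forcing number `f(G,M)`: the minimum cardinality of a forcing set of `M`. -/
noncomputable def forcingNumber {V : Type*} (G : SimpleGraph V) (M : G.Subgraph) : ℕ :=
  sInf {k | ∃ S : Set (Sym2 V), IsForcingSet G M S ∧ S.ncard = k}

/-- Block `A` starting at position `i` (length 4). -/
def blockA (n : ℕ) (i : ZMod n) : Set (Sym2 (PV n)) :=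
  {s(pu i, pu (i + 2)), s(pu (i + 1), pu (i + 3)), s(pv i, pv (i + 1)), s(pv (i + 2), pv (i + 3))}

/-- Block `B` at position `i` (length 1): a single spoke. -/
def blockB (n : ℕ) (i : ZMod n) : Set (Sym2 (PV n)) :=
  {s(pu i, pv i)}

/-- Block `C` starting at position `i` (length 3). -/
def blockC (n : ℕ) (i : ZMod n) : Set (Sym2 (PV n)) :=
  {s(pu i, pu (i + 2)), s(pu (i + 1), pv (i + 1)), s(pv (i + 2), pv (i + 3))}

/-- Block `D` starting at position `i` (length 4). -/
def blockD (n : ℕ) (i : ZMod n) : Set (Sym2 (PV n)) :=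
  {s(pu i, pu (i + 2)), s(pu (i + 1), pu (i + 3)), s(pv (i + 1), pv (i + 2)), s(pv (i + 3), pv (i + 4))}

/-- Length of an `A`/`B` block: `true` codes `A` (length 4), `false` codes `B` (length 1). -/
def abLen (b : Bool) : ℕ := if b then 4 else 1

/-- Edge set of a concatenation of `A`/`B` blocks starting at position `i`. -/
def abEdges (n : ℕ) : ZMod n → List Bool → Set (Sym2 (PV n))
  | _, [] => ∅
  | i, true :: L => blockA n i ∪ abEdges n (i + 4) L
  | i, false :: L => blockB n i ∪ abEdges n (i + 1) L

/-- A perfect matching (given as a subgraph of `P(n,2)`) has type 1 if its edge set is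
a cyclic concatenation of `A` and `B` blocks whose lengths sum to `n`. -/
def IsType1 {n : ℕ} (M : (petersen n).Subgraph) : Prop :=
  ∃ (i : ZMod n) (L : List Bool), (L.map abLen).sum = n ∧ M.edgeSet = abEdges n i L

/-- Length of a `C`/`D` block: `true` codes `C` (length 3), `false` codes `D` (length 4). -/
def cdLen (b : Bool) : ℕ := if b then 3 else 4

/-- Edge set of a concatenation of `C`/`D` blocks starting at position `i`. -/
def cdEdges (n : ℕ) : ZMod n → List Bool → Set (Sym2 (PV n))
  | _, [] => ∅
  | i, true :: L => blockC n i ∪ cdEdges n (i + 3) L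
  | i, false :: L => blockD n i ∪ cdEdges n (i + 4) L

/-- A perfect matching (given as a subgraph of `P(n,2)`) has type 2 if its edge set is
a cyclic concatenation of `C` and `D` blocks whose lengths sum to `n`. -/
def IsType2 {n : ℕ} (M : (petersen n).Subgraph) : Prop :=
  ∃ (i : ZMod n) (L : List Bool), (L.map cdLen).sum = n ∧ M.edgeSet = cdEdges n i L

/-- A set of prescribed edges `u_z u_{z+2}`, `u_z v_z`, `v_z v_{z+1}` at one position `z`. -/
abbrev Label := Bool × Bool × Bool

/-- Inclusion of labels. -/
def Label.le (ρ l : Label) : Bool := (!ρ.1 || l.1) && (!ρ.2.1 || l.2.1) && (!ρ.2.2 || l.2.2)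

/-- The number of edges of a label. -/
def Label.size (ρ : Label) : ℕ := ρ.1.toNat + ρ.2.1.toNat + ρ.2.2.toNat

/-- All labels. -/
def labels : List Label :=
  [(false, false, false), (false, false, true), (false, true, false), (false, true, true),
    (true, false, false), (true, false, true), (true, true, false), (true, true, true)]

/-- The transfer digraph of perfect matchings of `P(n,2)`. The state `4 * a + 2 * b + c` at position
`z` tells whether `u_{z-2} u_z`, `u_{z-1} u_{z+1}`, `v_{z-1} v_z` are matching edges. -/
def succs : ℕ → List ℕ
  | 0 => [0, 3]
  | 1 => [2]
  | 2 => [4, 7]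
  | 3 => [6]
  | 4 => [1]
  | 5 => [0]
  | 6 => [5]
  | 7 => [4]
  | _ => []

/-- The matching edges at a position, read from the states before and after it. -/
def letter (s t : ℕ) : Label :=
  (t.testBit 1, (s == 0 && t == 0) || (s == 2 && t == 4), t.testBit 0)

/-- The successors of `s` along which the edges prescribed by `ρ` are matching edges. -/
def moves (ρ : Label) (s : ℕ) : List ℕ := (succs s).filter fun t => ρ.le (letter s t)

/-- The set of the members of `l`, encoded in binary. -/
def mask (l : List ℕ) : ℕ := l.foldr (fun c D => 2 ^ c ||| D) 0

/-- The codes of the deviations possible after one more step with label `ρ` of a reference walk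
leaving state `m`, if `D` encodes the deviations possible before. The code `8 * i + s` stands for
the state `s` reached by a walk from the `i`-th starting state. -/
def deviations (ρ : Label) (m m' D : ℕ) : List ℕ :=
  ((moves ρ m).filter fun t => t != m') ++
    ((List.range 32).filter fun c => D.testBit c).flatMap fun c =>
      (moves ρ (c % 8)).map fun t => 8 * (c / 8) + t

/-- The entries of `T` (see `Tracks`) are closed under steps with labels contained in `allowed`,
unless a deviation rejoins the reference walk. -/
def stepCheck (W : ℕ) (allowed : Label) (T : List ℕ) : Bool :=
  T.all fun N => (succs (N % 8)).all fun m' => labels.all fun ρ =>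
    !(ρ.le (letter (N % 8) m') && ρ.le allowed) ||
      (mask (deviations ρ (N % 8) m' (N / 512))).testBit m' ||
      T.any fun N' => N' % 8 == m' && Nat.ble (N' / 8 % 64 + 1) (N / 8 % 64 + W * ρ.size) &&
        (N' / 512) &&& mask (deviations ρ (N % 8) m' (N / 512)) == N' / 512

/-- Every entry of `T` from which the reference walk closes by a step with a label containing `base`
has large weight or allows a closed deviation. -/
def closeCheck (W c : ℕ) (base : Label) (starts : List ℕ) (T : List ℕ) : Bool :=
  T.all fun N => (succs (N % 8)).all fun m' => labels.all fun ρ =>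
    !(ρ.le (letter (N % 8) m') && base.le ρ) || !(m' == starts.headD 0) ||
      Nat.ble (21 + c) (N / 8 % 64 + W * ρ.size) ||
      (List.range starts.length).any fun i => Nat.blt (starts.getD i 0) 8 &&
        (mask (deviations ρ (N % 8) m' (N / 512))).testBit (8 * i + starts.getD i 0)

/-- The codes of the walks which start away from the reference walk. -/
def startCodes (starts : List ℕ) : List ℕ :=
  ((List.range starts.length).filter fun i =>
    Nat.blt (starts.getD i 0) 8 && starts.getD i 0 != starts.headD 0).map fun i =>
      8 * i + starts.getD i 0

/-- The table `T` contains an entry valid for the walks of length `0`. -/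
def initCheck (starts : List ℕ) (T : List ℕ) : Bool :=
  T.any fun N => N % 8 == starts.headD 0 && Nat.ble (N / 8 % 64) 20 &&
    (N / 512) &&& mask (startCodes starts) == N / 512

/-- Entries for walks starting behind a prescribed spoke. -/
def spokeTable : List ℕ :=
  [131236, 13828236, 13763716, 260, 13830260, 65772, 13765732, 12583108, 1252, 13831260,
   12648636, 67796, 3268, 8521884, 8388860, 4326556, 4194556, 68796, 4260068, 2300, 1179801,
   13770881, 13764729, 5243097, 249, 13836393, 8417, 4325561, 2265, 13838417, 5308593, 4333745,
   73929, 5447825, 4194545, 1181841, 1048817, 131313, 75953, 139481, 9568402, 13763706,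
   13836402, 8519890, 242, 13771874, 9437378, 1242, 1179826, 73938, 13837386, 9502890, 8528042,
   1180842, 9410, 9577610, 131306, 9642122, 8388842, 74922, 13770895, 271, 13772919, 5243095,
   13771887, 9437391, 5382351, 8431, 10455, 9576623, 9423, 13773895, 5244071, 9439399, 1048839,
   12591271, 4194567, 8388871, 1188071, 4202727, 11431, 1287, 2311]

/-- Entries for walks starting in state `2` behind a prescribed edge `u_z u_{z+2}`, if no spokes
are prescribed. -/
def pTable2 : List ℕ :=
  [1101660160162, 34661860490, 1239401308290, 2147483850, 1179850, 210, 55076594802,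
   36785094842, 36549173434, 34393424050, 301991090, 13763762, 1210, 303169706, 2449547434,
   73906, 192515613786, 36785160354, 173988257954, 3523224730, 13771930, 9378, 3536979090,
   191437612162, 3523290242, 13837442, 9502922, 8528074, 74890, 3536987258, 2425356482,
   3537052770, 2425421994, 2189566122, 9642154, 2459051146, 2459115658, 138521149596,
   17217619092, 33554652, 4194524, 228, 1239401302148, 139594825924, 1073807556, 9633988, 65740,
   55076588660, 3233808572, 33555644, 1220, 1274847366252, 1238330574004, 1237253816492,
   2449541292, 13830316, 67764, 157077865636, 2459107492, 3523218588, 13765788, 3236,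
   173988251796, 3523284116, 13831316, 68764, 3537045644, 2189557964, 3536981116, 3537046644,
   2181040316, 8521916, 4326588, 2244, 2189559964, 1111622812, 138521092255, 1073742055,
   8388839, 239, 1239401244807, 1099781112015, 158151615615, 2425356487, 1073750215, 9576647,
   8399, 1237253759151, 2449483951, 13772975, 10423, 2459050151, 3523224743, 13771943, 9391,
   1292027178071, 1118038918303, 1136296724639, 3536988303, 1347420375, 3536987271, 3523226751,
   1342178503, 2415921351, 13773951, 5244103, 9439431, 12591303, 11399, 1231, 2255, 3536989279,
   1347421351, 2425358503, 3233816743, 17217626257, 34661861513, 268435665, 131281, 217,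
   158151680121, 18523160769, 18257805497, 33562809, 13770937, 8385, 1111621809, 301992113,
   2233, 1257667504225, 1118038982825, 157068437673, 157077872801, 3523289249, 13836449, 73897,
   3536986265, 1255511629961, 3523291273, 13838473, 5308625, 75921, 3537051777, 3537053801,
   1347485873, 1181873, 1381179537, 303171729]

/-- Entries for walks starting in state `7` behind a prescribed edge `u_z u_{z+2}`, if no spokes
are prescribed. -/
def pTable7 : List ℕ :=
  [36508270759, 1273760981127, 1099781112015, 247, 1239098073295, 1236951769295, 1292027177071,
   1118038917303, 1271612319927, 1271324092599, 1237253759151, 8407, 1256579933359,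
   1254144222383, 10431, 9399, 1292027178047, 1118038918279, 1136296724615, 1240184397959,
   1100589564111, 1101667500239, 1292013415559, 1118033675471, 1136287287503, 1288503962759,
   1116696741071, 1133880805583, 1236963172559, 1257667437671, 1101936984239, 1238028525743,
   11407, 1239, 2263, 1239409631375, 1274847307895, 1100859048127, 1238032711836, 1273761038468,
   1239098130636, 1236951826636, 1257663235196, 139594825924, 236, 155692565700, 154628392132,
   1292027234412, 1271612377268, 1271324149940, 173988249772, 1237253816492, 65748, 1228,
   192501779620, 188992326820, 1292027235412, 1292013472924, 1288504020124, 67772, 3244,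
   173988251772, 155730445436, 137472639172, 138516889796, 68772, 173979732164, 171807213764,
   154623149252, 1238028583084, 192515542108, 140672762020, 154652509348, 2252, 1239409688716,
   1274847365236, 139628511412, 154656571537, 17184063705, 1257663242361, 155692572865,
   154628399297, 18257805497, 225, 51573164217, 1292027240545, 1256579997865, 1254144286889,
   8393, 2241, 1292027242569, 1118038982801, 1292013480081, 1118033739993, 1288504027281, 73905,
   1255511629937, 51842779249, 17449353401, 17213554873, 75929, 51540789433, 154652516513,
   18291490969, 158155808897, 1257667502185, 51841728650, 34628174034, 34359869650,
   192515540082, 51573163194, 51553371322, 34393424050, 218, 1271612383410, 1292027176026,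
   1136296722594, 192501785762, 188992332962, 1218, 73914, 1292027241538, 1136296788106,
   173988257930, 1292013479050, 173979738322, 1288504026250, 1133880869074, 9386, 191437612138,
   1273769435242, 36515610802, 74898, 1271319961778, 34662908050, 55076586618, 192515548258,
   36785094826]

/-- Entries for walks starting in state `1` behind a prescribed edge `v_z v_{z+1}`, if only such
edges are prescribed. -/
def rTable1 : List ℕ :=
  [1100586418337, 36809351305, 1240474978433, 55076659313, 1238330507441, 209, 1257667504225,
   192515614809, 18527355041, 8377, 2225, 157077874825, 1255511629953, 73889, 75913,
   137480896666, 1240474977410, 158151680122, 1274847306858, 157068427434, 202, 192515613786,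
   1292027241554, 36549304474, 1202, 73898, 191437612154, 9370, 74882, 17486119060, 36809344140,
   36507353300, 158151673980, 36549165244, 220, 1274847300716, 36549298356, 1257667497060,
   55064068260, 65732, 1212, 1238331753620, 173988251788, 157077867660, 67756, 3228, 68756,
   2236, 17486061719, 17452499167, 158151616639, 18523095239, 231, 55076594807, 18527290559,
   1257667439719, 55064010919, 8391, 1292027178063, 1118038918295, 1238331696279, 10415, 9383,
   11391, 1223]

/-- Entries for walks starting in state `7` behind a prescribed edge `v_z v_{z+1}`, if only such
edges are prescribed. -/
def rTable7 : List ℕ :=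
  [18254659751, 55064010887, 247, 192515549295, 18559803575, 157082069175, 1292027176039, 8407,
   158151616671, 10431, 9399, 1292027178047, 1118038918279, 1238028525751, 11407, 1239,
   1273769371807, 1099781112039, 1237253759175, 34401681564, 55064068228, 18254856396,
   1274843104380, 236, 192515606636, 18559860916, 157082126516, 36809344172, 1255511621804,
   65748, 1292027169884, 1228, 1292027235412, 158151674012, 67772, 1255511622788, 3244,
   173988251772, 68772, 1238028583092, 154652509356, 2252, 139594825948, 1237253816516,
   1237256765585, 1099784257753, 1274843111545, 1100854853825, 34402869441, 1257667430513,
   1118038917305, 225, 1292027240545, 36809351337, 1240474978465, 191437611169, 8393, 2241,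
   1292027242569, 1118038982801, 55076659345, 73905, 191437613177, 17449353409, 1255511629937,
   75929, 154652516521, 51842779297, 18257805521, 157068427402, 139586568402, 1257667429490,
   139628380346, 1237266334906, 192515612778, 173988249778, 218, 1292027176026, 1240474977442,
   1218, 73914, 1292027241538, 173988257930, 9386, 36515610810, 191437612138, 74898,
   51842778274, 34393424074]

theorem mem_moves {ρ : Label} {s t : ℕ} :
    t ∈ moves ρ s ↔ t ∈ succs s ∧ ρ.le (letter s t) = true := by
  simp [moves]

theorem lt_eight_of_mem_succs {s t : ℕ} (h : t ∈ succs s) : s < 8 ∧ t < 8 := by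
  unfold succs at h
  split at h <;> simp at h <;> omega

theorem mem_labels (ρ : Label) : ρ ∈ labels := by
  obtain ⟨a, b, c⟩ := ρ
  revert a b c
  decide

theorem testBit_mask (l : List ℕ) (c : ℕ) : (mask l).testBit c = true ↔ c ∈ l := by
  induction l with
  | nil => simp [mask]
  | cons a l ih =>
    change (2 ^ a ||| mask l).testBit c = true ↔ _
    rw [Nat.testBit_or, Bool.or_eq_true, ih, Nat.testBit_two_pow, List.mem_cons]
    simp [eq_comm]

/-- `Deviates X ρ σ t s`: some walk from `σ` to `s` of length `t`, obeying the labels `ρ`,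
differs from the walk `X`. -/
inductive Deviates (X : ℕ → ℕ) (ρ : ℕ → Label) (σ : ℕ) : ℕ → ℕ → Prop
  | start : σ ≠ X 0 → Deviates X ρ σ 0 σ
  | step {t s s' : ℕ} : Deviates X ρ σ t s → s' ∈ moves (ρ t) s → Deviates X ρ σ (t + 1) s'
  | leave {t s' : ℕ} : σ = X 0 → s' ∈ moves (ρ t) (X t) → s' ≠ X (t + 1) →
      Deviates X ρ σ (t + 1) s'

theorem Deviates.exists_walk {X : ℕ → ℕ} {ρ : ℕ → Label} {σ t s : ℕ}
    (hX : ∀ t, X (t + 1) ∈ moves (ρ t) (X t)) (h : Deviates X ρ σ t s) :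
    ∃ y : ℕ → ℕ, y 0 = σ ∧ y t = s ∧ (∀ j < t, y (j + 1) ∈ moves (ρ j) (y j)) ∧
      ∃ j ≤ t, y j ≠ X j := by
  induction h with
  | start h => exact ⟨fun _ => σ, rfl, rfl, by simp, 0, le_rfl, h⟩
  | @step t s s' _ hs ih =>
    obtain ⟨y, h0, ht, hy, j, hj, hne⟩ := ih
    refine ⟨fun i => if i ≤ t then y i else s', by simpa using h0, by simp, fun i hi => ?_,
      j, by omega, by simpa [hj] using hne⟩
    rcases Nat.lt_succ_iff_lt_or_eq.1 hi with h | rfl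
    · simpa [h.le, Nat.succ_le_of_lt h] using hy i h
    · simpa [ht] using hs
  | @leave t s' hσ hs hne =>
    refine ⟨fun i => if i ≤ t then X i else s', by simpa using hσ.symm, by simp, fun i hi => ?_,
      t + 1, le_rfl, by simpa using hne⟩
    rcases Nat.lt_succ_iff_lt_or_eq.1 hi with h | rfl
    · simpa [h.le, Nat.succ_le_of_lt h] using hX i
    · simpa using hs

theorem Deviates.follow {X : ℕ → ℕ} {ρ : ℕ → Label} {σ t : ℕ}
    (hX : ∀ t, X (t + 1) ∈ moves (ρ t) (X t)) (h : Deviates X ρ σ t (X t)) (k : ℕ) :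
    Deviates X ρ σ (t + k) (X (t + k)) := by
  induction k with
  | zero => exact h
  | succ k ih => exact ih.step (hX _)

/-- The walk `X` has reached the state `N % 8` after `t` steps, the labels used so far weigh
`t + N / 8 % 64 - 20` at least, and all deviations recorded in `N / 512` are possible. -/
def Tracks (X : ℕ → ℕ) (ρ : ℕ → Label) (W : ℕ) (starts : List ℕ) (t N : ℕ) : Prop :=
  N % 8 = X t ∧ N / 8 % 64 + t ≤ 20 + W * ∑ j ∈ Finset.range t, (ρ j).size ∧
    ∀ c < 32, (N / 512).testBit c = true → Deviates X ρ (starts.getD (c / 8) 0) t (c % 8)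

theorem deviates_of_mem_deviations {X : ℕ → ℕ} {ρ : ℕ → Label} {W t N c : ℕ} {starts : List ℕ}
    (h0 : X 0 = starts.headD 0) (hN : Tracks X ρ W starts t N)
    (hc : c ∈ deviations (ρ t) (N % 8) (X (t + 1)) (N / 512)) :
    Deviates X ρ (starts.getD (c / 8) 0) (t + 1) (c % 8) := by
  obtain ⟨hm, -, hdev⟩ := hN
  rw [hm] at hc
  rcases List.mem_append.1 hc with hc | hc
  · rw [List.mem_filter] at hc
    have h8 := (lt_eight_of_mem_succs (mem_moves.1 hc.1).1).2
    rw [Nat.div_eq_of_lt h8, Nat.mod_eq_of_lt h8]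
    refine .leave ?_ hc.1 (by simpa using hc.2)
    rw [h0]
    cases starts <;> rfl
  · rw [List.mem_flatMap] at hc
    obtain ⟨b, hb, hc⟩ := hc
    rw [List.mem_filter, List.mem_range] at hb
    obtain ⟨s, hs, rfl⟩ := List.mem_map.1 hc
    have h8 := (lt_eight_of_mem_succs (mem_moves.1 hs).1).2
    rw [show (8 * (b / 8) + s) / 8 = b / 8 by omega, show (8 * (b / 8) + s) % 8 = s by omega]
    exact (hdev b hb.1 hb.2).step hs

theorem exists_tracks {X : ℕ → ℕ} {ρ : ℕ → Label} {W n : ℕ} {allowed : Label}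
    {starts T : List ℕ} (hX : ∀ t, X (t + 1) ∈ moves (ρ t) (X t))
    (hρ : ∀ t, (ρ t).le allowed = true) (h0 : X 0 = starts.headD 0)
    (hinit : initCheck starts T = true) (hstep : stepCheck W allowed T = true)
    (hno : ¬ Deviates X ρ (X 0) n (X n)) {t : ℕ} (ht : t ≤ n) :
    ∃ N ∈ T, Tracks X ρ W starts t N := by
  induction t with
  | zero =>
    simp only [initCheck, List.any_eq_true, Bool.and_eq_true, beq_iff_eq, Nat.ble_eq] at hinit
    obtain ⟨N, hN, ⟨hm, hφ⟩, hD⟩ := hinit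
    refine ⟨N, hN, by rw [hm, h0], by simpa using hφ, fun c hc hbit => ?_⟩
    rw [← hD, Nat.testBit_and, Bool.and_eq_true, testBit_mask] at hbit
    obtain ⟨i, hi, rfl⟩ := List.mem_map.1 hbit.2
    rw [List.mem_filter, Bool.and_eq_true, Nat.blt_eq, bne_iff_ne] at hi
    rw [show (8 * i + starts.getD i 0) / 8 = i by omega,
      show (8 * i + starts.getD i 0) % 8 = starts.getD i 0 by omega]
    exact .start (by rw [h0]; exact hi.2.2)
  | succ t ih =>
    obtain ⟨N, hN, hT⟩ := ih (by omega)
    obtain ⟨hm, hφ, hdev⟩ := hT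
    have hmv := mem_moves.1 (hX t)
    simp only [stepCheck, List.all_eq_true] at hstep
    have h := hstep N hN (X (t + 1)) (by rw [hm]; exact hmv.1) (ρ t) (mem_labels _)
    rw [hm, hmv.2, hρ t, ← hm] at h
    simp only [Bool.and_self, Bool.not_true, Bool.false_or, Bool.or_eq_true, List.any_eq_true,
      Bool.and_eq_true, beq_iff_eq, Nat.ble_eq] at h
    rcases h with h | ⟨N', hN', ⟨hm', hφ'⟩, hD⟩
    · have h8 := (lt_eight_of_mem_succs hmv.1).2
      have := deviates_of_mem_deviations h0 ⟨hm, hφ, hdev⟩ ((testBit_mask _ _).1 h)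
      rw [Nat.div_eq_of_lt h8, Nat.mod_eq_of_lt h8] at this
      have h' := this.follow hX (n - (t + 1))
      rw [Nat.add_sub_cancel' ht] at h'
      refine absurd ?_ hno
      convert h' using 1
      rw [h0]
      cases starts <;> rfl
    · refine ⟨N', hN', hm', ?_, fun c hc hbit => ?_⟩
      · rw [Finset.sum_range_succ, mul_add]
        omega
      · rw [← hD, Nat.testBit_and, Bool.and_eq_true, testBit_mask] at hbit
        exact deviates_of_mem_deviations h0 ⟨hm, hφ, hdev⟩ hbit.2

theorem le_sum_size {X : ℕ → ℕ} {ρ : ℕ → Label} {W c n : ℕ} {base allowed : Label}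
    {starts T : List ℕ} (hX : ∀ t, X (t + 1) ∈ moves (ρ t) (X t))
    (hρ : ∀ t, (ρ t).le allowed = true) (h0 : X 0 = starts.headD 0)
    (hend : X (n + 1) = X 0) (hbase : base.le (ρ n) = true)
    (hno : ∀ σ, ¬ Deviates X ρ σ (n + 1) σ)
    (hinit : initCheck starts T = true) (hstep : stepCheck W allowed T = true)
    (hclose : closeCheck W c base starts T = true) :
    c + (n + 1) ≤ W * ∑ j ∈ Finset.range (n + 1), (ρ j).size := by
  obtain ⟨N, hN, hT⟩ := exists_tracks (n := n + 1) hX hρ h0 hinit hstep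
    (by rw [hend]; exact hno _) (Nat.le_succ n)
  obtain ⟨hm, hφ, hdev⟩ := hT
  have hmv := mem_moves.1 (hX n)
  simp only [closeCheck, List.all_eq_true] at hclose
  have h := hclose N hN (X (n + 1)) (by rw [hm]; exact hmv.1) (ρ n) (mem_labels _)
  rw [hm, hmv.2, hbase, ← hm, hend, h0] at h
  simp only [Bool.and_self, Bool.not_true, Bool.false_or, Bool.or_eq_true, List.any_eq_true,
    beq_self_eq_true, Nat.ble_eq, Bool.and_eq_true, Nat.blt_eq] at h
  rcases h with h | ⟨i, -, h8, h⟩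
  · rw [Finset.sum_range_succ, mul_add]
    omega
  · rw [testBit_mask, ← h0, ← hend] at h
    have := deviates_of_mem_deviations h0 ⟨hm, hφ, hdev⟩ h
    rw [show (8 * i + starts.getD i 0) / 8 = i by omega,
      show (8 * i + starts.getD i 0) % 8 = starts.getD i 0 by omega] at this
    exact absurd this (hno _)

/-- Closed walks of length `n` in the transfer digraph which contain all edges prescribed
by `ℓ`. -/
def IsWalk {n : ℕ} (ℓ : ZMod n → Label) (x : ZMod n → ℕ) : Prop :=
  ∀ z, x (z + 1) ∈ moves (ℓ z) (x z)

theorem exists_isWalk {n : ℕ} [NeZero n] {ℓ : ZMod n → Label} (z₀ : ZMod n) {y : ℕ → ℕ}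
    (hy : ∀ j < n, y (j + 1) ∈ moves (ℓ (z₀ + j)) (y j)) (hend : y n = y 0) :
    ∃ w, IsWalk ℓ w ∧ ∀ j < n, w (z₀ + j) = y j := by
  refine ⟨fun z => y (z - z₀).val, fun z => ?_, fun j hj => ?_⟩
  · have hlt := ZMod.val_lt (z - z₀)
    have hz : z = z₀ + ((z - z₀).val : ZMod n) := by simp
    have hval : (z + 1 - z₀).val = ((z - z₀).val + 1) % n := by
      rw [← ZMod.val_natCast, Nat.cast_add, ZMod.natCast_zmod_val, Nat.cast_one]
      congr 1
      ring
    have h := hy _ hlt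
    rw [← hz] at h
    simp only [hval]
    rcases Nat.lt_or_ge ((z - z₀).val + 1) n with h' | h'
    · rwa [Nat.mod_eq_of_lt h']
    · have : (z - z₀).val + 1 = n := by omega
      rw [this, Nat.mod_self, ← hend]
      rwa [this] at h
  · simp [ZMod.val_natCast, Nat.mod_eq_of_lt hj]

theorem sum_range_zmod {n : ℕ} [NeZero n] (z₀ : ZMod n) (f : ZMod n → ℕ) :
    ∑ j ∈ Finset.range n, f (z₀ + j) = ∑ z, f z := by
  refine Finset.sum_bij (fun j _ => z₀ + j) (by simp) (fun a ha b hb h => ?_)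
    (fun z _ => ⟨(z - z₀).val, by simpa using ZMod.val_lt _, by simp⟩) (fun _ _ => rfl)
  have := congrArg ZMod.val (add_left_cancel h)
  rw [Finset.mem_range] at ha hb
  rwa [ZMod.val_natCast, ZMod.val_natCast, Nat.mod_eq_of_lt ha, Nat.mod_eq_of_lt hb] at this

theorem le_sum_size_of_unique {n : ℕ} [NeZero n] {ℓ : ZMod n → Label} {x : ZMod n → ℕ}
    (hx : IsWalk ℓ x) (huniq : ∀ w, IsWalk ℓ w → w = x) {W c : ℕ} {base allowed : Label}
    {starts T : List ℕ} (hallowed : ∀ z, (ℓ z).le allowed = true) (z : ZMod n)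
    (hbase : base.le (ℓ z) = true) (h0 : x (z + 1) = starts.headD 0)
    (hinit : initCheck starts T = true) (hstep : stepCheck W allowed T = true)
    (hclose : closeCheck W c base starts T = true) :
    c + n ≤ W * ∑ z, (ℓ z).size := by
  obtain ⟨k, rfl⟩ := Nat.exists_eq_succ_of_ne_zero (NeZero.ne n)
  have hX : ∀ t : ℕ, x (z + 1 + (t + 1 : ℕ)) ∈ moves (ℓ (z + 1 + t)) (x (z + 1 + t)) :=
    fun t => by simpa [add_assoc] using hx (z + 1 + t)
  have hcast : z + 1 + (k : ZMod (k + 1)) = z := by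
    rw [add_assoc, add_comm 1, ← Nat.cast_succ, ZMod.natCast_self, add_zero]
  rw [← sum_range_zmod (z + 1)]
  refine le_sum_size (X := fun t => x (z + 1 + t)) (ρ := fun t => ℓ (z + 1 + t)) hX
    (fun t => hallowed _) (by simpa using h0) ?_ (by simpa only [hcast] using hbase) ?_
    hinit hstep hclose
  · simp only [Nat.cast_succ, ← add_assoc, hcast, Nat.cast_zero, add_zero]
  · intro σ hσ
    obtain ⟨y, hy0, hyn, hy, j, hj, hne⟩ := hσ.exists_walk hX
    obtain ⟨w, hw, hwy⟩ := exists_isWalk (z + 1) hy (by rw [hy0, hyn])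
    rw [huniq w hw] at hwy
    rcases Nat.lt_succ_iff_lt_or_eq.1 (Nat.lt_succ_of_le hj) with h | rfl
    · exact hne (hwy j h).symm
    · refine hne ?_
      rw [hyn, ← hy0, ← hwy 0 (Nat.succ_pos k)]
      simp only [Nat.cast_succ, ← add_assoc, hcast, Nat.cast_zero, add_zero]

/-- The states of odd weight are visited by type-2 matchings, the others by type-1 matchings. -/
def oddStates : List ℕ := [1, 2, 4, 7]

theorem mem_oddStates_of_mem_succs {s t : ℕ} (hs : s ∈ oddStates) (ht : t ∈ succs s) :
    t ∈ oddStates := by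
  revert t
  revert s
  decide

theorem IsWalk.mem_oddStates {n : ℕ} [NeZero n] {ℓ : ZMod n → Label} {x : ZMod n → ℕ}
    (hx : IsWalk ℓ x) {z₀ : ZMod n} (h : x z₀ ∈ oddStates) (z : ZMod n) : x z ∈ oddStates := by
  have key : ∀ j : ℕ, x (z₀ + j) ∈ oddStates := by
    intro j
    induction j with
    | zero => simpa using h
    | succ j ih =>
      have := mem_oddStates_of_mem_succs ih (mem_moves.1 (hx _)).1
      simpa [add_assoc] using this
  simpa using key (z - z₀).val

theorem length_le_of_unique {n : ℕ} [NeZero n] (hn : 11 ≤ n) {ℓ : ZMod n → Label}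
    {x : ZMod n → ℕ} (hx : IsWalk ℓ x) (huniq : ∀ w, IsWalk ℓ w → w = x)
    {z₀ : ZMod n} (hodd : x z₀ ∈ oddStates) : n + 12 ≤ 12 * ∑ z, (ℓ z).size := by
  have hodd := hx.mem_oddStates hodd
  have hletter := fun z => (mem_moves.1 (hx z)).2
  by_cases hq : ∃ z, (ℓ z).2.1 = true
  · obtain ⟨z, hz⟩ := hq
    have h4 : x (z + 1) = 4 := by
      have h1 := hletter z
      have h2 := hodd z
      simp [Label.le, letter, hz] at h1
      simp [oddStates] at h2
      omega
    have := le_sum_size_of_unique hx huniq (starts := [4, 0]) (fun z => by simp [Label.le])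
      z (by simp [Label.le, hz]) h4 (T := spokeTable) (W := 12) (c := 12)
      (base := (false, true, false)) (allowed := (true, true, true))
      (by decide +kernel) (by decide +kernel) (by decide +kernel)
    omega
  push Not at hq
  by_cases hp : ∃ z, (ℓ z).1 = true
  · obtain ⟨z, hz⟩ := hp
    have h27 : x (z + 1) = 2 ∨ x (z + 1) = 7 := by
      have h1 := hletter z
      have h2 := hodd (z + 1)
      simp [Label.le, letter, hz] at h1
      simp [oddStates] at h2
      rcases h2 with h | h | h | h <;> simp [h, Nat.testBit_succ] at h1 ⊢
    have hall : ∀ z, (ℓ z).le (true, false, true) = true := fun z => by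
      simp [Label.le, hq z]
    have hbase : Label.le (true, false, false) (ℓ z) = true := by simp [Label.le, hz]
    rcases h27 with h | h
    · have := le_sum_size_of_unique hx huniq (starts := [2, 3, 6, 7]) hall z hbase h
        (T := pTable2) (W := 9) (c := 6) (by decide +kernel) (by decide +kernel)
        (by decide +kernel)
      omega
    · have := le_sum_size_of_unique hx huniq (starts := [7, 3, 6, 2]) hall z hbase h
        (T := pTable7) (W := 9) (c := 6) (by decide +kernel) (by decide +kernel)
        (by decide +kernel)
      omega
  push Not at hp
  by_cases hr : ∃ z, (ℓ z).2.2 = true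
  · obtain ⟨z, hz⟩ := hr
    have h17 : x (z + 1) = 1 ∨ x (z + 1) = 7 := by
      have h1 := hletter z
      have h2 := hodd (z + 1)
      simp [Label.le, letter, hz] at h1
      simp [oddStates] at h2
      rcases h2 with h | h | h | h <;> simp [h] at h1 ⊢
    have hall : ∀ z, (ℓ z).le (false, false, true) = true := fun z => by
      simp [Label.le, hq z, hp z]
    have hbase : Label.le (false, false, true) (ℓ z) = true := by simp [Label.le, hz]
    rcases h17 with h | h
    · have := le_sum_size_of_unique hx huniq (starts := [1, 3, 5, 7]) hall z hbase h
        (T := rTable1) (W := 9) (c := 6) (by decide +kernel) (by decide +kernel)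
        (by decide +kernel)
      omega
    · have := le_sum_size_of_unique hx huniq (starts := [7, 3, 5, 1]) hall z hbase h
        (T := rTable7) (W := 9) (c := 6) (by decide +kernel) (by decide +kernel)
        (by decide +kernel)
      omega
  push Not at hr
  have h0 := huniq (fun _ => 0) fun z => by
    simp [mem_moves, succs, Label.le, hp z, hq z, hr z]
  have := hodd z₀
  rw [← h0] at this
  simp [oddStates] at this

theorem natCast_ne_zero_of_lt {n a : ℕ} (ha : a ≠ 0) (han : a < n) : (a : ZMod n) ≠ 0 := by
  rw [Ne, ZMod.natCast_eq_zero_iff]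
  exact fun h => absurd (Nat.le_of_dvd (Nat.pos_of_ne_zero ha) h) (by omega)

/-- The component of a label belonging to the edge `pedge (z, k)`. -/
def Label.has (ρ : Label) (k : Fin 3) : Bool := ![ρ.1, ρ.2.1, ρ.2.2] k

theorem Label.le_iff {ρ l : Label} : ρ.le l = true ↔ ∀ k, ρ.has k = true → l.has k = true := by
  revert ρ l
  decide

theorem Label.ext_has {ρ l : Label} (h : ∀ k, ρ.has k = l.has k) : ρ = l := by
  revert ρ l
  decide

/-- The edges of `petersen n`, indexed by position and kind. -/
def pedge {n : ℕ} (p : ZMod n × Fin 3) : Sym2 (PV n) :=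
  ![s(pu p.1, pu (p.1 + 2)), s(pu p.1, pv p.1), s(pv p.1, pv (p.1 + 1))] p.2

theorem pedge_injective {n : ℕ} (hn : 11 ≤ n) : Function.Injective (pedge (n := n)) := by
  have h2 : (2 : ZMod n) ≠ 0 := by
    exact_mod_cast natCast_ne_zero_of_lt (a := 2) (by simp) (by omega)
  have h4 : (4 : ZMod n) ≠ 0 := by
    exact_mod_cast natCast_ne_zero_of_lt (a := 4) (by simp) (by omega)
  rintro ⟨z, k⟩ ⟨w, l⟩ h
  fin_cases k <;> fin_cases l <;>
    simp [pedge, pu, pv] at h ⊢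
  · rcases h with h | ⟨h, h'⟩
    · exact h
    · exact absurd (by linear_combination h' - h) h4
  · exact h
  · rcases h with h | ⟨h, h'⟩
    · exact h
    · exact absurd (by linear_combination h' - h) h2

theorem pedge_mem_edgeSet {n : ℕ} (hn : 11 ≤ n) (p : ZMod n × Fin 3) :
    pedge p ∈ (petersen n).edgeSet := by
  have h1 : (1 : ZMod n) ≠ 0 := by
    exact_mod_cast natCast_ne_zero_of_lt (a := 1) (by simp) (by omega)
  have h2 : (2 : ZMod n) ≠ 0 := by
    exact_mod_cast natCast_ne_zero_of_lt (a := 2) (by simp) (by omega)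
  obtain ⟨z, k⟩ := p
  fin_cases k <;> simp [pedge, petersen, pu, pv, h1, h2]

theorem exists_edge_of_mem_edgeSet {n : ℕ} {e : Sym2 (PV n)} (he : e ∈ (petersen n).edgeSet) :
    ∃ p, pedge p = e := by
  induction e with | h a b
  rw [SimpleGraph.mem_edgeSet, petersen, SimpleGraph.fromRel_adj] at he
  obtain ⟨-, h | h⟩ := he <;> rcases h with ⟨i, rfl, rfl⟩ | ⟨i, rfl, rfl⟩ | ⟨i, rfl, rfl⟩
  · exact ⟨(i, 0), rfl⟩
  · exact ⟨(i, 1), rfl⟩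
  · exact ⟨(i, 2), rfl⟩
  · exact ⟨(i, 0), Sym2.eq_swap⟩
  · exact ⟨(i, 1), Sym2.eq_swap⟩
  · exact ⟨(i, 2), Sym2.eq_swap⟩

/-- The set of edges prescribed by a family of labels. -/
def edgesOf {n : ℕ} (ℓ : ZMod n → Label) : Set (Sym2 (PV n)) :=
  pedge '' {p | (ℓ p.1).has p.2 = true}

theorem pedge_mem_edgesOf {n : ℕ} (hn : 11 ≤ n) {ℓ : ZMod n → Label} {p : ZMod n × Fin 3} :
    pedge p ∈ edgesOf ℓ ↔ (ℓ p.1).has p.2 = true :=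
  (pedge_injective hn).mem_set_image

theorem edgesOf_subset_iff {n : ℕ} (hn : 11 ≤ n) {ℓ τ : ZMod n → Label} :
    edgesOf ℓ ⊆ edgesOf τ ↔ ∀ z, (ℓ z).le (τ z) = true := by
  rw [edgesOf, edgesOf, Set.image_subset_image_iff (pedge_injective hn)]
  simp only [Label.le_iff]
  exact ⟨fun h z k hk => h (a := (z, k)) hk, fun h p hp => h p.1 p.2 hp⟩

theorem edgesOf_injective {n : ℕ} (hn : 11 ≤ n) :
    Function.Injective (edgesOf (n := n)) := by
  intro ℓ τ h
  funext z
  refine Label.ext_has fun k => ?_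
  rw [Bool.eq_iff_iff, ← pedge_mem_edgesOf hn (p := (z, k)), h, pedge_mem_edgesOf hn]

theorem exists_edgesOf_eq {n : ℕ} {S : Set (Sym2 (PV n))} (hS : S ⊆ (petersen n).edgeSet) :
    ∃ ℓ, edgesOf ℓ = S := by
  classical
  refine ⟨fun z => (decide (pedge (z, 0) ∈ S), decide (pedge (z, 1) ∈ S),
    decide (pedge (z, 2) ∈ S)), ?_⟩
  ext e
  constructor
  · rintro ⟨⟨z, k⟩, h, rfl⟩
    fin_cases k <;> simpa [Label.has] using h
  · intro he
    obtain ⟨⟨z, k⟩, rfl⟩ := exists_edge_of_mem_edgeSet (hS he)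
    refine ⟨(z, k), ?_, rfl⟩
    fin_cases k <;> simpa [Label.has] using he

theorem ncard_edgesOf {n : ℕ} [NeZero n] (hn : 11 ≤ n) (ℓ : ZMod n → Label) :
    (edgesOf ℓ).ncard = ∑ z, (ℓ z).size := by
  have hsize : ∀ ρ : Label, ρ.size = ∑ k, if ρ.has k = true then 1 else 0 := by decide
  rw [edgesOf, Set.ncard_image_of_injective _ (pedge_injective hn), Set.ncard_eq_toFinset_card',
    Set.toFinset_ofPred, Finset.card_filter, Fintype.sum_prod_type]
  simp only [hsize]

/-- Exactly one of three propositions, given by Booleans, holds. -/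
def exactlyOne (a b c : Bool) : Bool := (a && !b && !c) || (!a && b && !c) || (!a && !b && c)

theorem existsUnique_iff_exactlyOne {α : Type*} {P : α → Prop} {a b c : α} (hab : a ≠ b)
    (hac : a ≠ c) (hbc : b ≠ c) (hP : ∀ w, P w → w = a ∨ w = b ∨ w = c) {x y z : Bool}
    (ha : P a ↔ x = true) (hb : P b ↔ y = true) (hc : P c ↔ z = true) :
    (∃! w, P w) ↔ exactlyOne x y z = true := by
  constructor
  · rintro ⟨w, hw, huniq⟩
    have ha' := huniq a
    have hb' := huniq b
    have hc' := huniq c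
    simp only [ha, hb, hc] at ha' hb' hc'
    rcases hP w hw with rfl | rfl | rfl <;>
      cases x <;> cases y <;> cases z <;> simp_all [exactlyOne, eq_comm]
  · intro h
    cases x <;> cases y <;> cases z <;> simp [exactlyOne] at h <;> simp at ha hb hc
    · exact ⟨c, hc, fun w hw => by rcases hP w hw with rfl | rfl | rfl <;> tauto⟩
    · exact ⟨b, hb, fun w hw => by rcases hP w hw with rfl | rfl | rfl <;> tauto⟩
    · exact ⟨a, ha, fun w hw => by rcases hP w hw with rfl | rfl | rfl <;> tauto⟩

/-- The local condition at position `z` for the edges prescribed by `τ` to form a perfect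
matching. -/
def IsPerfectLabel {n : ℕ} (τ : ZMod n → Label) : Prop :=
  ∀ z, exactlyOne (τ z).1 (τ (z - 2)).1 (τ z).2.1 = true ∧
    exactlyOne (τ z).2.2 (τ (z - 1)).2.2 (τ z).2.1 = true

theorem isPerfectMatching_iff_label {n : ℕ} (hn : 11 ≤ n) {M : (petersen n).Subgraph}
    {τ : ZMod n → Label} (hM : M.edgeSet = edgesOf τ) :
    M.IsPerfectMatching ↔ IsPerfectLabel τ := by
  have h1 : (1 : ZMod n) ≠ 0 := by
    exact_mod_cast natCast_ne_zero_of_lt (a := 1) (by simp) (by omega)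
  have h2 : (2 : ZMod n) ≠ 0 := by
    exact_mod_cast natCast_ne_zero_of_lt (a := 2) (by simp) (by omega)
  have h4 : (4 : ZMod n) ≠ 0 := by
    exact_mod_cast natCast_ne_zero_of_lt (a := 4) (by simp) (by omega)
  have hadj : ∀ z k a b, s(a, b) = pedge (z, k) → (M.Adj a b ↔ (τ z).has k = true) := by
    intro z k a b h
    rw [← SimpleGraph.Subgraph.mem_edgeSet, hM, h, pedge_mem_edgesOf hn]
  rw [SimpleGraph.Subgraph.isPerfectMatching_iff, Sum.forall, ← forall_and]
  refine forall_congr' fun z => and_congr ?_ ?_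
  · refine existsUnique_iff_exactlyOne (a := pu (z + 2)) (b := pu (z - 2)) (c := pv z) ?_
      (by simp [pu, pv]) (by simp [pu, pv]) (fun w hw => ?_) (hadj z 0 _ _ rfl)
      (hadj (z - 2) 0 _ _ ?_) (hadj z 1 _ _ rfl)
    · simp only [pu, ne_eq, Sum.inl.injEq]
      exact fun h => h4 (by linear_combination h)
    · obtain ⟨⟨i, k⟩, h⟩ :=
        exists_edge_of_mem_edgeSet ((SimpleGraph.mem_edgeSet _).2 (M.adj_sub hw))
      fin_cases k <;> simp [pedge, pu, pv] at h ⊢ <;> grind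
    · simp [pedge, Sym2.eq_swap, pu]
  · refine existsUnique_iff_exactlyOne (a := pv (z + 1)) (b := pv (z - 1)) (c := pu z) ?_
      (by simp [pu, pv]) (by simp [pu, pv]) (fun w hw => ?_) (hadj z 2 _ _ rfl)
      (hadj (z - 1) 2 _ _ ?_) (hadj z 1 _ _ Sym2.eq_swap)
    · simp only [pv, ne_eq, Sum.inr.injEq]
      exact fun h => h2 (by linear_combination h)
    · obtain ⟨⟨i, k⟩, h⟩ :=
        exists_edge_of_mem_edgeSet ((SimpleGraph.mem_edgeSet _).2 (M.adj_sub hw))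
      fin_cases k <;> simp [pedge, pu, pv] at h ⊢ <;> grind
    · simp [pedge, Sym2.eq_swap, pv]

/-- The subgraph of `petersen n` on all vertices with the edges prescribed by `τ`. -/
def subgraphOf {n : ℕ} (hn : 11 ≤ n) (τ : ZMod n → Label) : (petersen n).Subgraph where
  verts := Set.univ
  Adj a b := s(a, b) ∈ edgesOf τ
  adj_sub := by
    rintro a b ⟨p, -, hp⟩
    rw [← SimpleGraph.mem_edgeSet, ← hp]
    exact pedge_mem_edgeSet hn p
  edge_vert _ := Set.mem_univ _
  symm := ⟨fun a b h => by rwa [Sym2.eq_swap]⟩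

theorem edgeSet_subgraphOf {n : ℕ} (hn : 11 ≤ n) (τ : ZMod n → Label) :
    (subgraphOf hn τ).edgeSet = edgesOf τ := by
  ext e
  induction e with | h a b
  rfl

theorem eq_of_edgeSet_eq {V : Type*} {G : SimpleGraph V} {M M' : G.Subgraph}
    (hM : M.IsPerfectMatching) (hM' : M'.IsPerfectMatching) (h : M.edgeSet = M'.edgeSet) :
    M = M' := by
  refine SimpleGraph.Subgraph.ext ?_ ?_
  · rw [hM.2.verts_eq_univ, hM'.2.verts_eq_univ]
  · ext a b
    rw [← SimpleGraph.Subgraph.mem_edgeSet, h, SimpleGraph.Subgraph.mem_edgeSet]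

/-- The labels read along a walk. -/
def letters {n : ℕ} (x : ZMod n → ℕ) (z : ZMod n) : Label := letter (x z) (x (z + 1))

theorem IsWalk.eq_letters {n : ℕ} {ℓ : ZMod n → Label} {x : ZMod n → ℕ} (hx : IsWalk ℓ x)
    (z : ZMod n) : x z = 4 * (letters x (z - 2)).1.toNat + 2 * (letters x (z - 1)).1.toNat +
      (letters x (z - 1)).2.2.toNat := by
  have h1 := (mem_moves.1 (hx (z - 2))).1
  have h2 := (mem_moves.1 (hx (z - 1))).1
  have e1 : z - 2 + 1 = z - 1 := by ring
  simp only [letters, e1, sub_add_cancel] at h1 h2 ⊢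
  have hs := (lt_eight_of_mem_succs h1).1
  revert h1 h2
  generalize x (z - 2) = a at *
  generalize x (z - 1) = b
  generalize x z = c
  intro h1 h2
  have hfin : ∀ a < 8, ∀ b ∈ succs a, ∀ c ∈ succs b, c = 4 * (letter a b).1.toNat +
      2 * (letter b c).1.toNat + (letter b c).2.2.toNat := by decide
  exact hfin a hs b h1 c h2

theorem IsWalk.isPerfectLabel {n : ℕ} {ℓ : ZMod n → Label} {x : ZMod n → ℕ} (hx : IsWalk ℓ x) :
    IsPerfectLabel (letters x) := by
  intro z
  have h1 := (mem_moves.1 (hx (z - 2))).1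
  have h2 := (mem_moves.1 (hx (z - 1))).1
  have h3 := (mem_moves.1 (hx z)).1
  have e1 : z - 2 + 1 = z - 1 := by ring
  simp only [letters, e1, sub_add_cancel] at h1 h2 ⊢
  have hs := (lt_eight_of_mem_succs h1).1
  have hfin : ∀ a < 8, ∀ b ∈ succs a, ∀ c ∈ succs b, ∀ d ∈ succs c,
      exactlyOne (letter c d).1 (letter a b).1 (letter c d).2.1 = true ∧
      exactlyOne (letter c d).2.2 (letter b c).2.2 (letter c d).2.1 = true := by decide
  exact hfin _ hs _ h1 _ h2 _ h3

theorem IsPerfectLabel.exists_isWalk {n : ℕ} {τ : ZMod n → Label} (hτ : IsPerfectLabel τ) :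
    ∃ x, letters x = τ ∧ ∀ z, x (z + 1) ∈ succs (x z) := by
  let x : ZMod n → ℕ := fun z => 4 * (τ (z - 2)).1.toNat + 2 * (τ (z - 1)).1.toNat +
    (τ (z - 1)).2.2.toNat
  have key : ∀ z, letter (x z) (x (z + 1)) = τ z ∧ x (z + 1) ∈ succs (x z) := by
    intro z
    have e1 : z + 1 - 2 = z - 1 := by ring
    have hfin : ∀ (ρ : Label) (a b c : Bool), exactlyOne ρ.1 a ρ.2.1 = true ∧
        exactlyOne ρ.2.2 c ρ.2.1 = true →
        letter (4 * a.toNat + 2 * b.toNat + c.toNat)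
          (4 * b.toNat + 2 * ρ.1.toNat + ρ.2.2.toNat) = ρ ∧
        4 * b.toNat + 2 * ρ.1.toNat + ρ.2.2.toNat ∈
          succs (4 * a.toNat + 2 * b.toNat + c.toNat) := by decide
    simp only [x, e1, add_sub_cancel_right]
    exact hfin _ _ _ _ (hτ z)
  exact ⟨x, funext fun z => (key z).1, fun z => (key z).2⟩

theorem isWalk_iff {n : ℕ} {ℓ : ZMod n → Label} {x : ZMod n → ℕ} :
    IsWalk ℓ x ↔ (∀ z, x (z + 1) ∈ succs (x z)) ∧ ∀ z, (ℓ z).le (letters x z) = true := by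
  simp only [IsWalk, mem_moves, forall_and, letters]

theorem IsWalk.eq_of_letters_eq {n : ℕ} {ℓ τ : ZMod n → Label} {x y : ZMod n → ℕ}
    (hx : IsWalk ℓ x) (hy : IsWalk τ y) (h : letters x = letters y) : x = y := by
  funext z
  rw [hx.eq_letters, hy.eq_letters, h]

theorem IsWalk.exists_isPerfectMatching {n : ℕ} (hn : 11 ≤ n) {ℓ : ZMod n → Label}
    {x : ZMod n → ℕ} (hx : IsWalk ℓ x) :
    ∃ M : (petersen n).Subgraph, M.IsPerfectMatching ∧ M.edgeSet = edgesOf (letters x) :=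
  ⟨subgraphOf hn (letters x),
    (isPerfectMatching_iff_label hn (edgeSet_subgraphOf hn _)).2 hx.isPerfectLabel,
    edgeSet_subgraphOf hn _⟩

theorem exists_letters_of_isPerfectMatching {n : ℕ} (hn : 11 ≤ n) {M : (petersen n).Subgraph}
    (hM : M.IsPerfectMatching) :
    ∃ x, (∀ z, x (z + 1) ∈ succs (x z)) ∧ M.edgeSet = edgesOf (letters x) := by
  obtain ⟨τ, hτ⟩ := exists_edgesOf_eq M.edgeSet_subset
  obtain ⟨x, rfl, hx⟩ := ((isPerfectMatching_iff_label hn hτ.symm).1 hM).exists_isWalk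
  exact ⟨x, hx, hτ.symm⟩

theorem isForcingSet_edgesOf_iff {n : ℕ} (hn : 11 ≤ n) {M : (petersen n).Subgraph}
    (hM : M.IsPerfectMatching) {x : ZMod n → ℕ} (hx : ∀ z, x (z + 1) ∈ succs (x z))
    (hMx : M.edgeSet = edgesOf (letters x)) (ℓ : ZMod n → Label) :
    IsForcingSet (petersen n) M (edgesOf ℓ) ↔ IsWalk ℓ x ∧ ∀ w, IsWalk ℓ w → w = x := by
  rw [IsForcingSet, hMx, edgesOf_subset_iff hn]
  constructor
  · rintro ⟨hle, huniq⟩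
    have hxw : IsWalk ℓ x := isWalk_iff.2 ⟨hx, hle⟩
    refine ⟨hxw, fun w hw => ?_⟩
    obtain ⟨M', hM', hMw⟩ := hw.exists_isPerfectMatching hn
    have h := huniq M' hM' (by rw [hMw, edgesOf_subset_iff hn]; exact (isWalk_iff.1 hw).2)
    rw [h, hMx] at hMw
    exact hw.eq_of_letters_eq hxw (edgesOf_injective hn hMw.symm)
  · rintro ⟨hxw, huniq⟩
    refine ⟨(isWalk_iff.1 hxw).2, fun M' hM' hsub => ?_⟩
    obtain ⟨x', hx', hMx'⟩ := exists_letters_of_isPerfectMatching hn hM'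
    rw [hMx', edgesOf_subset_iff hn] at hsub
    rw [huniq x' (isWalk_iff.2 ⟨hx', hsub⟩), ← hMx] at hMx'
    exact eq_of_edgeSet_eq hM' hM hMx'

theorem exists_mem_oddStates_of_isType2 {n : ℕ} (hn : 11 ≤ n) {M : (petersen n).Subgraph}
    (hM : IsType2 M) {x : ZMod n → ℕ} (hx : ∀ z, x (z + 1) ∈ succs (x z))
    (hMx : M.edgeSet = edgesOf (letters x)) : ∃ z, x z ∈ oddStates := by
  obtain ⟨i, L, hL, h⟩ := hM
  rw [hMx] at h
  have hlt := fun z => lt_eight_of_mem_succs (hx z)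
  rcases L with - | ⟨_ | _, L⟩
  · simp at hL
    omega
  · refine ⟨i + 2, ?_⟩
    have h0 : pedge (i, 0) ∈ edgesOf (letters x) := by
      rw [h]; exact Or.inl (by simp [blockD, pedge])
    have h1 : pedge (i + 1, 0) ∈ edgesOf (letters x) := by
      rw [h]; exact Or.inl (by simp [blockD, pedge, add_assoc]; norm_num)
    have h2 : pedge (i + 1, 2) ∈ edgesOf (letters x) := by
      rw [h]; exact Or.inl (by simp [blockD, pedge, add_assoc]; norm_num)
    rw [pedge_mem_edgesOf hn] at h0 h1 h2
    have e1 : i + 1 + 1 = i + 2 := by ring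
    have hs := hx (i + 1)
    have hs' := hlt (i + 1)
    simp only [Label.has, letters, letter, e1] at h0 h1 h2 hs hs'
    revert hs hs' h0 h1 h2
    generalize x (i + 1) = a
    generalize x (i + 2) = b
    have : ∀ a < 8, ∀ b ∈ succs a, a.testBit 1 = true → b.testBit 1 = true →
      b.testBit 0 = true → b ∈ oddStates := by decide
    exact fun h0 h1 h2 hs hs' => this a hs'.1 b hs h0 h1 h2
  · refine ⟨i + 2, ?_⟩
    have h0 : pedge (i, 0) ∈ edgesOf (letters x) := by
      rw [h]; exact Or.inl (by simp [blockC, pedge])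
    have h1 : pedge (i + 1, 1) ∈ edgesOf (letters x) := by
      rw [h]; exact Or.inl (by simp [blockC, pedge])
    rw [pedge_mem_edgesOf hn] at h0 h1
    have e1 : i + 1 + 1 = i + 2 := by ring
    simp only [Label.has, letters, letter, e1] at h0 h1
    simp at h0 h1
    rcases h1 with h1 | h1
    · simp [h1.1] at h0
    · simp [oddStates, h1.2]

theorem le_forcingNumber_of_isType2 {n : ℕ} (hn : 11 ≤ n) {M : (petersen n).Subgraph}
    (hM : M.IsPerfectMatching) (hM2 : IsType2 M) :
    (n + 11) / 12 + 1 ≤ forcingNumber (petersen n) M := by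
  have : NeZero n := ⟨by omega⟩
  obtain ⟨x, hx, hMx⟩ := exists_letters_of_isPerfectMatching hn hM
  obtain ⟨z₀, hz₀⟩ := exists_mem_oddStates_of_isType2 hn hM2 hx hMx
  have hne : {k | ∃ S, IsForcingSet (petersen n) M S ∧ S.ncard = k}.Nonempty :=
    ⟨_, M.edgeSet, ⟨subset_rfl, fun M' hM' hsub => ?_⟩, rfl⟩
  · obtain ⟨S, hS, hcard⟩ := Nat.sInf_mem hne
    obtain ⟨ℓ, rfl⟩ := exists_edgesOf_eq (hS.1.trans M.edgeSet_subset)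
    obtain ⟨hw, huniq⟩ := (isForcingSet_edgesOf_iff hn hM hx hMx ℓ).1 hS
    have := length_le_of_unique hn hw huniq hz₀
    rw [ncard_edgesOf hn] at hcard
    rw [forcingNumber, ← hcard]
    omega
  · refine SimpleGraph.Subgraph.ext ?_ ?_
    · rw [hM.2.verts_eq_univ, hM'.2.verts_eq_univ]
    · have hsub' : ∀ {a b}, M.Adj a b → M'.Adj a b := fun h =>
        SimpleGraph.Subgraph.mem_edgeSet.1 (hsub (SimpleGraph.Subgraph.mem_edgeSet.2 h))
      ext a b
      refine ⟨fun h => ?_, fun h => hsub' h⟩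
      obtain ⟨w, hw, -⟩ := SimpleGraph.Subgraph.isPerfectMatching_iff.1 hM a
      obtain ⟨w', -, hw'⟩ := SimpleGraph.Subgraph.isPerfectMatching_iff.1 hM' a
      rwa [hw' b h, ← hw' w (hsub' hw)]

/-- The states visited before each position of a concatenation of `C` and `D` blocks. -/
def blockStates : List Bool → List ℕ
  | [] => []
  | true :: L => 1 :: 2 :: 4 :: blockStates L
  | false :: L => 1 :: 2 :: 7 :: 4 :: blockStates L

theorem length_blockStates (L : List Bool) : (blockStates L).length = (L.map cdLen).sum := by
  induction L with
  | nil => rfl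
  | cons b L ih => cases b <;> simp [blockStates, cdLen, ih] <;> omega

/-- The state before position `j` of a concatenation of blocks which ends where another block
starts. -/
def blockState (L : List Bool) (j : ℕ) : ℕ := (blockStates L ++ [1]).getD j 1

theorem blockState_zero (L : List Bool) : blockState L 0 = 1 := by
  rcases L with - | ⟨_ | _, L⟩ <;> rfl

theorem blockState_length (L : List Bool) : blockState L (L.map cdLen).sum = 1 := by
  simp [blockState, ← length_blockStates]

theorem blockState_cons_add (b : Bool) (L : List Bool) (j : ℕ) :
    blockState (b :: L) (cdLen b + j) = blockState L j := by
  cases b <;> simp [blockState, blockStates, cdLen, add_comm _ j]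

theorem blockState_append_add (L L' : List Bool) (j : ℕ) :
    blockState (L ++ L') ((L.map cdLen).sum + j) = blockState L' j := by
  induction L with
  | nil => simp
  | cons b L ih => simp [add_assoc, blockState_cons_add, ih]

theorem forall_lt_sum_cdLen_cons {P : ℕ → Prop} {b : Bool} {L : List Bool}
    (h₁ : ∀ j < cdLen b, P j) (h₂ : ∀ j < (L.map cdLen).sum, P (cdLen b + j)) :
    ∀ j < ((b :: L).map cdLen).sum, P j := by
  intro j hj
  rcases Nat.lt_or_ge j (cdLen b) with h | h
  · exact h₁ j h
  · obtain ⟨i, rfl⟩ := Nat.exists_eq_add_of_le h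
    exact h₂ i (by simpa using hj)

theorem blockState_succ_mem_succs (L : List Bool) :
    ∀ j < (L.map cdLen).sum, blockState L (j + 1) ∈ succs (blockState L j) := by
  induction L with
  | nil => simp
  | cons b L ih =>
    refine forall_lt_sum_cdLen_cons (fun j hj => ?_) fun j hj => ?_
    · have h0 := blockState_zero L
      rw [← blockState_cons_add b] at h0
      cases b
      · simp only [cdLen, Bool.false_eq_true, if_false] at hj h0
        interval_cases j
        · simp [blockState, blockStates, succs]
        · simp [blockState, blockStates, succs]
        · simp [blockState, blockStates, succs]
        · rw [h0]; simp [blockState, blockStates, succs]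
      · simp only [cdLen, if_true] at hj h0
        interval_cases j
        · simp [blockState, blockStates, succs]
        · simp [blockState, blockStates, succs]
        · rw [h0]; simp [blockState, blockStates, succs]
    · rw [add_assoc, blockState_cons_add, blockState_cons_add]
      exact ih j hj

/-- The label read at position `j` of a concatenation of blocks. -/
def blockLetter (L : List Bool) (j : ℕ) : Label := letter (blockState L j) (blockState L (j + 1))

theorem blockLetter_cons_add (b : Bool) (L : List Bool) (j : ℕ) :
    blockLetter (b :: L) (cdLen b + j) = blockLetter L j := by
  rw [blockLetter, add_assoc, blockState_cons_add, blockState_cons_add, blockLetter]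

theorem blockLetter_append_add (L L' : List Bool) (j : ℕ) :
    blockLetter (L ++ L') ((L.map cdLen).sum + j) = blockLetter L' j := by
  rw [blockLetter, add_assoc, blockState_append_add, blockState_append_add, blockLetter]

theorem blockLetter_true (L : List Bool) : blockLetter (true :: L) 0 = (true, false, false) ∧
    blockLetter (true :: L) 1 = (false, true, false) ∧
    blockLetter (true :: L) 2 = (false, false, true) := by
  have h := blockState_cons_add true L 0
  rw [blockState_zero] at h
  refine ⟨by simp [blockLetter, blockState, blockStates, letter, Nat.testBit_succ],
    by simp [blockLetter, blockState, blockStates, letter, Nat.testBit_succ], ?_⟩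
  rw [blockLetter]
  simp only [cdLen, if_true, add_zero] at h
  rw [h]
  simp [blockState, blockStates, letter, Nat.testBit_succ]

theorem blockLetter_false (L : List Bool) : blockLetter (false :: L) 0 = (true, false, false) ∧
    blockLetter (false :: L) 1 = (true, false, true) ∧
    blockLetter (false :: L) 2 = (false, false, false) ∧
    blockLetter (false :: L) 3 = (false, false, true) := by
  have h := blockState_cons_add false L 0
  rw [blockState_zero] at h
  refine ⟨by simp [blockLetter, blockState, blockStates, letter, Nat.testBit_succ],
    by simp [blockLetter, blockState, blockStates, letter, Nat.testBit_succ],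
    by simp [blockLetter, blockState, blockStates, letter, Nat.testBit_succ], ?_⟩
  rw [blockLetter]
  simp only [cdLen, Bool.false_eq_true, if_false, add_zero] at h
  rw [h]
  simp [blockState, blockStates, letter, Nat.testBit_succ]

theorem exists_lt_three {P : ℕ → Prop} : (∃ j < 3, P j) ↔ P 0 ∨ P 1 ∨ P 2 := by
  constructor
  · rintro ⟨j, hj, h⟩
    interval_cases j <;> tauto
  · rintro (h | h | h)
    exacts [⟨0, by simp, h⟩, ⟨1, by simp, h⟩, ⟨2, by simp, h⟩]

theorem exists_lt_four {P : ℕ → Prop} : (∃ j < 4, P j) ↔ P 0 ∨ P 1 ∨ P 2 ∨ P 3 := by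
  constructor
  · rintro ⟨j, hj, h⟩
    interval_cases j <;> tauto
  · rintro (h | h | h | h)
    exacts [⟨0, by simp, h⟩, ⟨1, by simp, h⟩, ⟨2, by simp, h⟩, ⟨3, by simp, h⟩]

theorem mem_cdEdges {n : ℕ} (L : List Bool) (i : ZMod n) (e : Sym2 (PV n)) :
    e ∈ cdEdges n i L ↔ ∃ j < (L.map cdLen).sum, ∃ k, (blockLetter L j).has k = true ∧
      pedge (i + (j : ZMod n), k) = e := by
  induction L generalizing i with
  | nil => simp [cdEdges]
  | cons b L ih =>
    have hsplit : (∃ j < ((b :: L).map cdLen).sum, ∃ k,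
        (blockLetter (b :: L) j).has k = true ∧ pedge (i + (j : ZMod n), k) = e) ↔
        (∃ j < cdLen b, ∃ k, (blockLetter (b :: L) j).has k = true ∧
          pedge (i + (j : ZMod n), k) = e) ∨ e ∈ cdEdges n (i + cdLen b) L := by
      rw [ih]
      constructor
      · rintro ⟨j, hj, h⟩
        rcases Nat.lt_or_ge j (cdLen b) with h' | h'
        · exact Or.inl ⟨j, h', h⟩
        · obtain ⟨i, rfl⟩ := Nat.exists_eq_add_of_le h'
          refine Or.inr ⟨i, by simpa using hj, ?_⟩
          simpa only [blockLetter_cons_add, Nat.cast_add, add_assoc] using h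
      · rintro (⟨j, hj, h⟩ | ⟨j, hj, h⟩)
        · exact ⟨j, by simp; omega, h⟩
        · refine ⟨cdLen b + j, by simpa using hj, ?_⟩
          simpa only [blockLetter_cons_add, Nat.cast_add, add_assoc] using h
    rw [hsplit]
    cases b
    · simp only [cdEdges, Set.mem_union]
      refine or_congr ?_ (by simp [cdLen])
      obtain ⟨h0, h1, h2, h3⟩ := blockLetter_false L
      have e2 : (1 : ZMod n) + 2 = 3 := by norm_num
      have e3 : (1 : ZMod n) + 1 = 2 := by norm_num
      have e4 : (3 : ZMod n) + 1 = 4 := by norm_num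
      simp only [cdLen, Bool.false_eq_true, if_false, exists_lt_four]
      simp [Fin.exists_fin_succ, h0, h1, h2, h3, Label.has,
        blockD, pedge, add_assoc, e2, e3, e4, eq_comm (a := e), or_assoc]
    · simp only [cdEdges, Set.mem_union]
      refine or_congr ?_ (by simp [cdLen])
      obtain ⟨h0, h1, h2⟩ := blockLetter_true L
      have e4 : (2 : ZMod n) + 1 = 3 := by norm_num
      simp only [cdLen, if_true, exists_lt_three]
      simp [Fin.exists_fin_succ, h0, h1, h2, Label.has,
        blockC, pedge, add_assoc, e4, eq_comm (a := e)]

theorem exists_letters_eq_cdEdges {n : ℕ} [NeZero n] (hn : 11 ≤ n) {L : List Bool}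
    (hL : (L.map cdLen).sum = n) :
    ∃ x : ZMod n → ℕ, (∀ z, x (z + 1) ∈ succs (x z)) ∧
      (∀ j < n, letters x j = blockLetter L j) ∧ edgesOf (letters x) = cdEdges n 0 L := by
  obtain ⟨x, hx, hxj⟩ := exists_isWalk (ℓ := fun _ => (false, false, false)) (0 : ZMod n)
    (y := blockState L) (fun j hj => mem_moves.2
      ⟨blockState_succ_mem_succs L j (by omega), by simp [Label.le]⟩)
    (by rw [← hL, blockState_length, blockState_zero])
  simp only [zero_add] at hxj
  have hlet : ∀ j < n, letters x j = blockLetter L j := by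
    intro j hj
    rw [letters, blockLetter, hxj j hj]
    rcases Nat.lt_or_ge (j + 1) n with h | h
    · rw [← hxj _ h, Nat.cast_succ]
    · have hjn : j + 1 = n := by omega
      have h0 := hxj 0 (by omega)
      rw [← Nat.cast_succ, Nat.succ_eq_add_one, hjn, ZMod.natCast_self, ← Nat.cast_zero, h0,
        blockState_zero, ← hL, blockState_length]
  refine ⟨x, (isWalk_iff.1 hx).1, hlet, ?_⟩
  ext e
  rw [mem_cdEdges, hL]
  constructor
  · rintro ⟨⟨z, k⟩, h, rfl⟩
    exact ⟨z.val, ZMod.val_lt z, k, by rw [← hlet _ (ZMod.val_lt z)]; simpa using h, by simp⟩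
  · rintro ⟨j, hj, k, h, rfl⟩
    exact ⟨(j, k), by simpa [hlet j hj] using h, by simp⟩

/-- All walks from `s` containing the edges prescribed by a word of labels. -/
def paths (s : ℕ) : List Label → List (List ℕ)
  | [] => [[]]
  | ρ :: W => (moves ρ s).flatMap fun t => (paths t W).map fun l => t :: l

theorem map_range_mem_paths {Y : ℕ → ℕ} (W : List Label) (a : ℕ)
    (h : ∀ i < W.length, Y (a + i + 1) ∈ moves (W.getD i (false, false, false)) (Y (a + i))) :
    (List.range W.length).map (fun i => Y (a + i + 1)) ∈ paths (Y a) W := by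
  induction W generalizing a with
  | nil => simp [paths]
  | cons ρ W ih =>
    simp only [paths, List.mem_flatMap, List.mem_map, List.length_cons,
      List.range_succ_eq_map, List.map_cons, List.map_map]
    refine ⟨Y (a + 1), by simpa using h 0 (by simp), _, ih (a + 1) fun i hi => ?_, ?_⟩
    · simpa [add_assoc, add_comm 1] using h (i + 1) (by simpa using hi)
    · simp only [add_zero, Function.comp_def, List.cons.injEq, true_and]
      exact List.map_congr_left fun i _ => by congr 1; omega

theorem moves_subset {ρ τ : Label} (h : ρ.le τ = true) (s : ℕ) : moves τ s ⊆ moves ρ s := by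
  intro t ht
  rw [mem_moves] at ht ⊢
  rw [Label.le_iff] at h
  exact ⟨ht.1, Label.le_iff.2 fun k hk => Label.le_iff.1 ht.2 k (h k hk)⟩

/-- The edges of the extremal forcing set at position `j`: one edge `u₀u₂`, a spoke in every
twelfth position, and one further spoke near the end. -/
def extremalLabel (k e j : ℕ) : Label :=
  (j == 0, (j % 12 == 1 && Nat.ble j (12 * k + 1)) || j == 12 * k + e, false)

/-- The part of the extremal forcing set in one period. -/
def periodWord : List Label :=
  (List.range 14).map fun i => (false, i == 1 || i == 13, false)

/-- The part of the extremal forcing set behind the last period. -/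
def baseWord (m e : ℕ) : List Label :=
  (List.range m).map fun i => (false, i == 1 || i == e, false)

/-- The blocks behind the last period and the position of the last spoke. -/
def baseBlocks : ℕ → List Bool × ℕ
  | 11 => ([true, false, false], 1)
  | 12 => ([true, true, true, true], 1)
  | 13 => ([true, true, true, false], 7)
  | 14 => ([true, true, false, false], 4)
  | 15 => ([true, true, true, true, true], 4)
  | 16 => ([true, true, true, true, false], 10)
  | 17 => ([true, true, true, false, false], 7)
  | 18 => ([true, true, true, true, true, true], 7)
  | 19 => ([true, true, true, true, true, false], 13)
  | 20 => ([true, true, true, true, false, false], 10)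
  | 21 => ([true, true, true, true, true, true, true], 10)
  | 22 => ([true, false, false, true, false, false], 12)
  | _ => ([], 0)

theorem baseBlocks_spec {m : ℕ} (h₁ : 11 ≤ m) (h₂ : m ≤ 22) :
    ((baseBlocks m).1.map cdLen).sum = m ∧ (baseBlocks m).1 = true :: (baseBlocks m).1.tail ∧
      0 < (baseBlocks m).2 ∧ (baseBlocks m).2 < m ∧ ((baseBlocks m).2 = 1 ↔ m ≤ 12) ∧
      (blockLetter (baseBlocks m).1 (baseBlocks m).2).2.1 = true := by
  interval_cases m <;> decide

theorem baseWord_unique {m : ℕ} (h₁ : 11 ≤ m) (h₂ : m ≤ 22) :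
    ∀ l ∈ paths 1 (baseWord m (baseBlocks m).2), l.getD (m - 1) 0 = 1 →
      ∀ r < m, l.getD r 0 = blockState (baseBlocks m).1 (r + 1) := by
  interval_cases m <;> decide +kernel

theorem period_unique : ∀ l ∈ paths 1 periodWord, ∀ r < 12,
    l.getD r 0 = [2, 4, 1, 2, 4, 1, 2, 4, 1, 2, 4, 1].getD r 0 := by
  decide +kernel

theorem eq_one_of_first_spoke {a b c : ℕ} (hb : b ∈ moves (true, false, false) a)
    (hc : c ∈ moves (false, true, false) b) : a = 1 := by
  rw [mem_moves] at hb hc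
  have h := (lt_eight_of_mem_succs hb.1).1
  have : ∀ a < 8, ∀ b ∈ succs a, ∀ c ∈ succs b,
      Label.le (true, false, false) (letter a b) = true →
      Label.le (false, true, false) (letter b c) = true → a = 1 := by decide
  exact this a h b hb.1 c hc.1 hb.2 hc.2

theorem extremal_walk_eq {m k : ℕ} (h₁ : 11 ≤ m) (h₂ : m ≤ 22) {Y : ℕ → ℕ}
    (hY : ∀ j < m + 12 * k, Y (j + 1) ∈ moves (extremalLabel k (baseBlocks m).2 j) (Y j))
    (hend : Y (m + 12 * k) = Y 0) :
    Y 0 = 1 ∧ (∀ i < k, ∀ r < 12, Y (12 * i + r + 1) =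
      [2, 4, 1, 2, 4, 1, 2, 4, 1, 2, 4, 1].getD r 0) ∧
      ∀ r < m, Y (12 * k + r + 1) = blockState (baseBlocks m).1 (r + 1) := by
  obtain ⟨-, -, he, hem, -, -⟩ := baseBlocks_spec h₁ h₂
  have h0 : Y 0 = 1 := by
    refine eq_one_of_first_spoke (moves_subset ?_ _ (hY 0 (by omega)))
      (moves_subset ?_ _ (hY 1 (by omega)))
    · simp [extremalLabel, Label.le]
    · simp [extremalLabel, Label.le]
  have hper : ∀ i < k, Y (12 * i) = 1 → ∀ r < 12, Y (12 * i + r + 1) =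
      [2, 4, 1, 2, 4, 1, 2, 4, 1, 2, 4, 1].getD r 0 := by
    intro i hi h1 r hr
    have := map_range_mem_paths (Y := Y) periodWord (12 * i) fun j hj => ?_
    · rw [h1] at this
      rw [← period_unique _ this r hr]
      simp [periodWord, List.getD_eq_getElem?_getD, List.getElem?_range (show r < 14 by omega)]
    · have hj : j < 14 := by simpa [periodWord] using hj
      refine moves_subset ?_ _ (hY (12 * i + j) (by omega))
      simp [periodWord, List.getD_eq_getElem?_getD, List.getElem?_range hj, extremalLabel,
        Label.le]
      omega
  have hstart : ∀ i ≤ k, Y (12 * i) = 1 := by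
    intro i hi
    induction i with
    | zero => exact h0
    | succ i ih => exact hper i (by omega) (ih (by omega)) 11 (by omega)
  refine ⟨h0, fun i hi => hper i hi (hstart i hi.le), fun r hr => ?_⟩
  have := map_range_mem_paths (Y := Y) (baseWord m (baseBlocks m).2) (12 * k) fun j hj => ?_
  · rw [hstart k le_rfl] at this
    have hval : ∀ r < m, ((List.range (baseWord m (baseBlocks m).2).length).map
        fun i => Y (12 * k + i + 1)).getD r 0 = Y (12 * k + r + 1) := fun r hr => by
      simp [baseWord, List.getD_eq_getElem?_getD, List.getElem?_range hr]
    rw [← hval r hr]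
    refine baseWord_unique h₁ h₂ _ this ?_ r hr
    rw [hval _ (by omega), ← h0, ← hend]
    congr 1
    omega
  · have hj : j < m := by simpa [baseWord] using hj
    refine moves_subset ?_ _ (hY (12 * k + j) (by omega))
    simp [baseWord, List.getD_eq_getElem?_getD, List.getElem?_range hj, extremalLabel, Label.le]
    omega

theorem sum_size_extremalLabel_le (m k e : ℕ) :
    ∑ j ∈ Finset.range m, (extremalLabel k e j).size ≤ k + 2 + if e = 1 then 0 else 1 := by
  let A : Finset ℕ := (Finset.range (k + 1)).image (fun i => 12 * i + 1) ∪
    if e = 1 then ∅ else {12 * k + e}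
  have hA : A.card ≤ k + 1 + if e = 1 then 0 else 1 := by
    refine (Finset.card_union_le _ _).trans (Nat.add_le_add ?_ ?_)
    · exact Finset.card_image_le.trans (by simp)
    · split_ifs <;> simp
  have hle : ∀ j, (extremalLabel k e j).size ≤
      (if j ∈ ({0} : Finset ℕ) then 1 else 0) + if j ∈ A then 1 else 0 := by
    intro j
    have hq : ((j % 12 == 1 && Nat.ble j (12 * k + 1)) || j == 12 * k + e) = true → j ∈ A := by
      intro h
      simp only [Bool.or_eq_true, Bool.and_eq_true, beq_iff_eq, Nat.ble_eq] at h
      simp only [A, Finset.mem_union, Finset.mem_image, Finset.mem_range]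
      rcases h with h | h
      · exact Or.inl ⟨j / 12, by omega, by omega⟩
      · by_cases he : e = 1
        · exact Or.inl ⟨k, by omega, by omega⟩
        · exact Or.inr (by simp [he, h])
    simp only [extremalLabel, Label.size, Bool.toNat_false, add_zero]
    refine Nat.add_le_add ?_ ?_
    · by_cases h : j = 0 <;> simp [h]
    · by_cases h : j ∈ A
      · rw [if_pos h]
        exact Bool.toNat_le _
      · rw [Bool.eq_false_iff.2 (mt hq h)]
        simp
  refine (Finset.sum_le_sum fun j _ => hle j).trans ?_
  rw [Finset.sum_add_distrib, ← Finset.card_filter, ← Finset.card_filter]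
  have h1 : (Finset.filter (· ∈ ({0} : Finset ℕ)) (Finset.range m)).card ≤ 1 :=
    (Finset.card_le_card fun j hj => (Finset.mem_filter.1 hj).2).trans (by simp)
  have h2 : (Finset.filter (· ∈ A) (Finset.range m)).card ≤ A.card :=
    Finset.card_le_card fun j hj => (Finset.mem_filter.1 hj).2
  omega

theorem sum_map_cdLen_replicate (k : ℕ) :
    ((List.replicate (4 * k) true).map cdLen).sum = 12 * k := by
  simp [cdLen]
  omega

/-- The blocks of the extremal matching. -/
def extremalBlocks (m k : ℕ) : List Bool := List.replicate (4 * k) true ++ (baseBlocks m).1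

theorem sum_map_cdLen_extremalBlocks {m k : ℕ} (h₁ : 11 ≤ m) (h₂ : m ≤ 22) :
    ((extremalBlocks m k).map cdLen).sum = m + 12 * k := by
  rw [extremalBlocks, List.map_append, List.sum_append, sum_map_cdLen_replicate,
    (baseBlocks_spec h₁ h₂).1, add_comm]

theorem blockLetter_extremalBlocks {m k i : ℕ} (hi : i ≤ k) (j : ℕ) :
    blockLetter (extremalBlocks m k) (12 * i + j) =
      blockLetter (extremalBlocks m (k - i)) j := by
  have : extremalBlocks m k = List.replicate (4 * i) true ++ extremalBlocks m (k - i) := by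
    rw [extremalBlocks, extremalBlocks, ← List.append_assoc, List.replicate_append_replicate]
    congr 3
    omega
  rw [this, ← sum_map_cdLen_replicate, blockLetter_append_add]

theorem exists_extremalBlocks_eq {m : ℕ} (h₁ : 11 ≤ m) (h₂ : m ≤ 22) (k : ℕ) :
    ∃ L, extremalBlocks m k = true :: L := by
  rw [extremalBlocks, (baseBlocks_spec h₁ h₂).2.1]
  rcases Nat.eq_zero_or_pos k with rfl | hk
  · exact ⟨_, rfl⟩
  · obtain ⟨l, hl⟩ := Nat.exists_eq_succ_of_ne_zero (show 4 * k ≠ 0 by omega)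
    rw [hl]
    exact ⟨_, rfl⟩

theorem extremalLabel_le {m k : ℕ} (h₁ : 11 ≤ m) (h₂ : m ≤ 22) (j : ℕ) :
    (extremalLabel k (baseBlocks m).2 j).le (blockLetter (extremalBlocks m k) j) = true := by
  have hp : j = 0 → (blockLetter (extremalBlocks m k) j).1 = true := by
    rintro rfl
    obtain ⟨L, hL⟩ := exists_extremalBlocks_eq h₁ h₂ k
    rw [hL, (blockLetter_true L).1]
  have hq : (j % 12 = 1 ∧ j ≤ 12 * k + 1) ∨ j = 12 * k + (baseBlocks m).2 →
      (blockLetter (extremalBlocks m k) j).2.1 = true := by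
    rintro (⟨h, h'⟩ | rfl)
    · obtain ⟨i, rfl⟩ : ∃ i, j = 12 * i + 1 := ⟨j / 12, by omega⟩
      obtain ⟨L, hL⟩ := exists_extremalBlocks_eq h₁ h₂ (k - i)
      rw [blockLetter_extremalBlocks (by omega), hL, (blockLetter_true L).2.1]
    · rw [blockLetter_extremalBlocks le_rfl, Nat.sub_self]
      exact (baseBlocks_spec h₁ h₂).2.2.2.2.2
  have hq' : (extremalLabel k (baseBlocks m).2 j).2.1 = true →
      (blockLetter (extremalBlocks m k) j).2.1 = true := fun h => hq (by
    simpa [extremalLabel] using h)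
  rw [Label.le_iff]
  intro i
  fin_cases i
  · simpa [extremalLabel, Label.has] using hp
  · simpa [Label.has] using hq'
  · simp [extremalLabel, Label.has]

theorem exists_isType2_forcingNumber_le {n : ℕ} (hn : 11 ≤ n) :
    ∃ M : (petersen n).Subgraph, M.IsPerfectMatching ∧ IsType2 M ∧
      forcingNumber (petersen n) M ≤ (n + 11) / 12 + 1 := by
  have : NeZero n := ⟨by omega⟩
  obtain ⟨m, k, h₁, h₂, hmk⟩ : ∃ m k, 11 ≤ m ∧ m ≤ 22 ∧ n = m + 12 * k :=
    ⟨11 + (n - 11) % 12, (n - 11) / 12, by omega, by omega, by omega⟩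
  have hL := (sum_map_cdLen_extremalBlocks (k := k) h₁ h₂).trans hmk.symm
  obtain ⟨x, hx, hlet, hedges⟩ := exists_letters_eq_cdEdges hn hL
  let ℓ : ZMod n → Label := fun z => extremalLabel k (baseBlocks m).2 z.val
  have hxℓ : IsWalk ℓ x := isWalk_iff.2 ⟨hx, fun z => by
    have := hlet z.val (ZMod.val_lt z)
    rw [ZMod.natCast_zmod_val] at this
    rw [this]
    exact extremalLabel_le h₁ h₂ _⟩
  have hseq : ∀ w, IsWalk ℓ w → ∀ j < m + 12 * k,
      w (j + 1 : ℕ) ∈ moves (extremalLabel k (baseBlocks m).2 j) (w j) := by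
    intro w hw j hj
    have := hw j
    rwa [← Nat.cast_succ, show ℓ j = extremalLabel k (baseBlocks m).2 j by
      simp [ℓ, ZMod.val_natCast, Nat.mod_eq_of_lt (hmk.symm ▸ hj)]] at this
  have hcycle : ∀ w : ZMod n → ℕ, w (m + 12 * k : ℕ) = w (0 : ℕ) := fun w => by
    rw [← hmk, ZMod.natCast_self, Nat.cast_zero]
  have huniq : ∀ w, IsWalk ℓ w → w = x := by
    intro w hw
    obtain ⟨hw0, hw1, hw2⟩ := extremal_walk_eq h₁ h₂ (Y := fun j => w j) (hseq w hw) (hcycle w)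
    obtain ⟨hx0, hx1, hx2⟩ := extremal_walk_eq h₁ h₂ (Y := fun j => x j) (hseq x hxℓ) (hcycle x)
    have key : ∀ j < n, w (j : ℕ) = x (j : ℕ) := by
      rintro (_ | j) hj
      · exact hw0.trans hx0.symm
      · rcases Nat.lt_or_ge j (12 * k) with h | h
        · rw [← Nat.div_add_mod j 12]
          exact (hw1 (j / 12) (by omega) (j % 12) (by omega)).trans
            (hx1 (j / 12) (by omega) (j % 12) (by omega)).symm
        · obtain ⟨r, rfl⟩ := Nat.exists_eq_add_of_le h
          exact (hw2 r (by omega)).trans (hx2 r (by omega)).symm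
    funext z
    simpa using key z.val (ZMod.val_lt z)
  obtain ⟨M, hM, hMx⟩ := hxℓ.exists_isPerfectMatching hn
  refine ⟨M, hM, ⟨0, _, hL, hMx.trans hedges⟩, ?_⟩
  have hforce := (isForcingSet_edgesOf_iff hn hM hx hMx ℓ).2 ⟨hxℓ, huniq⟩
  have hle : forcingNumber (petersen n) M ≤ (edgesOf ℓ).ncard := Nat.sInf_le ⟨_, hforce, rfl⟩
  refine hle.trans ?_
  have hsum : ∑ z, (ℓ z).size =
      ∑ j ∈ Finset.range n, (extremalLabel k (baseBlocks m).2 j).size := by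
    rw [← sum_range_zmod 0]
    refine Finset.sum_congr rfl fun j hj => ?_
    simp [ℓ, ZMod.val_natCast, Nat.mod_eq_of_lt (Finset.mem_range.1 hj)]
  rw [ncard_edgesOf hn, hsum]
  refine (sum_size_extremalLabel_le n k _).trans ?_
  have h12 := (baseBlocks_spec h₁ h₂).2.2.2.2.1
  split_ifs with h
  · omega
  · have := mt h12.2 h
    omega

/-- for `n ≥ 11` the minimum forcing number over type-2 perfect matchings
of `P(n,2)` equals `⌈n/12⌉ + 1` (written `(n+11)/12 + 1` in natural division). -/
theorem type2_min_forcing (n : ℕ) (hn : 11 ≤ n) :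
    IsLeast {k | ∃ M : (petersen n).Subgraph,
        M.IsPerfectMatching ∧ IsType2 M ∧ forcingNumber (petersen n) M = k}
      ((n + 11) / 12 + 1) := by
  constructor
  · obtain ⟨M, hM, hM2, hle⟩ := exists_isType2_forcingNumber_le hn
    exact ⟨M, hM, hM2, hle.antisymm (le_forcingNumber_of_isType2 hn hM hM2)⟩
  · rintro _ ⟨M, hM, hM2, rfl⟩
    exact le_forcingNumber_of_isType2 hn hM hM2
end

section
/- For n ≥ 3, the set {f(P(n,2),M) : M a type-2 perfect matching of P(n,2)} is a set of consecutive integers (an integer interval). -/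
open SimpleGraph

namespace CDWord

/-- The possible contents of a position `i` of a perfect matching of `P(n,2)`: which of the edges
`u_i u_{i+2}`, `u_i v_i`, `v_i v_{i+1}` are present. The cell `uv` holds the first and the third
edge, the cell `o` none of them. -/
inductive Cell
  | o | u | s | v | uv
  deriving DecidableEq

instance : Fintype Cell := ⟨{.o, .u, .s, .v, .uv}, fun c => by cases c <;> decide⟩

namespace Cell

/-- The cell contains the edge `u_i u_{i+2}`. -/
def hasU : Cell → Bool
  | u => true
  | uv => true
  | _ => false

/-- The cell contains the spoke. -/
def hasS : Cell → Bool
  | s => true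
  | _ => false

/-- The cell contains the edge `v_i v_{i+1}`. -/
def hasV : Cell → Bool
  | v => true
  | uv => true
  | _ => false

/-- Inclusion of cells. -/
def le : Cell → Cell → Bool
  | o, _ => true
  | u, u => true
  | u, uv => true
  | s, s => true
  | v, v => true
  | v, uv => true
  | uv, uv => true
  | _, _ => false

/-- Number of edges in a cell. -/
def size : Cell → ℕ
  | o => 0
  | u => 1
  | s => 1
  | v => 1
  | uv => 2

/-- All cells contained in a given one. -/
def subs : Cell → List Cell
  | o => [o]
  | u => [o, u]
  | s => [o, s]
  | v => [o, v]
  | uv => [o, u, v, uv]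

theorem mem_subs {a b : Cell} : a ∈ subs b ↔ le a b = true := by
  cases a <;> cases b <;> decide

theorem le_refl (a : Cell) : le a a = true := by cases a <;> rfl

theorem le_antisymm {a b : Cell} (h : le a b = true) (h' : le b a = true) : a = b := by
  cases a <;> cases b <;> simp_all [le]

end Cell

/-- The state between two positions: whether each of the two preceding outer edges and the
preceding inner edge is present. -/
abbrev CutState := Bool × Bool × Bool

/-- Reading a cell: defined exactly when both vertices of the position get covered once. -/
def read (σ : CutState) (c : Cell) : Option CutState :=
  if (σ.1.toNat + c.hasU.toNat + c.hasS.toNat = 1) ∧ (σ.2.2.toNat + c.hasV.toNat + c.hasS.toNat = 1)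
  then some (σ.2.1, c.hasU, c.hasV) else none

/-- Reading a list of cells. -/
def run : List Cell → CutState → Option CutState
  | [], σ => some σ
  | c :: l, σ => (read σ c).bind (run l)

theorem run_append (a b : List Cell) (σ : CutState) : run (a ++ b) σ = (run a σ).bind (run b) := by
  induction a generalizing σ with
  | nil => rfl
  | cons c a ih =>
    simp only [List.cons_append, run]
    cases read σ c <;> simp [ih]

/-- A list of cells which closes up to a perfect matching. -/
def Closed (x : List Cell) : Prop := ∃ σ, run x σ = some σ

theorem Closed.rotate {a b : List Cell} (h : Closed (a ++ b)) : Closed (b ++ a) := by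
  obtain ⟨σ, h⟩ := h
  rw [run_append, Option.bind_eq_some_iff] at h
  obtain ⟨τ, h1, h2⟩ := h
  exact ⟨τ, by rw [run_append, h2]; exact h1⟩

/-- Pointwise inclusion of lists of cells. -/
def Sub (S x : List Cell) : Prop := List.Forall₂ (fun a b => Cell.le a b = true) S x

theorem Sub.length_eq {S x : List Cell} (h : Sub S x) : S.length = x.length :=
  List.Forall₂.length_eq h

theorem Sub.refl (x : List Cell) : Sub x x := by
  induction x with
  | nil => exact .nil
  | cons c x ih => exact .cons (Cell.le_refl c) ih

theorem Sub.append {S T x y : List Cell} (h : Sub S x) (h' : Sub T y) : Sub (S ++ T) (x ++ y) :=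
  List.rel_append h h'

theorem Sub.split_left {S T x : List Cell} (h : Sub (S ++ T) x) :
    ∃ a b, x = a ++ b ∧ Sub S a ∧ Sub T b :=
  ⟨_, _, (List.take_append_drop S.length x).symm,
    (List.forall₂_take_append x S T h.flip).flip, (List.forall₂_drop_append x S T h.flip).flip⟩

theorem Sub.split_right {S a b : List Cell} (h : Sub S (a ++ b)) :
    ∃ A B, S = A ++ B ∧ Sub A a ∧ Sub B b :=
  ⟨_, _, (List.take_append_drop a.length S).symm,
    List.forall₂_take_append S a b h, List.forall₂_drop_append S a b h⟩

/-- Number of edges of a list of cells. -/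
def size (x : List Cell) : ℕ := (x.map Cell.size).sum

theorem size_append (a b : List Cell) : size (a ++ b) = size a + size b := by simp [size]


theorem Sub.size_le {S x : List Cell} (h : Sub S x) : size S ≤ size x := by
  induction h with
  | nil => exact le_refl _
  | @cons a b _ _ h _ ih =>
    have : a.size ≤ b.size := by revert h; cases a <;> cases b <;> decide
    simp only [size, List.map_cons, List.sum_cons] at ih ⊢
    omega

theorem Sub.eq_of_size {S x : List Cell} (h : Sub S x) (hs : size x ≤ size S) : S = x := by
  induction h with
  | nil => rfl
  | @cons a b S x h hS ih =>
    have h1 : a.size ≤ b.size := by revert h; cases a <;> cases b <;> decide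
    have h2 : b.size ≤ a.size → a = b := by revert h; cases a <;> cases b <;> decide
    have h3 := Sub.size_le hS
    simp only [size, List.map_cons, List.sum_cons] at ih hs h3
    rw [h2 (by omega), ih (by omega)]

/-- Number of edges recorded in a state. -/
def CutState.weight (σ : CutState) : ℕ := σ.1.toNat + σ.2.1.toNat + σ.2.2.toNat

theorem run_size {x : List Cell} {σ τ : CutState} (h : run x σ = some τ) :
    2 * size x + CutState.weight σ = 2 * x.length + CutState.weight τ := by
  induction x generalizing σ with
  | nil => simp only [run, Option.some.injEq] at h; simp [size, h]
  | cons c x ih =>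
    rw [run, Option.bind_eq_some_iff] at h
    obtain ⟨ρ, h1, h2⟩ := h
    have := ih h2
    have hc : 2 * c.size + CutState.weight σ = 2 + CutState.weight ρ := by
      clear ih this h2
      revert h1
      revert σ ρ c
      decide
    simp only [size, List.map_cons, List.sum_cons, List.length_cons] at this ⊢
    omega

theorem Closed.size_eq {x : List Cell} (h : Closed x) : size x = x.length := by
  obtain ⟨σ, h⟩ := h
  have := run_size h
  omega

/-- `S` is contained in `x` and in no other closed list. -/
def Forces (S x : List Cell) : Prop := Sub S x ∧ ∀ y, Closed y → Sub S y → y = x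

theorem Closed.forces_self {x : List Cell} (hx : Closed x) : Forces x x :=
  ⟨.refl x, fun y hy h => (h.eq_of_size (by rw [hx.size_eq, hy.size_eq, h.length_eq])).symm⟩

theorem Forces.rotate {S T a b : List Cell} (hl : S.length = a.length)
    (h : Forces (S ++ T) (a ++ b)) : Forces (T ++ S) (b ++ a) := by
  obtain ⟨A, B, hAB, hA, hB⟩ := h.1.split_right
  obtain ⟨rfl, rfl⟩ := List.append_inj hAB (hl.trans hA.length_eq.symm)
  refine ⟨hB.append hA, fun y hy hs => ?_⟩
  obtain ⟨q, p, rfl, hq, hp⟩ := hs.split_left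
  have := h.2 (p ++ q) hy.rotate (hp.append hq)
  obtain ⟨rfl, rfl⟩ := List.append_inj this (hp.length_eq.symm.trans hl)
  rfl

/-- The smallest number of edges which force a list of cells. -/
noncomputable def force (x : List Cell) : ℕ := sInf {k | ∃ S, Forces S x ∧ size S = k}

theorem force_le {S x : List Cell} (h : Forces S x) : force x ≤ size S :=
  Nat.sInf_le ⟨S, h, rfl⟩

theorem Closed.exists_force {x : List Cell} (hx : Closed x) :
    ∃ S, Forces S x ∧ size S = force x :=
  Nat.sInf_mem (s := {k | ∃ S, Forces S x ∧ size S = k}) ⟨_, x, hx.forces_self, rfl⟩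

theorem force_rotate_le {a b : List Cell} (h : Closed (a ++ b)) :
    force (b ++ a) ≤ force (a ++ b) := by
  obtain ⟨S, hS, hk⟩ := h.exists_force
  obtain ⟨A, B, rfl, hA, hB⟩ := hS.1.split_right
  rw [← hk]
  refine (force_le (hS.rotate hA.length_eq)).trans ?_
  rw [size_append, size_append, add_comm]

theorem force_rotate {a b : List Cell} (h : Closed (a ++ b)) : force (b ++ a) = force (a ++ b) :=
  le_antisymm (force_rotate_le h) (force_rotate_le h.rotate)

/-- The pairs of states `(σ, τ)` joined by a reading of some list other than `X` containing `W`. -/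
def Deviates (W X : List Cell) (σ τ : CutState) : Prop :=
  ∃ q, run q σ = some τ ∧ Sub W q ∧ q ≠ X

/-- The state between two blocks. -/
def base : CutState := (false, false, true)

theorem Forces.replace {W W' X Y S r : List Cell} (hX : run X base = some base)
    (hY : run Y base = some base) (hY' : ∀ σ, σ ≠ base → run Y σ = none)
    (hlen : X.length = Y.length) (hW : Sub W X) (hW' : Sub W' Y)
    (hr : run r base = some base)
    (hdev : ∀ σ τ, (r = [] → σ = τ) → Deviates W' Y σ τ → Deviates W X σ τ)
    (h : Forces (W ++ S) (X ++ r)) : Forces (W' ++ S) (Y ++ r) := by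
  obtain ⟨A, B, hAB, hA, hB⟩ := h.1.split_right
  obtain ⟨rfl, rfl⟩ := List.append_inj hAB (hW.length_eq.trans hA.length_eq.symm)
  refine ⟨hW'.append hB, fun y ⟨σ, hy⟩ hs => ?_⟩
  obtain ⟨q, t, rfl, hq, ht⟩ := hs.split_left
  rw [run_append, Option.bind_eq_some_iff] at hy
  obtain ⟨τ, h1, h2⟩ := hy
  by_cases hqY : q = Y
  · subst hqY
    have hσ : σ = base := by
      by_contra hne
      rw [hY' σ hne] at h1
      cases h1
    subst hσ
    rw [hY, Option.some.injEq] at h1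
    subst h1
    have := h.2 (X ++ t) ⟨base, by rw [run_append, hX]; exact h2⟩ (hW.append ht)
    rw [List.append_cancel_left this]
  · have hnil : r = [] → σ = τ := by
      rintro rfl
      have : t = [] := List.length_eq_zero_iff.1 (by rw [← ht.length_eq, hB.length_eq]; rfl)
      subst this
      simpa [run, eq_comm] using h2
    obtain ⟨p, h3, h4, h5⟩ := hdev σ τ hnil ⟨q, h1, hq, hqY⟩
    have := h.2 (p ++ t) ⟨σ, by rw [run_append, h3]; exact h2⟩ (h4.append ht)
    exact absurd (List.append_inj this (h4.length_eq.symm.trans hW.length_eq)).1 h5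

theorem force_replace_le {X Y r : List Cell} (hX : run X base = some base)
    (hY : run Y base = some base) (hY' : ∀ σ, σ ≠ base → run Y σ = none)
    (hlen : X.length = Y.length) (hne : X ≠ Y) (hr : run r base = some base)
    (hdom : ∀ W, Sub W X → Sub W Y ∨ ∃ W', Sub W' Y ∧ size W' ≤ size W + 1 ∧
      ∀ σ τ, (r = [] → σ = τ) → Deviates W' Y σ τ → Deviates W X σ τ) :
    force (Y ++ r) ≤ force (X ++ r) + 1 := by
  have hcl : Closed (X ++ r) := ⟨base, by rw [run_append, hX]; exact hr⟩
  obtain ⟨S, hS, hk⟩ := hcl.exists_force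
  obtain ⟨W, T, rfl, hW, hT⟩ := hS.1.split_right
  rcases hdom W hW with h | ⟨W', h1, h2, h3⟩
  · have := hS.2 (Y ++ r) ⟨base, by rw [run_append, hY]; exact hr⟩ (h.append hT)
    exact absurd (List.append_cancel_right this).symm hne
  · refine (force_le (hS.replace hX hY hY' hlen hW h1 hr h3)).trans ?_
    rw [← hk, size_append, size_append]
    omega

/-! ### Computing `Deviates` with bit masks -/

/-- A state as a number below `8`. -/
def CutState.idx (σ : CutState) : ℕ := 4 * σ.1.toNat + 2 * σ.2.1.toNat + σ.2.2.toNat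

/-- The bit of the set of triples `(start, current, deviated)`. -/
def bit (σ τ : CutState) (f : Bool) : ℕ := τ.idx + 8 * (σ.idx + 8 * f.toNat)

/-- Moves the elements with current state `a` to the current state `b`. -/
def move (a b m : ℕ) : ℕ :=
  Nat.shiftLeft (Nat.land (Nat.shiftRight m a) 1334440654591915542993625911497130241) b

/-- Reads a cell. -/
def hop : Cell → ℕ → ℕ
  | .o, m => Nat.lor (move 5 0 m) (move 7 4 m)
  | .u, m => Nat.lor (move 1 2 m) (move 3 6 m)
  | .s, m => Nat.lor (move 0 0 m) (move 2 4 m)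
  | .v, m => Nat.lor (move 4 1 m) (move 6 5 m)
  | .uv, m => Nat.lor (move 0 3 m) (move 2 7 m)

/-- Marks all elements as deviated. -/
def mark (m : ℕ) : ℕ :=
  Nat.shiftLeft (Nat.land (Nat.lor m (Nat.shiftRight m 64)) 18446744073709551615) 64

/-- Reads all cells of a list which contain `a` and differ from `p`. -/
def hopOther (a p : Cell) (m : ℕ) : List Cell → ℕ
  | [] => 0
  | c :: l =>
    bif Cell.le a c && !(Cell.le c p && Cell.le p c) then Nat.lor (hop c m) (hopOther a p m l)
    else hopOther a p m l

/-- Reads all cells which contain `a`, marking those which differ from `p`. -/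
def step (a p : Cell) (m : ℕ) : ℕ :=
  Nat.lor (bif Cell.le a p then hop p m else 0) (mark (hopOther a p m [.o, .u, .s, .v, .uv]))

/-- The set of all triples `(σ, σ, false)`. -/
def start : ℕ := 9241421688590303745

/-- `cover d k T Z b j m` runs through all masks with at most `j` edges of the list of first
components of `Z`, starting from the set of triples `m`, and checks that the mask is contained in
the second components (where `b` tells whether this may still happen) or that the deviations
obtained in the end contain those recorded in some not too large entry of `T`, up to `d`. -/
def cover (d k : ℕ) (T : List (ℕ × ℕ)) : List (Cell × Cell) → Bool → ℕ → ℕ → Bool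
  | [], b, j, m => b || T.any fun t => Nat.ble (t.1 + j) (k + 1) &&
      Nat.beq (Nat.land t.2 (Nat.land d (Nat.shiftRight m 64))) t.2
  | (p, y) :: Z, b, j, m => (Cell.subs p).all fun c =>
      Nat.blt j c.size || cover d k T Z (b && Cell.le c y) (j - c.size) (step c p m)

/-- All triples reachable by reading a list that contains `W`, compared with `X`. -/
def reach : List Cell → List Cell → ℕ → ℕ
  | c :: W, p :: X, m => reach W X (step c p m)
  | _, _, m => m

/-- A block: `true` codes `C`, `false` codes `D`. -/
def block : Bool → List Cell
  | true => [.u, .s, .v]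
  | false => [.u, .uv, .o, .v]

/-- The list of cells of a list of blocks. -/
def word (L : List Bool) : List Cell := L.flatMap block

/-- The masks `Ws` of `Y`, each given by its size and its deviations. -/
def table (d : ℕ) (Y : List Cell) (Ws : List (List Cell)) : List (ℕ × ℕ) :=
  Ws.map fun W => (size W, Nat.land d (Nat.shiftRight (reach W Y start) 64))

/-- Every mask of the word `X` can be exchanged for one of the masks `Ws` of the word `Y`, at the
cost of at most one more edge. -/
def Dominates (d k : ℕ) (X Y : List Bool) (Ws : List (List Cell)) : Prop :=
  ((word X).length = (word Y).length ∧ word X ≠ word Y) ∧ Y ≠ [] ∧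
    (∀ W ∈ Ws, Sub W (word Y)) ∧ (k + 2, 0) ∈ table d (word Y) Ws ∧
    cover d k (table d (word Y) Ws) ((word X).zip (word Y)) true k start = true

theorem CutState.idx_lt (σ : CutState) : σ.idx < 8 := by revert σ; decide

theorem testBit_ones : ∀ t < 8, ∀ b < 8, ∀ g < 16, b ≤ t + 8 * g →
    (1334440654591915542993625911497130241 : ℕ).testBit (t + 8 * g - b) = decide (t = b) := by
  decide +kernel

theorem testBit_move {a b t g m : ℕ} (ht : t < 8) (hb : b < 8) (hg : g < 16) :
    (move a b m).testBit (t + 8 * g) = (decide (t = b) && m.testBit (a + 8 * g)) := by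
  change (((m >>> a) &&& 1334440654591915542993625911497130241) <<< b).testBit _ = _
  rw [Nat.testBit_shiftLeft, Nat.testBit_and, Nat.testBit_shiftRight]
  by_cases h : b ≤ t + 8 * g
  · rw [testBit_ones t ht b hb g hg h]
    by_cases htb : t = b
    · subst htb
      simp [h]
    · simp [htb]
  · have : t ≠ b := by omega
    simp [h, this]

theorem testBit_lor (a b i : ℕ) : (Nat.lor a b).testBit i = (a.testBit i || b.testBit i) :=
  Nat.testBit_or a b i

theorem testBit_hop (c : Cell) (m : ℕ) (σ τ : CutState) (f : Bool) :
    (hop c m).testBit (bit σ τ f) = true ↔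
      ∃ ρ, read ρ c = some τ ∧ m.testBit (bit σ ρ f) = true := by
  have hg : σ.idx + 8 * f.toNat < 16 := by
    have := σ.idx_lt
    cases f <;> simp <;> omega
  unfold bit
  generalize σ.idx + 8 * f.toNat = g at hg
  have key (a b : ℕ) (hb : b < 8) := testBit_move (a := a) (m := m) τ.idx_lt hb hg
  cases c <;> simp [hop, key] <;>
    obtain ⟨_ | _, _ | _, _ | _⟩ := τ <;>
    simp [CutState.idx, read, Cell.hasU, Cell.hasS, Cell.hasV]

theorem bit_eq (σ τ : CutState) (f : Bool) :
    bit σ τ f = (τ.idx + 8 * σ.idx) + 64 * f.toNat := by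
  unfold bit; ring

theorem testBit_mark (m : ℕ) (σ τ : CutState) (f : Bool) :
    (mark m).testBit (bit σ τ f) = true ↔ f = true ∧ ∃ f₀, m.testBit (bit σ τ f₀) = true := by
  have h1 := σ.idx_lt
  have h2 := τ.idx_lt
  change (((m ||| (m >>> 64)) &&& (2 ^ 64 - 1)) <<< 64).testBit _ = true ↔ _
  rw [Nat.testBit_shiftLeft, Nat.testBit_and, Nat.testBit_two_pow_sub_one, Nat.testBit_or,
    Nat.testBit_shiftRight]
  simp only [bit_eq]
  generalize hk : τ.idx + 8 * σ.idx = k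
  have hk' : k < 64 := by omega
  cases f
  · simp
    omega
  · simp [hk', add_comm]

theorem testBit_hopOther (a p : Cell) (m : ℕ) (l : List Cell) (i : ℕ) :
    (hopOther a p m l).testBit i = true ↔
      ∃ c ∈ l, Cell.le a c = true ∧ c ≠ p ∧ (hop c m).testBit i = true := by
  have hcp : ∀ c p : Cell, (Cell.le c p && Cell.le p c) = decide (c = p) := by decide
  induction l with
  | nil => simp [hopOther]
  | cons c l ih =>
    rw [hopOther, hcp]
    by_cases h1 : Cell.le a c = true <;> by_cases h2 : c = p <;>
      simp [h1, h2, ih]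

theorem testBit_step (a p : Cell) (m : ℕ) (σ τ : CutState) (f : Bool) :
    (step a p m).testBit (bit σ τ f) = true ↔ ∃ ρ f₀ c, m.testBit (bit σ ρ f₀) = true ∧
      read ρ c = some τ ∧ Cell.le a c = true ∧ f = (f₀ || decide (c ≠ p)) := by
  have hmem : ∀ c : Cell, c ∈ ([.o, .u, .s, .v, .uv] : List Cell) := by decide
  have hfirst : (bif Cell.le a p then hop p m else 0).testBit (bit σ τ f) = true ↔
      Cell.le a p = true ∧ (hop p m).testBit (bit σ τ f) = true := by
    cases Cell.le a p <;> simp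
  rw [step, testBit_lor, Bool.or_eq_true, hfirst, testBit_mark]
  simp only [testBit_hopOther, testBit_hop, hmem, true_and]
  constructor
  · rintro (⟨h1, ρ, h2, h3⟩ | ⟨rfl, f₀, c, h1, h2, ρ, h3, h4⟩)
    · exact ⟨ρ, f, p, h3, h2, h1, by simp⟩
    · exact ⟨ρ, f₀, c, h4, h3, h1, by simp [h2]⟩
  · rintro ⟨ρ, f₀, c, h1, h2, h3, rfl⟩
    by_cases hc : c = p
    · subst hc
      exact .inl ⟨h3, ρ, h2, by simpa using h1⟩
    · exact .inr ⟨by simp [hc], f₀, c, h3, hc, ρ, h2, h1⟩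

theorem testBit_reach {W X : List Cell} (hl : W.length = X.length) (m : ℕ) (σ τ : CutState)
    (f : Bool) : (reach W X m).testBit (bit σ τ f) = true ↔
      ∃ ρ f₀ q, m.testBit (bit σ ρ f₀) = true ∧ run q ρ = some τ ∧ Sub W q ∧
        f = (f₀ || decide (q ≠ X)) := by
  induction W generalizing X m with
  | nil =>
    obtain rfl := List.length_eq_zero_iff.1 hl.symm
    rw [reach]
    · constructor
      · exact fun h => ⟨τ, f, [], h, rfl, .nil, by simp⟩
      · rintro ⟨ρ, f₀, q, h1, h2, h3, rfl⟩
        cases h3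
        simp only [run, Option.some.injEq] at h2
        simpa [h2] using h1
    · simp
  | cons a W ih =>
    obtain _ | ⟨p, X⟩ := X
    · simp at hl
    rw [reach, ih (by simpa using hl)]
    simp only [testBit_step]
    constructor
    · rintro ⟨ρ, f₁, q, ⟨ρ', f₀, c, h1, h2, h3, rfl⟩, h4, h5, rfl⟩
      refine ⟨ρ', f₀, c :: q, h1, by rw [run, h2]; exact h4, .cons h3 h5, ?_⟩
      rw [Bool.or_assoc]
      congr 1
      by_cases h : c = p <;> simp [h]
    · rintro ⟨ρ, f₀, q, h1, h2, h3, rfl⟩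
      obtain _ | ⟨h3, h5⟩ := h3
      rename_i c q
      rw [run, Option.bind_eq_some_iff] at h2
      obtain ⟨ρ', h2, h4⟩ := h2
      refine ⟨ρ', _, q, ⟨ρ, f₀, c, h1, h2, h3, rfl⟩, h4, h5, ?_⟩
      rw [Bool.or_assoc]
      congr 1
      by_cases h : c = p <;> simp [h]

theorem testBit_start : ∀ (σ τ : CutState) (f : Bool),
    start.testBit (bit σ τ f) = true ↔ σ = τ ∧ f = false := by
  decide +kernel

theorem testBit_reach_start {W X : List Cell} (hl : W.length = X.length) (σ τ : CutState) :
    (Nat.shiftRight (reach W X start) 64).testBit (τ.idx + 8 * σ.idx) = true ↔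
      Deviates W X σ τ := by
  have : 64 + (τ.idx + 8 * σ.idx) = bit σ τ true := by rw [bit_eq]; simp [add_comm]
  change (reach W X start >>> 64).testBit _ = true ↔ _
  rw [Nat.testBit_shiftRight, this, testBit_reach hl]
  simp only [testBit_start, Deviates]
  constructor
  · rintro ⟨_, _, q, ⟨rfl, rfl⟩, h1, h2, h3⟩
    exact ⟨q, h1, h2, by simpa using h3⟩
  · rintro ⟨q, h1, h2, h3⟩
    exact ⟨σ, false, q, ⟨rfl, rfl⟩, h1, h2, by simpa using h3⟩

theorem cover_spec {d k : ℕ} {T : List (ℕ × ℕ)} {Z : List (Cell × Cell)} {b : Bool} {j m : ℕ}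
    (h : cover d k T Z b j m = true) {W : List Cell} (hW : Sub W (Z.map Prod.fst))
    (hj : size W ≤ j) : (b = true ∧ Sub W (Z.map Prod.snd)) ∨ ∃ t ∈ T, t.1 + (j - size W) ≤ k + 1 ∧
      t.2 &&& (d &&& (reach W (Z.map Prod.fst) m >>> 64)) = t.2 := by
  induction Z generalizing W b j m with
  | nil =>
    cases hW
    rw [cover, Bool.or_eq_true, List.any_eq_true] at h
    rcases h with h | ⟨t, ht, h⟩
    · exact .inl ⟨h, .nil⟩
    · rw [Bool.and_eq_true, Nat.ble_eq, Nat.beq_eq] at h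
      exact .inr ⟨t, ht, by simpa [size] using h.1, by simpa [reach] using h.2⟩
  | cons z Z ih =>
    obtain ⟨p, y⟩ := z
    rw [List.map_cons] at hW
    obtain _ | ⟨ha, hW⟩ := hW
    rename_i a W
    have hs : size (a :: W) = a.size + size W := by simp [size]
    rw [cover, List.all_eq_true] at h
    have h1 := h a (Cell.mem_subs.2 ha)
    rw [Bool.or_eq_true, Nat.blt_eq] at h1
    rcases ih (h1.resolve_left (by omega)) hW (by omega) with ⟨h2, h3⟩ | ⟨t, ht, h2, h3⟩
    · rw [Bool.and_eq_true] at h2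
      exact .inl ⟨h2.1, .cons h2.2 h3⟩
    · exact .inr ⟨t, ht, by omega, h3⟩

theorem run_block (b : Bool) : run (block b) base = some base := by cases b <;> rfl

theorem run_block_eq_none (b : Bool) : ∀ σ, σ ≠ base → run (block b) σ = none := by
  cases b <;> decide

theorem word_cons (b : Bool) (L : List Bool) : word (b :: L) = block b ++ word L := rfl

theorem word_append (L R : List Bool) : word (L ++ R) = word L ++ word R := by simp [word]

theorem run_word (L : List Bool) : run (word L) base = some base := by
  induction L with
  | nil => rfl
  | cons b L ih => rw [word_cons, run_append, run_block]; exact ih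

theorem closed_word (L : List Bool) : Closed (word L) := ⟨base, run_word L⟩

theorem Dominates.force_le {d k : ℕ} {X Y : List Bool} {Ws : List (List Cell)}
    (h : Dominates d k X Y Ws) (R : List Bool)
    (hd : ∀ σ τ : CutState, (R = [] → σ = τ) → d.testBit (τ.idx + 8 * σ.idx) = true) :
    force (word (Y ++ R)) ≤ force (word (X ++ R)) + 1 := by
  obtain ⟨⟨hlen, hne⟩, hY, hWs, hfull, hcov⟩ := h
  have hR : word R = [] → R = [] := by
    intro h
    cases R with
    | nil => rfl
    | cons b R => cases b <;> simp [word_cons, block] at h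
  rw [word_append, word_append]
  refine force_replace_le (run_word X) (run_word Y) (fun σ hσ => ?_) hlen hne (run_word R)
    fun W hW => ?_
  · cases Y with
    | nil => exact absurd rfl hY
    | cons b Y => rw [word_cons, run_append, run_block_eq_none b σ hσ]; rfl
  · have hkey : Sub W (word Y) ∨ ∃ t ∈ table d (word Y) Ws, t.1 ≤ size W + 1 ∧
        t.2 &&& (d &&& (reach W (word X) start >>> 64)) = t.2 := by
      by_cases hs : size W ≤ k
      · have hz1 : ((word X).zip (word Y)).map Prod.fst = word X := List.map_fst_zip hlen.le
        have hz2 : ((word X).zip (word Y)).map Prod.snd = word Y := List.map_snd_zip hlen.ge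
        rcases cover_spec hcov (W := W) (by rwa [hz1]) hs with ⟨-, h⟩ | ⟨t, ht, h1, h2⟩
        · exact .inl (by rwa [hz2] at h)
        · exact .inr ⟨t, ht, by omega, by rwa [hz1] at h2⟩
      · exact .inr ⟨_, hfull, by simp only; omega, by simp⟩
    refine hkey.imp_right ?_
    rintro ⟨t, ht, h1, h2⟩
    obtain ⟨W', hW', rfl⟩ := List.mem_map.1 ht
    refine ⟨W', hWs W' hW', h1, fun σ τ hστ hdev => ?_⟩
    rw [← testBit_reach_start hW.length_eq]
    rw [← testBit_reach_start (hWs W' hW').length_eq] at hdev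
    have h3 := congrArg (fun m : ℕ => m.testBit (τ.idx + 8 * σ.idx)) h2
    have h4 : (Nat.land d (Nat.shiftRight (reach W' (word Y) start) 64)).testBit
        (τ.idx + 8 * σ.idx) = true := by
      change (d &&& _).testBit _ = true
      rw [Nat.testBit_and, hdev, hd σ τ (fun h => hστ (by rw [h]; rfl))]
      rfl
    simp only [Nat.testBit_and] at h3
    rw [h4] at h3
    simp only [Bool.true_and, Bool.and_eq_true] at h3
    exact h3.2

instance (d k : ℕ) (X Y : List Bool) (Ws : List (List Cell)) :
    Decidable (Dominates d k X Y Ws) := by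
  unfold Dominates Sub
  infer_instance

/-- The mask of length `n` with the given nonempty cells. -/
def mask (n : ℕ) (l : List (ℕ × Cell)) : List Cell :=
  (List.range n).map fun i => ((l.find? fun t => t.1 == i).map Prod.snd).getD .o

/-- All pairs of states. -/
def allPairs : ℕ := 18446744073709551615

/-- All pairs of equal states. -/
def diagonal : ℕ := 9241421688590303745

theorem dominates_ccd_cdc : Dominates allPairs 1
    [true, true, false]
    [true, false, true]
    [mask 10 [(0, .u), (1, .s), (8, .s)],
      mask 10 [(1, .s), (8, .s)]] := by
  decide +kernel

theorem dominates_dcd_ddc : Dominates allPairs 1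
    [false, true, false]
    [false, false, true]
    [mask 11 [(0, .u), (8, .u), (9, .s)],
      mask 11 [(0, .u), (9, .s)]] := by
  decide +kernel

theorem dominates_dcc_cdc : Dominates allPairs 1
    [false, true, true]
    [true, false, true]
    [mask 10 [(0, .u), (1, .s), (8, .s)],
      mask 10 [(1, .s), (8, .s)]] := by
  decide +kernel

theorem dominates_dcd_cdd : Dominates allPairs 1
    [false, true, false]
    [true, false, false]
    [mask 11 [(0, .u), (1, .s), (8, .u)],
      mask 11 [(1, .s), (4, .u)]] := by
  decide +kernel

theorem dominates_ddd_cccc : Dominates allPairs 1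
    [false, false, false]
    [true, true, true, true]
    [mask 12 [(0, .u), (1, .s), (10, .s)],
      mask 12 [(1, .s), (10, .s)]] := by
  decide +kernel

theorem dominates_cccccc_cdddc : Dominates allPairs 2
    [true, true, true, true, true, true]
    [true, false, false, false, true]
    [mask 18 [(0, .u), (1, .s), (4, .u), (16, .s)],
      mask 18 [(1, .s), (11, .u), (14, .v)],
      mask 18 [(0, .u), (1, .s), (16, .s)],
      mask 18 [(4, .v), (16, .s)],
      mask 18 [(0, .u), (4, .v), (16, .s)],
      mask 18 [(1, .s), (12, .v)],
      mask 18 [(1, .s), (12, .v), (17, .v)],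
      mask 18 [(0, .u), (1, .s), (12, .v)],
      mask 18 [(4, .v), (15, .u), (16, .s)]] := by
  decide +kernel

theorem dominates_cccccd_cdddd : Dominates allPairs 2
    [true, true, true, true, true, false]
    [true, false, false, false, false]
    [mask 19 [(0, .u), (1, .s), (8, .u), (16, .u)],
      mask 19 [(1, .s), (8, .u), (16, .u)],
      mask 19 [(0, .u), (15, .u)],
      mask 19 [(0, .u), (1, .s), (18, .v)],
      mask 19 [(1, .s), (4, .u), (15, .u)],
      mask 19 [(11, .u), (14, .v), (16, .u)]] := by
  decide +kernel

theorem dominates_dccccd_ddddd : Dominates allPairs 3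
    [false, true, true, true, true, false]
    [false, false, false, false, false]
    [mask 20 [(0, .u), (1, .uv), (9, .u), (17, .u)],
      mask 20 [(1, .u), (12, .u), (15, .v), (17, .u)],
      mask 20 [(0, .u), (5, .u), (16, .u)],
      mask 20 [(0, .u), (1, .uv), (17, .u)],
      mask 20 [(0, .u), (13, .u), (17, .v)],
      mask 20 [(1, .u), (16, .u)],
      mask 20 [(0, .u), (5, .u), (13, .u), (17, .v)],
      mask 20 [(0, .u), (3, .v), (5, .u), (13, .u)],
      mask 20 [(1, .u), (12, .u), (17, .u)],
      mask 20 [(0, .u), (1, .uv)],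
      mask 20 [(8, .u), (11, .v), (13, .u)],
      mask 20 [(1, .u), (19, .v)]] := by
  decide +kernel

theorem dominates_cccc_ddd : Dominates diagonal 1
    [true, true, true, true]
    [false, false, false]
    [mask 12 [(0, .u), (1, .uv)],
      mask 12 [(0, .u), (1, .u)]] := by
  decide +kernel

theorem dominates_ccccc_cddd : Dominates diagonal 1
    [true, true, true, true, true]
    [true, false, false, false]
    [mask 15 [(0, .u), (1, .s), (4, .u)],
      mask 15 [(1, .s), (11, .u)]] := by
  decide +kernel

theorem dominates_ccccd_dddd : Dominates diagonal 1
    [true, true, true, true, false]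
    [false, false, false, false]
    [mask 16 [(0, .u), (3, .v), (5, .u)],
      mask 16 [(1, .u), (12, .u)]] := by
  decide +kernel

theorem testBit_allPairs (σ τ : CutState) : allPairs.testBit (τ.idx + 8 * σ.idx) = true := by
  revert σ τ; decide +kernel

theorem testBit_diagonal (σ : CutState) : diagonal.testBit (σ.idx + 8 * σ.idx) = true := by
  revert σ; decide +kernel

/-- The smallest number of edges which force a word. -/
noncomputable def wordForce (L : List Bool) : ℕ := force (word L)

theorem wordForce_rotate (a b : List Bool) : wordForce (a ++ b) = wordForce (b ++ a) := by
  have := closed_word (b ++ a)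
  rw [word_append] at this
  rw [wordForce, wordForce, word_append, word_append, force_rotate this]

theorem Dominates.wordForce_le {k : ℕ} {X Y : List Bool} {Ws : List (List Cell)}
    (h : Dominates allPairs k X Y Ws) (R : List Bool) :
    wordForce (Y ++ R) ≤ wordForce (X ++ R) + 1 :=
  h.force_le R fun σ τ _ => testBit_allPairs σ τ

theorem Dominates.wordForce_le_of_diagonal {k : ℕ} {X Y : List Bool} {Ws : List (List Cell)}
    (h : Dominates diagonal k X Y Ws) : wordForce Y ≤ wordForce X + 1 := by
  have := h.force_le [] fun σ τ hστ => by rw [hστ rfl]; exact testBit_diagonal τ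
  rwa [List.append_nil, List.append_nil] at this

/-- Forcing numbers that differ by at most one. -/
def Near (X Y : List Bool) : Prop :=
  wordForce X ≤ wordForce Y + 1 ∧ wordForce Y ≤ wordForce X + 1

theorem Near.symm {X Y : List Bool} (h : Near X Y) : Near Y X := ⟨h.2, h.1⟩

theorem near_of_eq {X Y : List Bool} (h : wordForce X = wordForce Y) : Near X Y := by
  unfold Near; omega

theorem Near.of_rotate {P X Y L : List Bool} (h : Near (X ++ (L ++ P)) (Y ++ (L ++ P))) :
    Near (P ++ (X ++ L)) (P ++ (Y ++ L)) := by
  unfold Near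
  rw [wordForce_rotate P, wordForce_rotate P, List.append_assoc, List.append_assoc]
  exact h

theorem near_swap_head (R : List Bool) : Near ([true, false] ++ R) ([false, true] ++ R) := by
  constructor
  · rcases R with _ | ⟨r, R⟩
    · exact (near_of_eq (wordForce_rotate [true] [false])).1
    · cases r
      · exact dominates_dcd_cdd.wordForce_le R
      · exact dominates_dcc_cdc.wordForce_le R
  · rcases R.eq_nil_or_concat with rfl | ⟨R, l, rfl⟩
    · exact (near_of_eq (wordForce_rotate [true] [false])).2
    · rw [List.concat_eq_append, ← List.append_assoc, ← List.append_assoc, wordForce_rotate _ [l],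
        wordForce_rotate _ [l]]
      cases l
      · exact dominates_dcd_ddc.wordForce_le R
      · exact dominates_ccd_cdc.wordForce_le R

theorem near_swap (P L : List Bool) (x y : Bool) : Near (P ++ y :: x :: L) (P ++ x :: y :: L) := by
  cases x <;> cases y
  · exact near_of_eq rfl
  · exact Near.of_rotate (X := [true, false]) (Y := [false, true]) (near_swap_head _)
  · exact Near.of_rotate (X := [false, true]) (Y := [true, false]) (near_swap_head _).symm
  · exact near_of_eq rfl

theorem wordForce_cccc_le (R : List Bool) : wordForce ([true, true, true, true] ++ R) ≤
    wordForce ([false, false, false] ++ R) + 1 :=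
  dominates_ddd_cccc.wordForce_le R

/-- Four blocks `C` can be exchanged for three blocks `D` in some word with given numbers of
blocks. -/
theorem exists_near_exchange (a b : ℕ) : ∃ X Y : List Bool, X.count true = a + 4 ∧
    X.count false = b ∧ Y.count true = a ∧ Y.count false = b + 3 ∧ Near X Y := by
  suffices h : ∃ P R : List Bool, (P ++ R).count true = a ∧ (P ++ R).count false = b ∧
      wordForce (P ++ ([false, false, false] ++ R)) ≤
        wordForce (P ++ ([true, true, true, true] ++ R)) + 1 by
    obtain ⟨P, R, h1, h2, h3⟩ := h
    simp only [List.count_append] at h1 h2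
    refine ⟨_, _, ?_, ?_, ?_, ?_, Near.of_rotate (P := P) (X := [true, true, true, true])
      (Y := [false, false, false]) (L := R) ⟨wordForce_cccc_le _, ?_⟩⟩
    · simp only [List.count_append]; simp; omega
    · simp only [List.count_append]; simp; omega
    · simp only [List.count_append]; simp; omega
    · simp only [List.count_append]; simp; omega
    · rwa [← List.append_assoc, ← List.append_assoc, wordForce_rotate _ P, wordForce_rotate _ P]
  rcases b with _ | b
  · rcases a with _ | _ | a
    · exact ⟨[], [], rfl, rfl, dominates_cccc_ddd.wordForce_le_of_diagonal⟩
    · exact ⟨[true], [], rfl, rfl, dominates_ccccc_cddd.wordForce_le_of_diagonal⟩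
    · exact ⟨[true], true :: List.replicate a true, by simp,
        by simp [List.count_replicate], dominates_cccccc_cdddc.wordForce_le _⟩
  · rcases a with _ | a
    · rcases b with _ | b
      · exact ⟨[], [false], rfl, rfl, dominates_ccccd_dddd.wordForce_le_of_diagonal⟩
      · exact ⟨[false], false :: List.replicate b false, by simp [List.count_replicate],
          by simp, dominates_dccccd_ddddd.wordForce_le _⟩
    · exact ⟨[true], false :: (List.replicate a true ++ List.replicate b false),
        by simp [List.count_replicate], by simp [List.count_replicate],
        dominates_cccccd_cdddd.wordForce_le _⟩

/-- Every value between the forcing numbers of `X` and `Y` is attained by a word of the same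
length as `X`. -/
def Connected (X Y : List Bool) : Prop :=
  ∀ k ∈ Set.uIcc (wordForce X) (wordForce Y),
    ∃ L : List Bool, (L.map cdLen).sum = (X.map cdLen).sum ∧ wordForce L = k

theorem Near.connected {X Y : List Bool} (h : Near X Y)
    (hs : (X.map cdLen).sum = (Y.map cdLen).sum) : Connected X Y := by
  intro k hk
  obtain ⟨h1, h2⟩ := h
  have : k = wordForce X ∨ k = wordForce Y := by
    rcases Set.mem_uIcc.1 hk with ⟨_, _⟩ | ⟨_, _⟩ <;> omega
  rcases this with rfl | rfl
  · exact ⟨X, rfl, rfl⟩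
  · exact ⟨Y, hs.symm, rfl⟩

theorem Connected.trans {X Y Z : List Bool} (h : Connected X Y) (h' : Connected Y Z)
    (hs : (X.map cdLen).sum = (Y.map cdLen).sum) : Connected X Z := by
  intro k hk
  rcases Set.uIcc_subset_uIcc_union_uIcc (b := wordForce Y) hk with hk | hk
  · exact h k hk
  · obtain ⟨L, h1, h2⟩ := h' k hk
    exact ⟨L, h1.trans hs.symm, h2⟩

theorem Connected.symm {X Y : List Bool} (h : Connected X Y)
    (hs : (X.map cdLen).sum = (Y.map cdLen).sum) : Connected Y X := by
  intro k hk
  rw [Set.uIcc_comm] at hk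
  rw [← hs]
  exact h k hk

theorem sum_eq_of_perm {X Y : List Bool} (h : X.Perm Y) :
    (X.map cdLen).sum = (Y.map cdLen).sum :=
  (h.map cdLen).sum_eq

theorem connected_of_perm {X Y : List Bool} (h : X.Perm Y) (P : List Bool) :
    Connected (P ++ X) (P ++ Y) := by
  induction h generalizing P with
  | nil => exact (near_of_eq rfl).connected rfl
  | cons x h ih => simpa using ih (P ++ [x])
  | swap x y l =>
    exact (near_swap P l x y).connected (sum_eq_of_perm ((List.Perm.swap x y l).append_left P))
  | trans h h' ih ih' => exact (ih P).trans (ih' P) (sum_eq_of_perm (h.append_left P))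

theorem sum_cdLen (X : List Bool) : (X.map cdLen).sum = 3 * X.count true + 4 * X.count false := by
  induction X with
  | nil => rfl
  | cons x X ih => cases x <;> simp [cdLen, ih] <;> ring

theorem perm_of_count {X Y : List Bool} (h : X.count true = Y.count true)
    (h' : X.count false = Y.count false) : X.Perm Y :=
  List.perm_iff_count.2 fun b => by cases b <;> assumption

theorem connected_aux (j : ℕ) : ∀ {X Y : List Bool}, (X.map cdLen).sum = (Y.map cdLen).sum →
    Y.count false = X.count false + j → Connected X Y := by
  induction j using Nat.strong_induction_on with
  | _ j ih =>
    intro X Y hs hj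
    have hs' := hs
    rw [sum_cdLen, sum_cdLen] at hs'
    rcases Nat.eq_zero_or_pos j with rfl | hpos
    · exact connected_of_perm (perm_of_count (by omega) (by omega)) []
    · obtain ⟨X', Y', h1, h2, h3, h4, h5⟩ :=
        exists_near_exchange (X.count true - 4) (X.count false)
      have hX : X.Perm X' := perm_of_count (by omega) h2.symm
      have hXY : (X'.map cdLen).sum = (Y'.map cdLen).sum := by
        rw [sum_cdLen, sum_cdLen]; omega
      have hY : (Y'.map cdLen).sum = (Y.map cdLen).sum :=
        hXY.symm.trans ((sum_eq_of_perm hX).symm.trans hs)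
      exact ((connected_of_perm hX []).trans (h5.connected hXY) (sum_eq_of_perm hX)).trans
        (ih (j - 3) (by omega) hY (by omega)) ((sum_eq_of_perm hX).trans hXY)

/-- The forcing numbers of the words of a given length form an interval. -/
theorem connected_of_sum_eq {X Y : List Bool} (hs : (X.map cdLen).sum = (Y.map cdLen).sum) :
    Connected X Y := by
  rcases le_total (X.count false) (Y.count false) with h | h
  · exact connected_aux _ hs (Nat.add_sub_cancel' h).symm
  · exact (connected_aux _ hs.symm (Nat.add_sub_cancel' h).symm).symm hs.symm


/-! ### Invariance under the rotations of `P(n,2)` -/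

theorem subgraph_ext_of_edgeSet {V : Type*} {G : SimpleGraph V} {M M' : G.Subgraph}
    (hM : M.IsPerfectMatching) (hM' : M'.IsPerfectMatching) (h : M.edgeSet = M'.edgeSet) :
    M = M' := by
  refine Subgraph.ext ?_ ?_
  · rw [hM.2.verts_eq_univ, hM'.2.verts_eq_univ]
  · ext x y
    rw [← Subgraph.mem_edgeSet, ← Subgraph.mem_edgeSet, h]

theorem map_adj_iff {V : Type*} {G : SimpleGraph V} (φ : G ≃g G) (M : G.Subgraph) (x y : V) :
    (M.map φ.toHom).Adj x y ↔ M.Adj (φ.symm x) (φ.symm y) := by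
  rw [Subgraph.map_adj, Relation.map_apply]
  constructor
  · rintro ⟨a, b, h, rfl, rfl⟩
    simpa using h
  · exact fun h => ⟨_, _, h, by simp, by simp⟩

theorem map_map_symm {V : Type*} {G : SimpleGraph V} (φ : G ≃g G) (M : G.Subgraph) :
    (M.map φ.toHom).map φ.symm.toHom = M := by
  refine Subgraph.ext ?_ ?_
  · rw [Subgraph.map_verts, Subgraph.map_verts, Set.image_image]
    simp
  · ext x y
    rw [map_adj_iff, map_adj_iff]
    simp

theorem IsPerfectMatching.map_iso {V : Type*} {G : SimpleGraph V} (φ : G ≃g G) {M : G.Subgraph}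
    (hM : M.IsPerfectMatching) : (M.map φ.toHom).IsPerfectMatching := by
  rw [Subgraph.isPerfectMatching_iff] at hM ⊢
  intro x
  simp only [map_adj_iff]
  obtain ⟨y, hy, huniq⟩ := hM (φ.symm x)
  exact ⟨φ y, by simpa using hy, fun z hz => by simp [← huniq _ hz]⟩

theorem IsForcingSet.map_iso {V : Type*} {G : SimpleGraph V} (φ : G ≃g G) {M : G.Subgraph}
    {S : Set (Sym2 V)} (hS : IsForcingSet G M S) :
    IsForcingSet G (M.map φ.toHom) (Sym2.map φ '' S) := by
  refine ⟨?_, fun M' hM' h => ?_⟩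
  · rw [Subgraph.edgeSet_map]
    exact Set.image_mono hS.1
  · have h1 := hS.2 _ (IsPerfectMatching.map_iso φ.symm hM') fun e he => by
      induction e with | _ x y
      have := h ⟨_, he, rfl⟩
      rw [Subgraph.mem_edgeSet, map_adj_iff]
      simpa using this
    rw [← h1]
    exact (map_map_symm φ.symm M').symm

theorem forcingNumber_map_iso {V : Type*} {G : SimpleGraph V} (φ : G ≃g G) (M : G.Subgraph) :
    forcingNumber G (M.map φ.toHom) = forcingNumber G M := by
  unfold forcingNumber
  congr 1
  have hcard (ψ : G ≃g G) (S : Set (Sym2 V)) : (Sym2.map ψ '' S).ncard = S.ncard :=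
    Set.ncard_image_of_injective _ (Sym2.map.injective ψ.injective)
  ext k
  constructor
  · rintro ⟨S, hS, rfl⟩
    refine ⟨_, ?_, hcard φ.symm S⟩
    have := IsForcingSet.map_iso φ.symm hS
    rwa [map_map_symm] at this
  · rintro ⟨S, hS, rfl⟩
    exact ⟨_, IsForcingSet.map_iso φ hS, hcard φ S⟩

variable {n : ℕ}

/-- The rotation of the vertices by `t`. -/
def shift (t : ZMod n) : PV n ≃ PV n := Equiv.sumCongr (Equiv.addRight t) (Equiv.addRight t)

theorem shift_pu (t k : ZMod n) : shift t (pu k) = pu (k + t) := rfl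

theorem shift_pv (t k : ZMod n) : shift t (pv k) = pv (k + t) := rfl

theorem shift_neg (t : ZMod n) (x : PV n) : shift (-t) (shift t x) = x := by
  rcases x with x | x <;> simp [shift]

theorem adj_shift (t : ZMod n) {x y : PV n} (h : (petersen n).Adj x y) :
    (petersen n).Adj (shift t x) (shift t y) := by
  have key : ∀ x y : PV n, ((∃ i : ZMod n, x = pu i ∧ y = pu (i + 2)) ∨
      (∃ i : ZMod n, x = pu i ∧ y = pv i) ∨ (∃ i : ZMod n, x = pv i ∧ y = pv (i + 1))) →
      ((∃ i : ZMod n, shift t x = pu i ∧ shift t y = pu (i + 2)) ∨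
      (∃ i : ZMod n, shift t x = pu i ∧ shift t y = pv i) ∨
      (∃ i : ZMod n, shift t x = pv i ∧ shift t y = pv (i + 1))) := by
    rintro x y (⟨i, rfl, rfl⟩ | ⟨i, rfl, rfl⟩ | ⟨i, rfl, rfl⟩)
    · exact .inl ⟨i + t, rfl, by rw [shift_pu, add_right_comm]⟩
    · exact .inr (.inl ⟨i + t, rfl, rfl⟩)
    · exact .inr (.inr ⟨i + t, rfl, by rw [shift_pv, add_right_comm]⟩)
  rw [petersen, SimpleGraph.fromRel_adj] at h ⊢
  exact ⟨(shift t).injective.ne h.1, h.2.imp (key _ _) (key _ _)⟩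

/-- The rotation by `t` as an automorphism. -/
def shiftIso (t : ZMod n) : petersen n ≃g petersen n where
  toEquiv := shift t
  map_rel_iff' := ⟨fun h => by simpa [shift_neg] using adj_shift (-t) h, adj_shift t⟩

theorem image_blockC (t i : ZMod n) :
    Sym2.map (shift t) '' blockC n i = blockC n (i + t) := by
  simp [blockC, Set.image_insert_eq, shift_pu, shift_pv, add_right_comm]

theorem image_blockD (t i : ZMod n) :
    Sym2.map (shift t) '' blockD n i = blockD n (i + t) := by
  simp [blockD, Set.image_insert_eq, shift_pu, shift_pv, add_right_comm]

theorem image_cdEdges (t i : ZMod n) (L : List Bool) :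
    Sym2.map (shift t) '' cdEdges n i L = cdEdges n (i + t) L := by
  induction L generalizing i with
  | nil => simp [cdEdges]
  | cons b L ih =>
    cases b <;>
      simp only [cdEdges, Set.image_union, ih, image_blockC, image_blockD, add_right_comm]

/-- The forcing number does not depend on the starting position. -/
theorem forcingNumber_eq_of_cdEdges {M M' : (petersen n).Subgraph} (hM : M.IsPerfectMatching)
    (hM' : M'.IsPerfectMatching) {i j : ZMod n} {L : List Bool} (h : M.edgeSet = cdEdges n i L)
    (h' : M'.edgeSet = cdEdges n j L) :
    forcingNumber (petersen n) M = forcingNumber (petersen n) M' := by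
  have : M' = M.map (shiftIso (j - i)).toHom := by
    refine subgraph_ext_of_edgeSet hM' (IsPerfectMatching.map_iso _ hM) ?_
    rw [Subgraph.edgeSet_map, h, h']
    have := image_cdEdges (j - i) i L
    rw [add_sub_cancel] at this
    exact this.symm
  rw [this, forcingNumber_map_iso]

/-! ### Perfect matchings as cyclic lists of cells -/

/-- The edge `u_k u_{k+2}`. -/
def edgeU (k : ZMod n) : Sym2 (PV n) := s(pu k, pu (k + 2))

/-- The spoke `u_k v_k`. -/
def edgeS (k : ZMod n) : Sym2 (PV n) := s(pu k, pv k)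

/-- The edge `v_k v_{k+1}`. -/
def edgeV (k : ZMod n) : Sym2 (PV n) := s(pv k, pv (k + 1))

/-- The edges of a cell at position `k`. -/
def cellEdges (k : ZMod n) (c : Cell) : Set (Sym2 (PV n)) :=
  {e | (c.hasU = true ∧ e = edgeU k) ∨ (c.hasS = true ∧ e = edgeS k) ∨
    (c.hasV = true ∧ e = edgeV k)}

/-- The edges of an assignment of cells to positions. -/
def edges (g : ZMod n → Cell) : Set (Sym2 (PV n)) := {e | ∃ k, e ∈ cellEdges k (g k)}

theorem natCast_ne_zero (hn : 5 ≤ n) (m : ℕ) (hm : 0 < m) (hm' : m < 5) : (m : ZMod n) ≠ 0 := by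
  rw [Ne, ZMod.natCast_eq_zero_iff]
  exact fun h => by have := Nat.le_of_dvd hm h; omega

theorem one_ne_zero' (hn : 5 ≤ n) : (1 : ZMod n) ≠ 0 := by
  simpa using natCast_ne_zero hn 1 (by norm_num) (by norm_num)

theorem two_ne_zero' (hn : 5 ≤ n) : (2 : ZMod n) ≠ 0 := by
  simpa using natCast_ne_zero hn 2 (by norm_num) (by norm_num)

theorem four_ne_zero' (hn : 5 ≤ n) : (4 : ZMod n) ≠ 0 := by
  simpa using natCast_ne_zero hn 4 (by norm_num) (by norm_num)

theorem pu_inj {i j : ZMod n} : (pu i : PV n) = pu j ↔ i = j := Sum.inl_injective.eq_iff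

theorem pv_inj {i j : ZMod n} : (pv i : PV n) = pv j ↔ i = j := Sum.inr_injective.eq_iff

theorem pu_ne_pv {i j : ZMod n} : (pu i : PV n) ≠ pv j := Sum.inl_ne_inr

theorem pv_ne_pu {i j : ZMod n} : (pv i : PV n) ≠ pu j := Sum.inr_ne_inl

theorem edgeU_inj (hn : 5 ≤ n) {k l : ZMod n} : edgeU k = edgeU l ↔ k = l := by
  refine ⟨fun h => ?_, fun h => by rw [h]⟩
  rw [edgeU, edgeU, Sym2.eq_iff, pu_inj, pu_inj, pu_inj, pu_inj] at h
  rcases h with h | ⟨h, h'⟩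
  · exact h.1
  · exact absurd (by linear_combination h' - h) (four_ne_zero' hn)

theorem edgeV_inj (hn : 5 ≤ n) {k l : ZMod n} : edgeV k = edgeV l ↔ k = l := by
  refine ⟨fun h => ?_, fun h => by rw [h]⟩
  rw [edgeV, edgeV, Sym2.eq_iff, pv_inj, pv_inj, pv_inj, pv_inj] at h
  rcases h with h | ⟨h, h'⟩
  · exact h.1
  · exact absurd (by linear_combination h' - h) (two_ne_zero' hn)

theorem edgeS_inj {k l : ZMod n} : edgeS k = edgeS l ↔ k = l := by
  simp [edgeS, pu_inj, pv_inj, pu_ne_pv]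

theorem edgeU_ne_edgeS {k l : ZMod n} : edgeU k ≠ edgeS l := by
  simp [edgeU, edgeS, pu_ne_pv]

theorem edgeU_ne_edgeV {k l : ZMod n} : edgeU k ≠ edgeV l := by
  simp [edgeU, edgeV, pu_ne_pv]

theorem edgeS_ne_edgeV {k l : ZMod n} : edgeS k ≠ edgeV l := by
  simp [edgeS, edgeV, pu_ne_pv]

theorem edgeU_mem (hn : 5 ≤ n) {g : ZMod n → Cell} {k : ZMod n} :
    edgeU k ∈ edges g ↔ (g k).hasU = true := by
  simp [edges, cellEdges, edgeU_inj hn, edgeU_ne_edgeS, edgeU_ne_edgeV]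

theorem edgeS_mem {g : ZMod n → Cell} {k : ZMod n} :
    edgeS k ∈ edges g ↔ (g k).hasS = true := by
  simp [edges, cellEdges, edgeS_inj, edgeU_ne_edgeS.symm, edgeS_ne_edgeV]

theorem edgeV_mem (hn : 5 ≤ n) {g : ZMod n → Cell} {k : ZMod n} :
    edgeV k ∈ edges g ↔ (g k).hasV = true := by
  simp [edges, cellEdges, edgeV_inj hn, edgeS_ne_edgeV.symm, edgeU_ne_edgeV.symm]

theorem Cell.le_iff (a b : Cell) : Cell.le a b = true ↔ (a.hasU = true → b.hasU = true) ∧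
    (a.hasS = true → b.hasS = true) ∧ (a.hasV = true → b.hasV = true) := by
  revert a b; decide

theorem edges_subset (hn : 5 ≤ n) {S g : ZMod n → Cell} :
    edges S ⊆ edges g ↔ ∀ k, Cell.le (S k) (g k) = true := by
  constructor
  · intro h k
    rw [Cell.le_iff, ← edgeU_mem hn, ← edgeU_mem hn, ← edgeS_mem, ← edgeS_mem, ← edgeV_mem hn,
      ← edgeV_mem hn]
    exact ⟨@h _, @h _, @h _⟩
  · rintro h e ⟨k, he⟩
    obtain ⟨h1, h2, h3⟩ := (Cell.le_iff _ _).1 (h k)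
    exact ⟨k, he.imp (And.imp_left h1) (Or.imp (And.imp_left h2) (And.imp_left h3))⟩

theorem edges_injective (hn : 5 ≤ n) : Function.Injective (edges (n := n)) := fun _ _ h =>
  funext fun k => Cell.le_antisymm ((edges_subset hn).1 h.subset k)
    ((edges_subset hn).1 h.superset k)

theorem petersen_adj (hn : 5 ≤ n) {x y : PV n} : (petersen n).Adj x y ↔
    ∃ k, s(x, y) = edgeU k ∨ s(x, y) = edgeS k ∨ s(x, y) = edgeV k := by
  rw [petersen, SimpleGraph.fromRel_adj]
  constructor
  · rintro ⟨-, (⟨i, rfl, rfl⟩ | ⟨i, rfl, rfl⟩ | ⟨i, rfl, rfl⟩) |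
      (⟨i, rfl, rfl⟩ | ⟨i, rfl, rfl⟩ | ⟨i, rfl, rfl⟩)⟩
    · exact ⟨i, .inl rfl⟩
    · exact ⟨i, .inr (.inl rfl)⟩
    · exact ⟨i, .inr (.inr rfl)⟩
    · exact ⟨i, .inl Sym2.eq_swap⟩
    · exact ⟨i, .inr (.inl Sym2.eq_swap)⟩
    · exact ⟨i, .inr (.inr Sym2.eq_swap)⟩
  · rintro ⟨k, h | h | h⟩ <;>
      [rw [edgeU, Sym2.eq_iff] at h; rw [edgeS, Sym2.eq_iff] at h; rw [edgeV, Sym2.eq_iff] at h] <;>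
      obtain ⟨rfl, rfl⟩ | ⟨rfl, rfl⟩ := h <;>
      simp [pu_inj, pv_inj, pu_ne_pv, pv_ne_pu, one_ne_zero' hn, two_ne_zero' hn]

theorem mem_edges_pu {g : ZMod n → Cell} {k : ZMod n} {y : PV n} :
    s(pu k, y) ∈ edges g ↔ ((g (k - 2)).hasU = true ∧ y = pu (k - 2)) ∨
      ((g k).hasU = true ∧ y = pu (k + 2)) ∨ ((g k).hasS = true ∧ y = pv k) := by
  constructor
  · rintro ⟨l, ⟨h, he⟩ | ⟨h, he⟩ | ⟨h, he⟩⟩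
    · rw [edgeU, Sym2.eq_iff] at he
      obtain ⟨h1, rfl⟩ | ⟨h1, rfl⟩ := he <;> rw [pu_inj] at h1 <;> subst h1
      · exact .inr (.inl ⟨h, rfl⟩)
      · rw [add_sub_cancel_right]
        exact .inl ⟨h, rfl⟩
    · rw [edgeS, Sym2.eq_iff] at he
      obtain ⟨h1, rfl⟩ | ⟨h1, rfl⟩ := he
      · rw [pu_inj] at h1
        subst h1
        exact .inr (.inr ⟨h, rfl⟩)
      · exact absurd h1 pu_ne_pv
    · rw [edgeV, Sym2.eq_iff] at he
      obtain ⟨h1, rfl⟩ | ⟨h1, rfl⟩ := he <;> exact absurd h1 pu_ne_pv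
  · rintro (⟨h, rfl⟩ | ⟨h, rfl⟩ | ⟨h, rfl⟩)
    · exact ⟨k - 2, .inl ⟨h, by rw [edgeU, sub_add_cancel, Sym2.eq_swap]⟩⟩
    · exact ⟨k, .inl ⟨h, rfl⟩⟩
    · exact ⟨k, .inr (.inl ⟨h, rfl⟩)⟩

theorem mem_edges_pv {g : ZMod n → Cell} {k : ZMod n} {y : PV n} :
    s(pv k, y) ∈ edges g ↔ ((g (k - 1)).hasV = true ∧ y = pv (k - 1)) ∨
      ((g k).hasV = true ∧ y = pv (k + 1)) ∨ ((g k).hasS = true ∧ y = pu k) := by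
  constructor
  · rintro ⟨l, ⟨h, he⟩ | ⟨h, he⟩ | ⟨h, he⟩⟩
    · rw [edgeU, Sym2.eq_iff] at he
      obtain ⟨h1, rfl⟩ | ⟨h1, rfl⟩ := he <;> exact absurd h1 pv_ne_pu
    · rw [edgeS, Sym2.eq_iff] at he
      obtain ⟨h1, rfl⟩ | ⟨h1, rfl⟩ := he
      · exact absurd h1 pv_ne_pu
      · rw [pv_inj] at h1
        subst h1
        exact .inr (.inr ⟨h, rfl⟩)
    · rw [edgeV, Sym2.eq_iff] at he
      obtain ⟨h1, rfl⟩ | ⟨h1, rfl⟩ := he <;> rw [pv_inj] at h1 <;> subst h1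
      · exact .inr (.inl ⟨h, rfl⟩)
      · rw [add_sub_cancel_right]
        exact .inl ⟨h, rfl⟩
  · rintro (⟨h, rfl⟩ | ⟨h, rfl⟩ | ⟨h, rfl⟩)
    · exact ⟨k - 1, .inr (.inr ⟨h, by rw [edgeV, sub_add_cancel, Sym2.eq_swap]⟩)⟩
    · exact ⟨k, .inr (.inr ⟨h, rfl⟩)⟩
    · exact ⟨k, .inr (.inl ⟨h, by rw [edgeS, Sym2.eq_swap]⟩)⟩

theorem existsUnique_or {α : Type*} {x y z : α} (hxy : x ≠ y) (hxz : x ≠ z) (hyz : y ≠ z)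
    (a b c : Bool) : (∃! t, (a = true ∧ t = x) ∨ (b = true ∧ t = y) ∨ (c = true ∧ t = z)) ↔
      a.toNat + b.toNat + c.toNat = 1 := by
  have key {p q : α} (hpq : p ≠ q) {P : α → Prop} (hp : P p) (hq : P q) : ¬ ∃! t, P t :=
    fun h => hpq (h.unique hp hq)
  cases a <;> cases b <;> cases c <;> simp
  · exact key hyz (.inl rfl) (.inr rfl)
  · exact key hxz (.inl rfl) (.inr rfl)
  · exact key hxy (.inl rfl) (.inr rfl)
  · exact key hxy (.inl rfl) (.inr (.inl rfl))

/-- Every vertex lies on exactly one edge of the assignment. -/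
def Good (g : ZMod n → Cell) : Prop := ∀ k,
  (g (k - 2)).hasU.toNat + (g k).hasU.toNat + (g k).hasS.toNat = 1 ∧
  (g (k - 1)).hasV.toNat + (g k).hasV.toNat + (g k).hasS.toNat = 1

theorem good_iff (hn : 5 ≤ n) {g : ZMod n → Cell} :
    Good g ↔ ∀ x, ∃! y, s(x, y) ∈ edges g := by
  have h1 (k : ZMod n) : (pu (k - 2) : PV n) ≠ pu (k + 2) := fun h =>
    four_ne_zero' hn (by linear_combination - (pu_inj.1 h))
  have h2 (k : ZMod n) : (pv (k - 1) : PV n) ≠ pv (k + 1) := fun h =>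
    two_ne_zero' hn (by linear_combination - (pv_inj.1 h))
  have h3 (k : ZMod n) : (∃! y, s(pu k, y) ∈ edges g) ↔
      (g (k - 2)).hasU.toNat + (g k).hasU.toNat + (g k).hasS.toNat = 1 := by
    simp only [mem_edges_pu]
    exact existsUnique_or (h1 k) pu_ne_pv pu_ne_pv _ _ _
  have h4 (k : ZMod n) : (∃! y, s(pv k, y) ∈ edges g) ↔
      (g (k - 1)).hasV.toNat + (g k).hasV.toNat + (g k).hasS.toNat = 1 := by
    simp only [mem_edges_pv]
    exact existsUnique_or (h2 k) pv_ne_pu pv_ne_pu _ _ _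
  constructor
  · rintro h (k | k)
    · exact (h3 k).2 (h k).1
    · exact (h4 k).2 (h k).2
  · exact fun h k => ⟨(h3 k).1 (h (pu k)), (h4 k).1 (h (pv k))⟩

theorem Good.exists_subgraph (hn : 5 ≤ n) {g : ZMod n → Cell} (hg : Good g) :
    ∃ M : (petersen n).Subgraph, M.IsPerfectMatching ∧ M.edgeSet = edges g := by
  let M : (petersen n).Subgraph :=
    { verts := Set.univ
      Adj := fun x y => s(x, y) ∈ edges g
      adj_sub := by
        rintro x y ⟨k, h⟩
        exact (petersen_adj hn).2 ⟨k, h.imp And.right (Or.imp And.right And.right)⟩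
      edge_vert := fun _ => Set.mem_univ _
      symm := ⟨fun x y h => by rwa [Sym2.eq_swap]⟩ }
  refine ⟨M, Subgraph.isPerfectMatching_iff.2 ((good_iff hn).1 hg), ?_⟩
  ext e
  induction e with | _ x y
  rfl

theorem exists_cell {P Q R : Prop} (h : ¬ (P ∧ Q)) (h' : ¬ (R ∧ Q)) :
    ∃ c : Cell, (c.hasU = true ↔ P) ∧ (c.hasS = true ↔ Q) ∧ (c.hasV = true ↔ R) := by
  by_cases hP : P <;> by_cases hQ : Q <;> by_cases hR : R
  · exact absurd ⟨hP, hQ⟩ h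
  · exact absurd ⟨hP, hQ⟩ h
  · exact ⟨.uv, by simp [Cell.hasU, Cell.hasS, Cell.hasV, *]⟩
  · exact ⟨.u, by simp [Cell.hasU, Cell.hasS, Cell.hasV, *]⟩
  · exact absurd ⟨hR, hQ⟩ h'
  · exact ⟨.s, by simp [Cell.hasU, Cell.hasS, Cell.hasV, *]⟩
  · exact ⟨.v, by simp [Cell.hasU, Cell.hasS, Cell.hasV, *]⟩
  · exact ⟨.o, by simp [Cell.hasU, Cell.hasS, Cell.hasV, *]⟩

theorem exists_edges_eq (hn : 5 ≤ n) {M : (petersen n).Subgraph} (hM : M.IsPerfectMatching)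
    {T : Set (Sym2 (PV n))} (hT : T ⊆ M.edgeSet) : ∃ g, edges g = T := by
  rw [Subgraph.isPerfectMatching_iff] at hM
  have hc (k : ZMod n) : ∃ c : Cell, (c.hasU = true ↔ edgeU k ∈ T) ∧
      (c.hasS = true ↔ edgeS k ∈ T) ∧ (c.hasV = true ↔ edgeV k ∈ T) := by
    refine exists_cell (fun h => ?_) fun h => ?_
    · exact absurd ((hM (pu k)).unique (hT h.1) (hT h.2)) pu_ne_pv
    · exact absurd ((hM (pv k)).unique (hT h.1) (M.adj_symm (hT h.2))) pv_ne_pu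
  choose g h1 h2 h3 using hc
  refine ⟨g, ?_⟩
  ext e
  constructor
  · rintro ⟨k, ⟨h, rfl⟩ | ⟨h, rfl⟩ | ⟨h, rfl⟩⟩
    · exact (h1 k).1 h
    · exact (h2 k).1 h
    · exact (h3 k).1 h
  · intro he
    induction e with | _ x y
    obtain ⟨k, h | h | h⟩ := (petersen_adj hn).1 (M.adj_sub (hT he))
    · rw [h] at he ⊢
      exact (edgeU_mem hn).2 ((h1 k).2 he)
    · rw [h] at he ⊢
      exact edgeS_mem.2 ((h2 k).2 he)
    · rw [h] at he ⊢
      exact (edgeV_mem hn).2 ((h3 k).2 he)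

/-! ### Assignments of cells and lists of cells -/

/-- The list of cells of an assignment, starting at position `0`. -/
def toList (g : ZMod n → Cell) : List Cell := (List.range n).map fun k : ℕ => g (k : ZMod n)

theorem length_toList (g : ZMod n → Cell) : (toList g).length = n := by simp [toList]

theorem sub_toList [NeZero n] {S g : ZMod n → Cell} :
    Sub (toList S) (toList g) ↔ ∀ k, Cell.le (S k) (g k) = true := by
  rw [Sub, toList, toList, List.forall₂_map_left_iff, List.forall₂_map_right_iff, List.forall₂_same]
  constructor
  · intro h k
    simpa using h k.val (List.mem_range.2 k.val_lt)
  · exact fun h k _ => h k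

theorem toList_injective [NeZero n] : Function.Injective (toList (n := n)) := fun _ _ hgh =>
  funext fun k => Cell.le_antisymm (sub_toList.1 (hgh ▸ Sub.refl _) k)
    (sub_toList.1 (hgh ▸ Sub.refl _) k)

theorem exists_toList_eq {y : List Cell} (hy : y.length = n) :
    ∃ g : ZMod n → Cell, toList g = y := by
  refine ⟨fun k => y.getD k.val .o, List.ext_getElem (by simp [length_toList, hy]) fun k h h' => ?_⟩
  rw [hy] at h'
  simp [toList, ZMod.val_natCast, Nat.mod_eq_of_lt h', h', hy]

/-- The edges of an assignment passing from the positions before `k` to the positions from `k`. -/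
def cutAt (g : ZMod n → Cell) (k : ZMod n) : CutState :=
  ((g (k - 2)).hasU, (g (k - 1)).hasU, (g (k - 1)).hasV)

theorem read_cutAt (g : ZMod n → Cell) (k : ZMod n) (τ : CutState) :
    read (cutAt g k) (g k) = some τ ↔
      ((g (k - 2)).hasU.toNat + (g k).hasU.toNat + (g k).hasS.toNat = 1 ∧
      (g (k - 1)).hasV.toNat + (g k).hasV.toNat + (g k).hasS.toNat = 1) ∧ cutAt g (k + 1) = τ := by
  have h : k + 1 - 2 = k - 1 := by ring
  simp only [read, cutAt, h, add_sub_cancel_right]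
  split_ifs with h' <;> simp [h']

theorem run_cutAt (g : ZMod n → Cell) (m : ℕ) (τ : CutState) :
    run ((List.range m).map fun k : ℕ => g (k : ZMod n)) (cutAt g 0) = some τ ↔
      (∀ k : ℕ, k < m →
        (g (k - 2)).hasU.toNat + (g k).hasU.toNat + (g k).hasS.toNat = 1 ∧
        (g (k - 1)).hasV.toNat + (g k).hasV.toNat + (g k).hasS.toNat = 1) ∧ cutAt g m = τ := by
  induction m generalizing τ with
  | zero => simp [run]
  | succ m ih =>
    simp only [List.range_succ, List.map_append, run_append, Option.bind_eq_some_iff, ih,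
      List.map_cons, List.map_nil, run, Nat.lt_succ_iff_lt_or_eq, or_imp, forall_and, forall_eq]
    simp only [Option.some.injEq, exists_eq_right, Nat.cast_add, Nat.cast_one]
    constructor
    · rintro ⟨_, ⟨h, rfl⟩, h'⟩
      rw [read_cutAt] at h'
      exact ⟨⟨⟨h.1, h'.1.1⟩, h.2, h'.1.2⟩, h'.2⟩
    · rintro ⟨⟨⟨h1, h2⟩, h3, h4⟩, h⟩
      exact ⟨_, ⟨⟨h1, h3⟩, rfl⟩, (read_cutAt _ _ _).2 ⟨⟨h2, h4⟩, h⟩⟩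

theorem eq_of_run_append_pair {l : List Cell} {a b : Cell} {σ τ : CutState}
    (h : run (l ++ [a, b]) σ = some τ) : τ = (a.hasU, b.hasU, b.hasV) := by
  rw [run_append, Option.bind_eq_some_iff] at h
  obtain ⟨ρ, -, h⟩ := h
  simp only [run, Option.bind_eq_some_iff, Option.some.injEq, exists_eq_right, read] at h
  obtain ⟨π, h1, h2⟩ := h
  split_ifs at h1 h2
  cases h1
  cases h2
  rfl

theorem closed_toList (hn : 2 ≤ n) {g : ZMod n → Cell} : Closed (toList g) ↔ Good g := by
  have hgood : run (toList g) (cutAt g 0) = some (cutAt g 0) ↔ Good g := by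
    have : NeZero n := ⟨by omega⟩
    rw [toList, run_cutAt, ZMod.natCast_self, and_iff_left rfl]
    constructor
    · intro h k
      simpa using h k.val k.val_lt
    · exact fun h k _ => h k
  rw [← hgood]
  refine ⟨fun ⟨σ, h⟩ => ?_, fun h => ⟨_, h⟩⟩
  obtain ⟨m, rfl⟩ := Nat.exists_eq_add_of_le' hn
  have hσ := h
  rw [toList, List.range_succ, List.range_succ, List.map_append, List.map_append,
    List.append_assoc] at hσ
  have hcast : (m : ZMod (m + 2)) = 0 - 2 := by
    linear_combination (by exact_mod_cast ZMod.natCast_self (m + 2) :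
      ((m : ZMod (m + 2)) + 2 = 0))
  have hσ' := eq_of_run_append_pair hσ
  simp only [Nat.cast_succ, hcast] at hσ'
  rw [show (0 - 2 + 1 : ZMod (m + 2)) = 0 - 1 by ring] at hσ'
  rwa [show σ = cutAt g 0 from hσ'] at h

theorem sum_toNat [NeZero n] (p : ZMod n → Bool) :
    ∑ k, (p k).toNat = {k | p k = true}.ncard := by
  rw [Set.ncard_eq_toFinset_card', Set.toFinset_ofPred, Finset.card_filter]
  exact Finset.sum_congr rfl fun k _ => by cases p k <;> rfl

theorem Cell.size_eq (c : Cell) : c.size = c.hasU.toNat + c.hasS.toNat + c.hasV.toNat := by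
  cases c <;> rfl

theorem edges_eq (g : ZMod n → Cell) : edges g = edgeU '' {k | (g k).hasU = true} ∪
    edgeS '' {k | (g k).hasS = true} ∪ edgeV '' {k | (g k).hasV = true} := by
  ext e
  simp only [edges, cellEdges, Set.mem_ofPred_eq, Set.mem_union, Set.mem_image, exists_or, or_assoc,
    eq_comm (a := e)]

theorem size_toList (hn : 5 ≤ n) (g : ZMod n → Cell) : size (toList g) = (edges g).ncard := by
  have : NeZero n := ⟨by omega⟩
  have hsum : size (toList g) = ∑ k, (g k).size := by
    rw [size, toList, List.map_map, ← List.sum_toFinset _ List.nodup_range, List.toFinset_range]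
    exact Finset.sum_nbij' (fun k => (k : ZMod n)) ZMod.val (fun _ _ => Finset.mem_univ _)
      (fun k _ => Finset.mem_range.2 k.val_lt)
      (fun k hk => ZMod.val_natCast_of_lt (Finset.mem_range.1 hk)) (fun k _ => by simp)
      fun _ _ => rfl
  simp only [hsum, Cell.size_eq, Finset.sum_add_distrib, sum_toNat]
  have h1 : Disjoint (edgeU '' {k | (g k).hasU = true}) (edgeS '' {k | (g k).hasS = true}) := by
    rw [Set.disjoint_left]
    rintro _ ⟨k, -, rfl⟩ ⟨l, -, h⟩
    exact edgeU_ne_edgeS h.symm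
  have h2 : Disjoint (edgeU '' {k | (g k).hasU = true} ∪ edgeS '' {k | (g k).hasS = true})
      (edgeV '' {k | (g k).hasV = true}) := by
    rw [Set.disjoint_left]
    rintro _ (⟨k, -, rfl⟩ | ⟨k, -, rfl⟩) ⟨l, -, h⟩
    · exact edgeU_ne_edgeV h.symm
    · exact edgeS_ne_edgeV h.symm
  rw [edges_eq, Set.ncard_union_eq h2, Set.ncard_union_eq h1,
    Set.ncard_image_of_injective _ fun _ _ => (edgeU_inj hn).1,
    Set.ncard_image_of_injective _ fun _ _ => edgeS_inj.1,
    Set.ncard_image_of_injective _ fun _ _ => (edgeV_inj hn).1]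

theorem forcingNumber_eq_force (hn : 5 ≤ n) {M : (petersen n).Subgraph} (hM : M.IsPerfectMatching)
    {g : ZMod n → Cell} (h : M.edgeSet = edges g) :
    forcingNumber (petersen n) M = force (toList g) := by
  have : NeZero n := ⟨by omega⟩
  unfold forcingNumber force
  congr 1
  ext k
  constructor
  · rintro ⟨S, ⟨hS, hforce⟩, rfl⟩
    obtain ⟨s, rfl⟩ := exists_edges_eq hn hM hS
    refine ⟨toList s, ⟨sub_toList.2 ((edges_subset hn).1 (h ▸ hS)), fun y hy hsub => ?_⟩,
      size_toList hn s⟩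
    obtain ⟨t, rfl⟩ := exists_toList_eq (n := n) (hsub.length_eq ▸ length_toList s)
    obtain ⟨M', hM', h'⟩ := Good.exists_subgraph hn ((closed_toList (by omega)).1 hy)
    have := hforce M' hM' (h' ▸ (edges_subset hn).2 (sub_toList.1 hsub))
    rw [edges_injective hn (h'.symm.trans (this ▸ h))]
  · rintro ⟨S, ⟨hS, hforce⟩, rfl⟩
    obtain ⟨s, rfl⟩ := exists_toList_eq (n := n) (hS.length_eq.trans (length_toList g))
    refine ⟨edges s, ⟨h ▸ (edges_subset hn).2 (sub_toList.1 hS), fun M' hM' hsub => ?_⟩,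
      (size_toList hn s).symm⟩
    obtain ⟨t, ht⟩ := exists_edges_eq hn hM' subset_rfl
    have hgood : Good t := by
      rw [good_iff hn, ht]
      exact Subgraph.isPerfectMatching_iff.1 hM'
    have := hforce (toList t) ((closed_toList (by omega)).2 hgood)
      (sub_toList.2 ((edges_subset hn).1 (ht ▸ hsub)))
    refine subgraph_ext_of_edgeSet hM' hM ?_
    rw [h, ← ht, toList_injective this]

/-! ### Block words -/

/-- The edges of a list of cells placed at the positions from `i` on. -/
def listEdges : ZMod n → List Cell → Set (Sym2 (PV n))
  | _, [] => ∅
  | i, c :: l => cellEdges i c ∪ listEdges (i + 1) l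

theorem listEdges_append (i : ZMod n) (a b : List Cell) :
    listEdges i (a ++ b) = listEdges i a ∪ listEdges (i + a.length) b := by
  induction a generalizing i with
  | nil => simp [listEdges]
  | cons c a ih =>
    simp only [List.cons_append, listEdges, ih, Set.union_assoc, List.length_cons, Nat.cast_add,
      Nat.cast_one, add_comm (a.length : ZMod n), add_assoc]

theorem listEdges_toList [NeZero n] (g : ZMod n → Cell) : listEdges 0 (toList g) = edges g := by
  have h (m : ℕ) : listEdges 0 ((List.range m).map fun k : ℕ => g (k : ZMod n)) =
      {e | ∃ k : ℕ, k < m ∧ e ∈ cellEdges (k : ZMod n) (g k)} := by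
    induction m with
    | zero => simp [listEdges]
    | succ m ih =>
      rw [List.range_succ, List.map_append, listEdges_append, ih]
      ext e
      simp only [listEdges, List.map_cons, List.map_nil, List.length_map, List.length_range,
        zero_add, Set.union_empty, Set.mem_union, Set.mem_ofPred_eq, Nat.lt_succ_iff_lt_or_eq,
        or_and_right, exists_or, exists_eq_left]
  rw [toList, h]
  ext e
  constructor
  · rintro ⟨k, -, hk⟩
    exact ⟨k, hk⟩
  · rintro ⟨k, hk⟩
    exact ⟨k.val, k.val_lt, by simpa using hk⟩

theorem listEdges_block_true (i : ZMod n) : listEdges i (block true) = blockC n i := by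
  have h : i + 1 + 1 = i + 2 := by ring
  have h' : i + 2 + 1 = i + 3 := by ring
  ext e
  simp [block, listEdges, cellEdges, blockC, Cell.hasU, Cell.hasS, Cell.hasV, edgeU, edgeS, edgeV,
    h, h']
  tauto

theorem listEdges_block_false (i : ZMod n) : listEdges i (block false) = blockD n i := by
  have h : i + 1 + 1 = i + 2 := by ring
  have h' : i + 2 + 1 = i + 3 := by ring
  have h1 : i + 1 + 2 = i + 3 := by ring
  have h2 : i + 3 + 1 = i + 4 := by ring
  ext e
  simp [block, listEdges, cellEdges, blockD, Cell.hasU, Cell.hasS, Cell.hasV, edgeU, edgeV,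
    h, h', h1, h2]
  tauto

theorem cdEdges_eq (i : ZMod n) (L : List Bool) : cdEdges n i L = listEdges i (word L) := by
  induction L generalizing i with
  | nil => rfl
  | cons b L ih =>
    rw [word_cons, listEdges_append]
    cases b
    · rw [cdEdges, ih, listEdges_block_false]
      rfl
    · rw [cdEdges, ih, listEdges_block_true]
      rfl

theorem length_word (L : List Bool) : (word L).length = (L.map cdLen).sum := by
  induction L with
  | nil => rfl
  | cons b L ih =>
    rw [word_cons, List.length_append, List.map_cons, List.sum_cons, ih]
    cases b <;> rfl

/-- Every block word of length `n` is realised by a perfect matching. -/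
theorem exists_type2 (hn : 5 ≤ n) {L : List Bool} (hL : (L.map cdLen).sum = n) :
    ∃ M : (petersen n).Subgraph, M.IsPerfectMatching ∧ M.edgeSet = cdEdges n 0 L ∧
      forcingNumber (petersen n) M = wordForce L := by
  have : NeZero n := ⟨by omega⟩
  obtain ⟨g, hg⟩ := exists_toList_eq (n := n) ((length_word L).trans hL)
  obtain ⟨M, hM, h⟩ := Good.exists_subgraph hn
    ((closed_toList (by omega)).1 (hg.symm ▸ closed_word L))
  refine ⟨M, hM, ?_, ?_⟩
  · rw [h, cdEdges_eq, ← hg, listEdges_toList]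
  · rw [forcingNumber_eq_force hn hM h, hg, wordForce]

theorem exists_word (hn : 5 ≤ n) {M : (petersen n).Subgraph} (hM : M.IsPerfectMatching)
    (h : IsType2 M) :
    ∃ L : List Bool, (L.map cdLen).sum = n ∧ forcingNumber (petersen n) M = wordForce L := by
  obtain ⟨i, L, hL, h⟩ := h
  obtain ⟨M', hM', h', hf⟩ := exists_type2 hn hL
  exact ⟨L, hL, (forcingNumber_eq_of_cdEdges hM hM' h h').trans hf⟩

theorem eq_of_sum_cdLen_eq_of_lt {L L' : List Bool} (h : (L.map cdLen).sum = n)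
    (h' : (L'.map cdLen).sum = n) (hn : n < 5) : L = L' := by
  match L, L' with
  | [], [] => rfl
  | [a], [b] => subst h; revert a b; decide
  | [], b :: l => cases b <;> simp [cdLen] at h h' <;> omega
  | a :: l, [] => cases a <;> simp [cdLen] at h h' <;> omega
  | a :: b :: l, _ => cases a <;> cases b <;> simp [cdLen] at h <;> omega
  | [a], b :: c :: l => cases b <;> cases c <;> simp [cdLen] at h' <;> omega

end CDWord

/-- for `n ≥ 3` the set of forcing numbers of type-2 perfect matchings
of `P(n,2)` is a set of consecutive integers. -/
theorem type2_spectrum_interval (n : ℕ) (hn : 3 ≤ n) :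
    Set.OrdConnected {k | ∃ M : (petersen n).Subgraph,
      M.IsPerfectMatching ∧ IsType2 M ∧ forcingNumber (petersen n) M = k} := by
  refine ⟨?_⟩
  rintro _ ⟨M₁, hM₁, h₁, rfl⟩ _ ⟨M₂, hM₂, h₂, rfl⟩ k hk
  rcases lt_or_ge n 5 with hn' | hn'
  · obtain ⟨i, L, hL, hi⟩ := id h₁
    obtain ⟨j, L', hL', hj⟩ := h₂
    rw [← CDWord.eq_of_sum_cdLen_eq_of_lt hL hL' hn'] at hj
    rw [← CDWord.forcingNumber_eq_of_cdEdges hM₁ hM₂ hi hj] at hk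
    exact ⟨M₁, hM₁, h₁, le_antisymm hk.1 hk.2⟩
  · obtain ⟨L₁, hL₁, hf₁⟩ := CDWord.exists_word hn' hM₁ h₁
    obtain ⟨L₂, hL₂, hf₂⟩ := CDWord.exists_word hn' hM₂ h₂
    rw [hf₁, hf₂] at hk
    obtain ⟨L, hL, rfl⟩ := CDWord.connected_of_sum_eq (hL₁.trans hL₂.symm) k
      (Set.Icc_subset_uIcc hk)
    obtain ⟨M, hM, h, hf⟩ := CDWord.exists_type2 hn' (hL.trans hL₁)
    exact ⟨M, hM, ⟨0, L, hL.trans hL₁, h⟩, hf⟩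
end

section
/- Let n ≥ 37 and let M1 be a type-2 perfect matching of P(n,2) whose block decomposition contains at least one C and at least one D, with a block C at positions i, i+1, i+2 immediately followed by a block D at positions i+3, i+4, i+5, i+6. Let M2 be the perfect matching obtained from M1 by replacing this chain CD by DC (a block D at positions i, i+1, i+2, i+3 followed by a block C at positions i+4, i+5, i+6), keeping all other parts of M1; equivalently, M2 is the symmetric difference of M1 with the M1-alternating 8-cycle u_{i+1} u_{i+3} u_{i+5} v_{i+5} v_{i+4} v_{i+3} v_{i+2} v_{i+1} u_{i+1}. Then |f(P(n,2),M1) − f(P(n,2),M2)| ≤ 1. -/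
open SimpleGraph

/-- The `M1`-alternating 8-cycle
`u_{i+1} u_{i+3} u_{i+5} v_{i+5} v_{i+4} v_{i+3} v_{i+2} v_{i+1} u_{i+1}`. -/
def cycCD (n : ℕ) (i : ZMod n) : Set (Sym2 (PV n)) :=
  {s(pu (i + 1), pu (i + 3)), s(pu (i + 3), pu (i + 5)), s(pu (i + 5), pv (i + 5)),
   s(pv (i + 5), pv (i + 4)), s(pv (i + 4), pv (i + 3)), s(pv (i + 3), pv (i + 2)),
   s(pv (i + 2), pv (i + 1)), s(pv (i + 1), pu (i + 1))}

namespace SimpleGraph.Subgraph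

variable {α : Type*} {G : SimpleGraph α}

lemma IsPerfectMatching.eq_of_mem_edgeSet {M : G.Subgraph} (hM : M.IsPerfectMatching) {a b c : α}
    (hb : s(a, b) ∈ M.edgeSet) (hc : s(a, c) ∈ M.edgeSet) : b = c :=
  hM.1.eq_of_adj_left hb hc

lemma IsPerfectMatching.eq_of_edgeSet_subset {M N : G.Subgraph} (hM : M.IsPerfectMatching)
    (hN : N.IsPerfectMatching) (h : M.edgeSet ⊆ N.edgeSet) : M = N := by
  refine Subgraph.ext ?_ ?_
  · rw [Set.eq_univ_of_forall hM.2, Set.eq_univ_of_forall hN.2]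
  · ext a b
    refine ⟨fun hab => h (show s(a, b) ∈ M.edgeSet from hab), fun hab => ?_⟩
    obtain ⟨c, hc, -⟩ := hM.1 (hM.2 a)
    rwa [hN.eq_of_mem_edgeSet hab (h (show s(a, c) ∈ M.edgeSet from hc))]

/-- Replacing a set `A` of edges of a perfect matching by a matching `B` covering the same
vertices gives a perfect matching. -/
lemma IsPerfectMatching.exists_edgeSet_eq_diff_union {N : G.Subgraph} (hN : N.IsPerfectMatching)
    {A B : Set (Sym2 α)} (hA : A ⊆ N.edgeSet) (hB : B ⊆ G.edgeSet)
    (hcov : ∀ v, (∃ a ∈ A, v ∈ a) ↔ ∃ b ∈ B, v ∈ b)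
    (hdisj : ∀ v, ∀ b ∈ B, ∀ b' ∈ B, v ∈ b → v ∈ b' → b = b') :
    ∃ N' : G.Subgraph, N'.IsPerfectMatching ∧ N'.edgeSet = N.edgeSet \ A ∪ B := by
  refine ⟨⟨Set.univ, fun a b => s(a, b) ∈ N.edgeSet \ A ∪ B, ?_, fun _ => Set.mem_univ _, ?_⟩,
    ⟨?_, fun _ => Set.mem_univ _⟩, ?_⟩
  · rintro a b (h | h)
    · exact N.adj_sub h.1
    · exact hB h
  · refine ⟨fun a b h => ?_⟩
    rwa [Sym2.eq_swap]
  · intro v _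
    by_cases hv : ∃ b ∈ B, v ∈ b
    · obtain ⟨b, hb, hvb⟩ := hv
      obtain ⟨w, rfl⟩ := hvb
      refine ⟨w, Or.inr hb, ?_⟩
      rintro y (hy | hy)
      · obtain ⟨a, ha, hva⟩ := (hcov v).2 ⟨_, hb, Sym2.mem_mk_left v w⟩
        obtain ⟨z, rfl⟩ := hva
        have := hN.eq_of_mem_edgeSet hy.1 (hA ha)
        exact absurd ha (this ▸ hy.2)
      · exact Sym2.congr_right.1
          (hdisj v _ hy _ hb (Sym2.mem_mk_left v y) (Sym2.mem_mk_left v w))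
    · obtain ⟨w, hw, huniq⟩ := hN.1 (hN.2 v)
      refine ⟨w, Or.inl ⟨hw, fun h => hv ((hcov v).1 ⟨_, h, Sym2.mem_mk_left v w⟩)⟩, ?_⟩
      rintro y (hy | hy)
      · exact huniq y hy.1
      · exact absurd ⟨_, hy, Sym2.mem_mk_left v y⟩ hv
  · ext e
    induction e with
    | _ a b => rfl

/-- Switching a perfect matching along an alternating 8-cycle. -/
lemma IsPerfectMatching.exists_switch {N : G.Subgraph} (hN : N.IsPerfectMatching)
    {a b c d e f g h : α} (hnd : [a, b, c, d, e, f, g, h].Nodup)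
    (hA : {s(a, b), s(c, d), s(e, f), s(g, h)} ⊆ N.edgeSet)
    (hB : {s(b, c), s(d, e), s(f, g), s(h, a)} ⊆ G.edgeSet) :
    ∃ N' : G.Subgraph, N'.IsPerfectMatching ∧ N'.edgeSet =
      N.edgeSet \ {s(a, b), s(c, d), s(e, f), s(g, h)} ∪ {s(b, c), s(d, e), s(f, g), s(h, a)} := by
  refine hN.exists_edgeSet_eq_diff_union hA hB (fun v => ?_) (fun v => ?_)
  · simp only [Set.mem_insert_iff, Set.mem_singleton_iff, exists_eq_or_imp,
      exists_eq_left, Sym2.mem_iff]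
    tauto
  · simp only [List.nodup_cons, List.mem_cons, List.not_mem_nil, or_false, not_or] at hnd
    rintro x (rfl | rfl | rfl | rfl) y (rfl | rfl | rfl | rfl) <;> simp only [Sym2.mem_iff] <;>
      rintro (rfl | rfl) (h' | h') <;> first | trivial | (subst h'; exact absurd hnd (by simp))

lemma IsPerfectMatching.exists_isForcingSet {M : G.Subgraph} (hM : M.IsPerfectMatching) :
    ∃ S, IsForcingSet G M S ∧ S.ncard = forcingNumber G M :=
  Nat.sInf_mem (s := {k | ∃ S, IsForcingSet G M S ∧ S.ncard = k})
    ⟨_, M.edgeSet, ⟨subset_rfl, fun _ hM' h => (hM.eq_of_edgeSet_subset hM' h).symm⟩, rfl⟩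

end SimpleGraph.Subgraph

lemma IsForcingSet.forcingNumber_le {α : Type*} {G : SimpleGraph α} {M : G.Subgraph}
    {S : Set (Sym2 α)} (h : IsForcingSet G M S) : forcingNumber G M ≤ S.ncard :=
  Nat.sInf_le ⟨S, h, rfl⟩

/-- `U` and `V` cover a graph that looks locally like `P(n,2)`: `U k` has neighbours `U (k ± 2)`
and `V k`, `V k` has neighbours `V (k ± 1)` and `U k`, and nearby indices give distinct vertices. -/
structure IsPetersenChart {α : Type*} (G : SimpleGraph α) (U V : ℤ → α) : Prop where
  adj_U : ∀ k w, G.Adj (U k) w ↔ w = U (k - 2) ∨ w = U (k + 2) ∨ w = V k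
  adj_V : ∀ k w, G.Adj (V k) w ↔ w = V (k - 1) ∨ w = V (k + 1) ∨ w = U k
  U_inj : ∀ a b, (a - b).natAbs < 37 → (U a = U b ↔ a = b)
  V_inj : ∀ a b, (a - b).natAbs < 37 → (V a = V b ↔ a = b)
  U_ne_V : ∀ a b, U a ≠ V b

namespace IsPetersenChart

variable {α : Type*} {G : SimpleGraph α} {U V : ℤ → α}

lemma reflect (h : IsPetersenChart G U V) (c : ℤ) :
    IsPetersenChart G (fun k => U (c - k)) (fun k => V (c - k)) where
  adj_U k w := by
    rw [h.adj_U, show c - k - 2 = c - (k + 2) by ring, show c - k + 2 = c - (k - 2) by ring]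
    tauto
  adj_V k w := by
    rw [h.adj_V, show c - k - 1 = c - (k + 1) by ring, show c - k + 1 = c - (k - 1) by ring]
    tauto
  U_inj a b hab := by rw [h.U_inj _ _ (by omega)]; omega
  V_inj a b hab := by rw [h.V_inj _ _ (by omega)]; omega
  U_ne_V a b := h.U_ne_V _ _

/-- The edges of the `CD` matching on the alternating 8-cycle. -/
def cdPart (U V : ℤ → α) : Set (Sym2 α) := {s(U 1, V 1), s(U 3, U 5), s(V 2, V 3), s(V 4, V 5)}

/-- The edges of the `DC` matching on the alternating 8-cycle. -/
def dcPart (U V : ℤ → α) : Set (Sym2 α) := {s(U 1, U 3), s(U 5, V 5), s(V 1, V 2), s(V 3, V 4)}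

lemma cdPart_reflect : cdPart (fun k => U (6 - k)) (fun k => V (6 - k)) = dcPart U V := by
  ext
  simp only [cdPart, dcPart, Set.mem_insert_iff, Set.mem_singleton_iff]
  norm_num only
  rw [Sym2.eq_swap (a := U 3), Sym2.eq_swap (a := V 4), Sym2.eq_swap (a := V 2)]
  tauto

lemma dcPart_reflect : dcPart (fun k => U (6 - k)) (fun k => V (6 - k)) = cdPart U V := by
  ext
  simp only [cdPart, dcPart, Set.mem_insert_iff, Set.mem_singleton_iff]
  norm_num only
  rw [Sym2.eq_swap (a := U 5), Sym2.eq_swap (a := V 5), Sym2.eq_swap (a := V 3)]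
  tauto

lemma exists_U (h : IsPetersenChart G U V) {N : G.Subgraph} (hN : N.IsPerfectMatching) (k : ℤ) :
    s(U (k - 2), U k) ∈ N.edgeSet ∨ s(U k, U (k + 2)) ∈ N.edgeSet ∨ s(U k, V k) ∈ N.edgeSet := by
  obtain ⟨w, hw, -⟩ := hN.1 (hN.2 (U k))
  rcases (h.adj_U k w).1 (N.adj_sub hw) with rfl | rfl | rfl
  · exact Or.inl hw.symm
  · exact Or.inr (Or.inl hw)
  · exact Or.inr (Or.inr hw)

lemma exists_V (h : IsPetersenChart G U V) {N : G.Subgraph} (hN : N.IsPerfectMatching) (k : ℤ) :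
    s(V (k - 1), V k) ∈ N.edgeSet ∨ s(V k, V (k + 1)) ∈ N.edgeSet ∨ s(U k, V k) ∈ N.edgeSet := by
  obtain ⟨w, hw, -⟩ := hN.1 (hN.2 (V k))
  rcases (h.adj_V k w).1 (N.adj_sub hw) with rfl | rfl | rfl
  · exact Or.inl hw.symm
  · exact Or.inr (Or.inl hw)
  · exact Or.inr (Or.inr hw.symm)

/-- At most one of the three edges at `U k` lies in a perfect matching. -/
lemma not_mem_U (h : IsPetersenChart G U V) {N : G.Subgraph} (hN : N.IsPerfectMatching) (k : ℤ) :
    ¬ (s(U (k - 2), U k) ∈ N.edgeSet ∧ s(U k, U (k + 2)) ∈ N.edgeSet) ∧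
    ¬ (s(U (k - 2), U k) ∈ N.edgeSet ∧ s(U k, V k) ∈ N.edgeSet) ∧
    ¬ (s(U k, U (k + 2)) ∈ N.edgeSet ∧ s(U k, V k) ∈ N.edgeSet) := by
  rw [Sym2.eq_swap (a := U (k - 2))]
  refine ⟨fun ⟨h1, h2⟩ => ?_, fun ⟨h1, h2⟩ => ?_, fun ⟨h1, h2⟩ => ?_⟩ <;>
    have := hN.eq_of_mem_edgeSet h1 h2
  · rw [h.U_inj _ _ (by omega)] at this; omega
  · exact h.U_ne_V _ _ this
  · exact h.U_ne_V _ _ this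

/-- At most one of the three edges at `V k` lies in a perfect matching. -/
lemma not_mem_V (h : IsPetersenChart G U V) {N : G.Subgraph} (hN : N.IsPerfectMatching) (k : ℤ) :
    ¬ (s(V (k - 1), V k) ∈ N.edgeSet ∧ s(V k, V (k + 1)) ∈ N.edgeSet) ∧
    ¬ (s(V (k - 1), V k) ∈ N.edgeSet ∧ s(U k, V k) ∈ N.edgeSet) ∧
    ¬ (s(V k, V (k + 1)) ∈ N.edgeSet ∧ s(U k, V k) ∈ N.edgeSet) := by
  rw [Sym2.eq_swap (a := V (k - 1)), Sym2.eq_swap (a := U k)]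
  refine ⟨fun ⟨h1, h2⟩ => ?_, fun ⟨h1, h2⟩ => ?_, fun ⟨h1, h2⟩ => ?_⟩ <;>
    have := hN.eq_of_mem_edgeSet h1 h2
  · rw [h.V_inj _ _ (by omega)] at this; omega
  · exact h.U_ne_V _ _ this.symm
  · exact h.U_ne_V _ _ this.symm

lemma adj_UU (h : IsPetersenChart G U V) (k : ℤ) : s(U k, U (k + 2)) ∈ G.edgeSet :=
  (h.adj_U _ _).2 (by simp)

lemma adj_UV (h : IsPetersenChart G U V) (k : ℤ) : s(U k, V k) ∈ G.edgeSet :=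
  (h.adj_U _ _).2 (by simp)

lemma adj_VV (h : IsPetersenChart G U V) (k : ℤ) : s(V k, V (k + 1)) ∈ G.edgeSet :=
  (h.adj_V _ _).2 (by simp)

lemma disjoint_dcPart (h : IsPetersenChart G U V) {M : G.Subgraph} (hM : M.IsPerfectMatching)
    (hcd : cdPart U V ⊆ M.edgeSet) : Disjoint (dcPart U V) M.edgeSet := by
  simp only [cdPart, Set.insert_subset_iff, Set.singleton_subset_iff] at hcd
  obtain ⟨c1, c2, c3, c4⟩ := hcd
  have u1 := h.not_mem_U hM 1
  have u5 := h.not_mem_U hM 5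
  have v1 := h.not_mem_V hM 1
  have v3 := h.not_mem_V hM 3
  norm_num only at u1 u5 v1 v3
  rw [Set.disjoint_left]
  rintro x (rfl | rfl | rfl | rfl) hx
  · exact u1.2.2 ⟨hx, c1⟩
  · exact u5.2.1 ⟨c2, hx⟩
  · exact v1.2.2 ⟨hx, c1⟩
  · exact v3.1 ⟨c3, hx⟩

lemma exists_dc_to_cd (h : IsPetersenChart G U V) {N : G.Subgraph} (hN : N.IsPerfectMatching)
    (hB : dcPart U V ⊆ N.edgeSet) : ∃ N' : G.Subgraph, N'.IsPerfectMatching ∧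
      N'.edgeSet = N.edgeSet \ dcPart U V ∪ cdPart U V := by
  have hdc : dcPart U V = {s(U 1, U 3), s(U 5, V 5), s(V 4, V 3), s(V 2, V 1)} := by
    ext; simp only [dcPart, Sym2.eq_swap (a := V 4), Sym2.eq_swap (a := V 2),
      Set.mem_insert_iff, Set.mem_singleton_iff]; tauto
  have hcd : cdPart U V = {s(U 3, U 5), s(V 5, V 4), s(V 3, V 2), s(V 1, U 1)} := by
    ext; simp only [cdPart, Sym2.eq_swap (a := V 5), Sym2.eq_swap (a := V 3),
      Sym2.eq_swap (a := V 1), Set.mem_insert_iff, Set.mem_singleton_iff]; tauto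
  have hG : cdPart U V ⊆ G.edgeSet := by
    simp only [cdPart, Set.insert_subset_iff, Set.singleton_subset_iff]
    exact ⟨h.adj_UV 1, h.adj_UU 3, h.adj_VV 2, h.adj_VV 4⟩
  rw [hcd] at hG ⊢
  rw [hdc] at hB ⊢
  exact hN.exists_switch (by simp [h.U_inj, h.V_inj, h.U_ne_V]) hB hG

/-- If `S` forces the `CD` matching, no perfect matching contains the five spokes at `1, …, 5`
together with all edges of `S` but one edge `e` of the 8-cycle. -/
lemma false_of_spokes (h : IsPetersenChart G U V) {M N : G.Subgraph} {S : Set (Sym2 α)}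
    (hM : M.IsPerfectMatching) (hS : IsForcingSet G M S) (hcd : cdPart U V ⊆ M.edgeSet)
    (h02 : s(U 0, U 2) ∈ M.edgeSet) {e : Sym2 α} (he : e ∈ cdPart U V)
    (hN : N.IsPerfectMatching) (hSN : S ⊆ insert e N.edgeSet)
    (h1 : s(U 1, V 1) ∈ N.edgeSet) (h2 : s(U 2, V 2) ∈ N.edgeSet)
    (h3 : s(U 3, V 3) ∈ N.edgeSet) (h4 : s(U 4, V 4) ∈ N.edgeSet)
    (h5 : s(U 5, V 5) ∈ N.edgeSet) : False := by
  simp only [cdPart, Set.insert_subset_iff, Set.singleton_subset_iff] at hcd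
  obtain ⟨c1, c2, c3, c4⟩ := hcd
  have m2 := h.not_mem_U hM 2
  have m2' := h.not_mem_V hM 2
  have m3' := h.not_mem_V hM 3
  have m4' := h.not_mem_V hM 4
  have m5' := h.not_mem_V hM 5
  norm_num only at m2 m2' m3' m4' m5'
  by_cases he1 : e = s(U 1, V 1)
  · have := hS.2 N hN (hSN.trans (by simp [he1, h1]))
    subst this
    exact m5'.2.1 ⟨c4, h5⟩
  have hA : {s(V 2, U 2), s(U 4, V 4), s(V 5, U 5), s(U 3, V 3)} ⊆ N.edgeSet := by
    simp only [Set.insert_subset_iff, Set.singleton_subset_iff, Sym2.eq_swap (a := V _)]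
    exact ⟨h2, h4, h5, h3⟩
  obtain ⟨N', hN', hE⟩ := hN.exists_switch
    (by simp [h.U_inj, h.V_inj, h.U_ne_V, (h.U_ne_V _ _).symm]) hA (by
    simp only [Set.insert_subset_iff, Set.singleton_subset_iff]
    rw [Sym2.eq_swap (a := U 5), Sym2.eq_swap (a := V 3)]
    exact ⟨h.adj_UU 2, h.adj_VV 4, h.adj_UU 3, h.adj_VV 2⟩)
  have hmem : s(U 2, U 4) ∈ N'.edgeSet := by rw [hE]; simp
  rw [hS.2 N' hN' ?_] at hmem
  · exact m2.1 ⟨h02, hmem⟩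
  intro x hx
  rw [hE]
  by_cases hxe : x = e
  · right
    subst hxe
    rw [Sym2.eq_swap (a := U 5), Sym2.eq_swap (a := V 3)]
    rcases he with he | rfl | rfl | rfl
    · exact absurd he he1
    all_goals simp
  · left
    refine ⟨(hSN hx).resolve_left hxe, fun hx' => ?_⟩
    have hxM := hS.1 hx
    simp only [Set.mem_insert_iff, Set.mem_singleton_iff, Sym2.eq_swap (a := V _)] at hx'
    rcases hx' with rfl | rfl | rfl | rfl
    · exact m2'.2.2 ⟨c3, hxM⟩
    · exact m4'.2.2 ⟨c4, hxM⟩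
    · exact m5'.2.1 ⟨c4, hxM⟩
    · exact m3'.2.1 ⟨c3, hxM⟩

/-- A perfect matching containing the `DC` edges on the 8-cycle and the edges of `S` off
the 8-cycle is the `DC` matching. -/
lemma eq_of_dcPart_subset (h : IsPetersenChart G U V) {M M' N : G.Subgraph} {S : Set (Sym2 α)}
    (hS : IsForcingSet G M S) (hdc : Disjoint (dcPart U V) M.edgeSet)
    (hM' : M'.IsPerfectMatching) (hE : M'.edgeSet = M.edgeSet \ cdPart U V ∪ dcPart U V)
    (hN : N.IsPerfectMatching) (hSN : S ⊆ cdPart U V ∪ N.edgeSet)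
    (hdcN : dcPart U V ⊆ N.edgeSet) : N = M' := by
  obtain ⟨N', hN', hE'⟩ := h.exists_dc_to_cd hN hdcN
  obtain rfl := hS.2 N' hN' fun x hx => by
    rw [hE']
    rcases hSN hx with hx' | hx'
    · exact Or.inr hx'
    · exact Or.inl ⟨hx', fun hxd => hdc.le_bot ⟨hxd, hS.1 hx⟩⟩
  refine (hM'.eq_of_edgeSet_subset hN ?_).symm
  rw [hE, hE']
  rintro x (⟨hx | hx, hx'⟩ | hx)
  · exact hx.1
  · exact absurd hx hx'
  · exact hdcN hx

/-- A `CD`-to-`DC` transformation raises the forcing number by at most one. -/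
lemma forcingNumber_le_add_one [Finite α] (h : IsPetersenChart G U V) {M M' : G.Subgraph}
    (hM : M.IsPerfectMatching) (hM' : M'.IsPerfectMatching) (hcd : cdPart U V ⊆ M.edgeSet)
    (h02 : s(U 0, U 2) ∈ M.edgeSet) (h10 : s(V (-1), V 0) ∈ M.edgeSet)
    (hE : M'.edgeSet = M.edgeSet \ cdPart U V ∪ dcPart U V) :
    forcingNumber G M' ≤ forcingNumber G M + 1 := by
  obtain ⟨S, hS, hSc⟩ := hM.exists_isForcingSet
  have hdc := h.disjoint_dcPart hM hcd
  have hdc' : dcPart U V ⊆ M'.edgeSet := hE ▸ Set.subset_union_right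
  have hdc'' := hdc'
  simp only [dcPart, Set.insert_subset_iff, Set.singleton_subset_iff] at hdc''
  obtain ⟨d1, d2, d3, d4⟩ := hdc''
  have hcd02 : s(U 0, U 2) ∉ cdPart U V := by
    simp [cdPart, h.U_inj, h.U_ne_V]
  have hcd10 : s(V (-1), V 0) ∉ cdPart U V := by
    simp [cdPart, h.V_inj, (h.U_ne_V _ _).symm]
  have h02' : s(U 0, U 2) ∈ M'.edgeSet := hE ▸ Or.inl ⟨h02, hcd02⟩
  have h10' : s(V (-1), V 0) ∈ M'.edgeSet := hE ▸ Or.inl ⟨h10, hcd10⟩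
  set W : Set (Sym2 α) := {s(U 0, U 2), s(V (-1), V 0)} ∪ cdPart U V
  have hSW : S \ W ⊆ M'.edgeSet := fun x hx =>
    hE ▸ Or.inl ⟨hS.1 hx.1, fun hx' => hx.2 (Or.inr hx')⟩
  have hcard : (S ∩ W).ncard + (S \ W).ncard = S.ncard :=
    Set.ncard_inter_add_ncard_sdiff_eq_ncard S W
  obtain ⟨e, heS, he⟩ : ∃ e ∈ S, e ∈ cdPart U V := by
    by_contra! hcon
    have : M' = M := hS.2 M' hM' fun x hx => hE ▸ Or.inl ⟨hS.1 hx, hcon x hx⟩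
    exact hdc.le_bot ⟨Or.inl rfl, this ▸ d1⟩
  have heW : e ∈ S ∩ W := ⟨heS, Or.inr he⟩
  by_cases hone : S ∩ W = {e}
  · have hsub : S ⊆ insert e (S \ W) := fun x hx => by
      by_cases hxW : x ∈ W
      · exact Or.inl (hone.subset ⟨hx, hxW⟩)
      · exact Or.inr ⟨hx, hxW⟩
    have hF : IsForcingSet G M' (S \ W ∪ {s(U 5, V 5), s(V (-1), V 0)}) := by
      refine ⟨Set.union_subset hSW (Set.insert_subset d2 (Set.singleton_subset_iff.2 h10')), ?_⟩
      intro N hN hSN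
      obtain ⟨hSN, hT⟩ := Set.union_subset_iff.1 hSN
      simp only [Set.insert_subset_iff, Set.singleton_subset_iff] at hT
      obtain ⟨t1, t2⟩ := hT
      have hSN' : S ⊆ insert e N.edgeSet := hsub.trans (Set.insert_subset_insert hSN)
      have U1 := h.exists_U hN 1
      have U2 := h.exists_U hN 2
      have U3 := h.exists_U hN 3
      have U1' := h.not_mem_U hN 1
      have U2' := h.not_mem_U hN 2
      have U3' := h.not_mem_U hN 3
      have U4' := h.not_mem_U hN 4
      have U5' := h.not_mem_U hN 5
      have V1 := h.exists_V hN 1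
      have V2 := h.exists_V hN 2
      have V3 := h.exists_V hN 3
      have V4 := h.exists_V hN 4
      have V0' := h.not_mem_V hN 0
      have V1' := h.not_mem_V hN 1
      have V2' := h.not_mem_V hN 2
      have V3' := h.not_mem_V hN 3
      have V4' := h.not_mem_V hN 4
      have V5' := h.not_mem_V hN 5
      norm_num only at U1 U2 U3 U1' U2' U3' U4' U5' V1 V2 V3 V4 V0' V1' V2' V3' V4' V5'
      by_cases s1 : s(U 1, V 1) ∈ N.edgeSet
      · have s3 : s(U 3, V 3) ∈ N.edgeSet :=
          (U3.resolve_left fun hx => U1'.2.2 ⟨hx, s1⟩).resolve_left fun hx => U5'.2.1 ⟨hx, t1⟩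
        have s2 : s(U 2, V 2) ∈ N.edgeSet :=
          (V2.resolve_left fun hx => V1'.2.2 ⟨hx, s1⟩).resolve_left fun hx => V3'.2.1 ⟨hx, s3⟩
        have s4 : s(U 4, V 4) ∈ N.edgeSet :=
          (V4.resolve_left fun hx => V3'.2.2 ⟨hx, s3⟩).resolve_left fun hx => V5'.2.1 ⟨hx, t1⟩
        exact (h.false_of_spokes hM hS hcd h02 he hN hSN' s1 s2 s3 s4 t1).elim
      have y1 : s(V 1, V 2) ∈ N.edgeSet :=
        (V1.resolve_left fun hx => V0'.1 ⟨t2, hx⟩).resolve_right s1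
      by_cases x1 : s(U 1, U 3) ∈ N.edgeSet
      · have y3 : s(V 3, V 4) ∈ N.edgeSet :=
          (V3.resolve_left fun hx => V2'.1 ⟨y1, hx⟩).resolve_right fun hx => U3'.2.1 ⟨x1, hx⟩
        refine h.eq_of_dcPart_subset hS hdc hM' hE hN
          (hSN'.trans (Set.insert_subset (Or.inl he) Set.subset_union_right)) ?_
        simp [dcPart, Set.insert_subset_iff, -Subgraph.mem_edgeSet, x1, t1, y1, y3]
      have xm : s(U (-1), U 1) ∈ N.edgeSet :=
        U1.resolve_right fun hx => hx.elim x1 s1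
      have s3 : s(U 3, V 3) ∈ N.edgeSet :=
        (U3.resolve_left x1).resolve_left fun hx => U5'.2.1 ⟨hx, t1⟩
      have s4 : s(U 4, V 4) ∈ N.edgeSet :=
        (V4.resolve_left fun hx => V3'.2.2 ⟨hx, s3⟩).resolve_left fun hx => V5'.2.1 ⟨hx, t1⟩
      have x0 : s(U 0, U 2) ∈ N.edgeSet :=
        U2.resolve_right fun hx => hx.elim (fun hx => U4'.2.1 ⟨hx, s4⟩) fun hx => V2'.2.1 ⟨y1, hx⟩
      have hA : {s(U (-1), U 1), s(V 1, V 2), s(U 2, U 0), s(V 0, V (-1))} ⊆ N.edgeSet := by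
        simp only [Set.insert_subset_iff, Set.singleton_subset_iff, Sym2.eq_swap (a := U 2),
          Sym2.eq_swap (a := V 0)]
        exact ⟨xm, y1, x0, t2⟩
      obtain ⟨N', hN', hE'⟩ := hN.exists_switch
        (by simp [h.U_inj, h.V_inj, h.U_ne_V, (h.U_ne_V _ _).symm]) hA (by
        simp only [Set.insert_subset_iff, Set.singleton_subset_iff, Sym2.eq_swap (a := V _)]
        exact ⟨h.adj_UV 1, h.adj_UV 2, h.adj_UV 0, h.adj_UV (-1)⟩)
      rw [Sym2.eq_swap (a := V 2), Sym2.eq_swap (a := U 2), Sym2.eq_swap (a := V 0)] at hE'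
      have hkeep : ∀ x ∈ N.edgeSet, x ∉ ({s(U (-1), U 1), s(V 1, V 2), s(U 0, U 2),
          s(V (-1), V 0)} : Set (Sym2 α)) → x ∈ N'.edgeSet :=
        fun x hx hx' => hE' ▸ Or.inl ⟨hx, hx'⟩
      have spoke : ∀ k : ℤ, s(U k, V k) ∉ ({s(U (-1), U 1), s(V 1, V 2), s(U 0, U 2),
          s(V (-1), V 0)} : Set (Sym2 α)) := fun k => by
        simp [h.U_ne_V, (h.U_ne_V _ _).symm]
      refine (h.false_of_spokes hM hS hcd h02 he hN' (fun x hx => ?_) (hE' ▸ Or.inr (by simp))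
        (hE' ▸ Or.inr (by simp)) (hkeep _ s3 (spoke 3)) (hkeep _ s4 (spoke 4))
        (hkeep _ t1 (spoke 5))).elim
      refine (hsub hx).imp id fun hx' => hkeep x (hSN hx') ?_
      have hxM := hS.1 hx
      have hxW := hx'.2
      rintro (rfl | rfl | rfl | rfl)
      · have := (h.not_mem_U hM 1).2.1
        norm_num only at this
        exact this ⟨hxM, hcd (Or.inl rfl)⟩
      · exact hdc.le_bot ⟨Or.inr (Or.inr (Or.inl rfl)), hxM⟩
      · exact hxW (Or.inl (Or.inl rfl))
      · exact hxW (Or.inl (Or.inr rfl))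
    have h1 := hF.forcingNumber_le
    have h2 := Set.ncard_union_le (S \ W) {s(U 5, V 5), s(V (-1), V 0)}
    have h3 := Set.ncard_insert_le s(U 5, V 5) {s(V (-1), V 0)}
    rw [Set.ncard_singleton] at h3
    rw [hone, Set.ncard_singleton] at hcard
    omega
  · have htwo : 2 ≤ (S ∩ W).ncard := by
      by_contra! hlt
      refine hone (Set.eq_singleton_iff_unique_mem.2 ⟨heW, fun x hx => ?_⟩)
      exact (Set.ncard_le_one (Set.toFinite _)).1 (by omega) x hx e heW
    have hF : IsForcingSet G M' (S \ W ∪ {s(U 5, V 5), s(U 0, U 2), s(V 3, V 4)}) := by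
      refine ⟨Set.union_subset hSW (Set.insert_subset d2 (Set.insert_subset h02'
        (Set.singleton_subset_iff.2 d4))), ?_⟩
      intro N hN hSN
      obtain ⟨hSN, hT⟩ := Set.union_subset_iff.1 hSN
      simp only [Set.insert_subset_iff, Set.singleton_subset_iff] at hT
      obtain ⟨t1, t2, t3⟩ := hT
      have U3 := h.exists_U hN 3
      have U0' := h.not_mem_U hN 0
      have U2' := h.not_mem_U hN 2
      have U5' := h.not_mem_U hN 5
      have V0 := h.exists_V hN 0
      have V2 := h.exists_V hN 2
      have V1' := h.not_mem_V hN 1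
      have V3' := h.not_mem_V hN 3
      norm_num only at U3 U0' U2' U5' V0 V2 V1' V3'
      have y1 : s(V 1, V 2) ∈ N.edgeSet :=
        V2.resolve_right fun hx => hx.elim (fun hx => V3'.1 ⟨hx, t3⟩) fun hx => U2'.2.1 ⟨t2, hx⟩
      have x1 : s(U 1, U 3) ∈ N.edgeSet :=
        U3.resolve_right fun hx => hx.elim (fun hx => U5'.2.1 ⟨hx, t1⟩) fun hx => V3'.2.2 ⟨t3, hx⟩
      have ym : s(V (-1), V 0) ∈ N.edgeSet :=
        V0.resolve_right fun hx => hx.elim (fun hx => V1'.1 ⟨hx, y1⟩) fun hx => U0'.2.2 ⟨t2, hx⟩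
      refine h.eq_of_dcPart_subset hS hdc hM' hE hN (fun x hx => ?_) ?_
      · by_cases hxW : x ∈ W
        · rcases hxW with (rfl | rfl) | hx'
          · exact Or.inr t2
          · exact Or.inr ym
          · exact Or.inl hx'
        · exact Or.inr (hSN ⟨hx, hxW⟩)
      · simp [dcPart, Set.insert_subset_iff, -Subgraph.mem_edgeSet, x1, t1, y1, t3]
    have h1 := hF.forcingNumber_le
    have h2 := Set.ncard_union_le (S \ W) {s(U 5, V 5), s(U 0, U 2), s(V 3, V 4)}
    have h3 := Set.ncard_insert_le s(U 5, V 5) {s(U 0, U 2), s(V 3, V 4)}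
    have h4 := Set.ncard_insert_le s(U 0, U 2) {s(V 3, V 4)}
    rw [Set.ncard_singleton] at h4
    omega

end IsPetersenChart

lemma ZMod.add_intCast_inj {n : ℕ} (i : ZMod n) {a b : ℤ} (hab : (a - b).natAbs < n) :
    i + (a : ZMod n) = i + b ↔ a = b := by
  rw [add_right_inj, ZMod.intCast_eq_intCast_iff_dvd_sub]
  refine ⟨fun hd => ?_, fun hd => by simp [hd]⟩
  have := Int.eq_zero_of_dvd_of_natAbs_lt_natAbs hd (by omega)
  omega

lemma ZMod.ne_and_eq_add_iff {n : ℕ} {c : ℕ} (hc : c ≠ 0) (hcn : c < n) (x w : ZMod n) :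
    x ≠ w ∧ (w = x + c ∨ x = w + c) ↔ w = x - c ∨ w = x + c := by
  have h0 : (c : ZMod n) ≠ 0 := fun h =>
    hcn.not_ge (Nat.le_of_dvd (Nat.pos_of_ne_zero hc) ((ZMod.natCast_eq_zero_iff c n).1 h))
  rw [eq_sub_iff_add_eq, eq_comm (a := w + c)]
  constructor
  · tauto
  · rintro (rfl | rfl) <;> simp [h0]

lemma petersen_isPetersenChart {n : ℕ} (hn : 37 ≤ n) (i : ZMod n) :
    IsPetersenChart (petersen n) (fun k : ℤ => pu (i + k)) (fun k : ℤ => pv (i + k)) where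
  adj_U k w := by
    rcases w with w | w
    · simpa [petersen, pu, pv, add_assoc, add_sub_assoc] using
        ZMod.ne_and_eq_add_iff two_ne_zero (by omega) (i + (k : ZMod n)) w
    · simp [petersen, pu, pv]
  adj_V k w := by
    rcases w with w | w
    · simp [petersen, pu, pv, eq_comm]
    · simpa [petersen, pu, pv, add_assoc, add_sub_assoc] using
        ZMod.ne_and_eq_add_iff one_ne_zero (by omega) (i + (k : ZMod n)) w
  U_inj a b hab := by
    simpa [pu] using ZMod.add_intCast_inj i (show (a - b).natAbs < n by omega)
  V_inj a b hab := by
    simpa [pv] using ZMod.add_intCast_inj i (show (a - b).natAbs < n by omega)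
  U_ne_V a b := Sum.inl_ne_inr

/-- transforming a chain `CD` into `DC` changes the forcing number by at
most one. `M1` is a type-2 perfect matching with a block `C` at positions `i,i+1,i+2`
immediately followed by a block `D` at positions `i+3,…,i+6`; `M2` is the symmetric
difference of `M1` with the alternating 8-cycle `cycCD n i`. -/
theorem CD_transform_forcing (n : ℕ) (hn : 37 ≤ n) (i : ZMod n)
    (M1 M2 : (petersen n).Subgraph)
    (hM1 : M1.IsPerfectMatching) (hT1 : IsType2 M1)
    (hC : blockC n i ⊆ M1.edgeSet)
    (hD : blockD n (i + 3) ⊆ M1.edgeSet)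
    (hM2 : M2.IsPerfectMatching)
    (hE2 : M2.edgeSet = symmDiff M1.edgeSet (cycCD n i)) :
    |(forcingNumber (petersen n) M1 : ℤ) - (forcingNumber (petersen n) M2 : ℤ)| ≤ 1 := by
  have h := petersen_isPetersenChart hn i
  set U : ℤ → PV n := fun k => pu (i + k)
  set V : ℤ → PV n := fun k => pv (i + k)
  have : NeZero n := ⟨by omega⟩
  simp only [blockC, blockD, Set.insert_subset_iff, Set.singleton_subset_iff, add_assoc] at hC hD
  norm_num only at hC hD
  have e02 : s(U 0, U 2) ∈ M1.edgeSet := by simpa [U] using hC.1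
  have e11 : s(U 1, V 1) ∈ M1.edgeSet := by simpa [U, V] using hC.2.1
  have e10 : s(V (-1), V 0) ∈ M1.edgeSet := by
    have h0 := h.exists_V hM1 0
    have h1 := h.not_mem_V hM1 1
    have h2 := h.not_mem_U hM1 0
    norm_num only at h0 h1 h2
    tauto
  have e64 : s(U 6, U 4) ∈ M1.edgeSet := by rw [Sym2.eq_swap]; simpa [U] using hD.2.1
  have e76 : s(V 7, V 6) ∈ M1.edgeSet := by rw [Sym2.eq_swap]; simpa [V] using hD.2.2.2
  have hcd : IsPetersenChart.cdPart U V ⊆ M1.edgeSet := by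
    simp only [IsPetersenChart.cdPart, Set.insert_subset_iff, Set.singleton_subset_iff]
    exact ⟨e11, by simpa [U] using hD.1, by simpa [V] using hC.2.2, by simpa [V] using hD.2.2.1⟩
  have hcyc : cycCD n i = IsPetersenChart.cdPart U V ∪ IsPetersenChart.dcPart U V := by
    rw [cycCD, Sym2.eq_swap (a := pv (i + 5)) (b := pv (i + 4)),
      Sym2.eq_swap (a := pv (i + 4)) (b := pv (i + 3)),
      Sym2.eq_swap (a := pv (i + 3)) (b := pv (i + 2)),
      Sym2.eq_swap (a := pv (i + 2)) (b := pv (i + 1)), Sym2.eq_swap (a := pv (i + 1)) (b := pu (i + 1))]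
    ext e
    simp [IsPetersenChart.cdPart, IsPetersenChart.dcPart, U, V]
    tauto
  have hdc := h.disjoint_dcPart hM1 hcd
  have hE : M2.edgeSet =
      M1.edgeSet \ IsPetersenChart.cdPart U V ∪ IsPetersenChart.dcPart U V := by
    rw [hE2, hcyc, Set.symmDiff_def, ← Set.sdiff_sdiff, sdiff_sdiff_comm, hdc.symm.sdiff_eq_left,
      Set.union_sdiff_distrib, Set.sdiff_eq_empty.2 hcd, Set.empty_union, hdc.sdiff_eq_left]
  have hE' : M1.edgeSet =
      M2.edgeSet \ IsPetersenChart.dcPart U V ∪ IsPetersenChart.cdPart U V := by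
    rw [hE, Set.union_sdiff_right, (hdc.symm.mono_left Set.sdiff_subset).sdiff_eq_left,
      Set.sdiff_union_of_subset hcd]
  have h12 := h.forcingNumber_le_add_one hM1 hM2 hcd e02 e10 hE
  have h21 := (h.reflect 6).forcingNumber_le_add_one hM2 hM1
    (by rw [IsPetersenChart.cdPart_reflect, hE]; exact Set.subset_union_right)
    (by
      norm_num only
      rw [hE]
      refine Or.inl ⟨e64, ?_⟩
      simp [IsPetersenChart.cdPart, h.U_inj, h.U_ne_V])
    (by
      norm_num only
      rw [hE]
      refine Or.inl ⟨e76, ?_⟩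
      simp [IsPetersenChart.cdPart, h.V_inj, (h.U_ne_V _ _).symm])
    (by rwa [IsPetersenChart.cdPart_reflect, IsPetersenChart.dcPart_reflect])
  rw [abs_le]
  omega
end
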